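/- arXiv:2510.03084 — 2 statements merged into one kernel-verified Lean document; each statement's English description precedes it below -/
import Mathlib

section
/- For every integer k ≥ 3 there exist constants C, c > 0 such that for all sufficiently large n and all p with p > C n^{-1/(k-1)}, the binomial random set [n]_p is can-k-vdW with probability at least 1 − e^{−c n p}. -/
/-- `A` contains the `k`-term arithmetic progression with first term `a` and
common difference `d ≥ 1`. -/
def APIn (k : ℕ) (A : Finset ℕ) (a d : ℕ) : Prop :=
  1 ≤ d ∧ ∀ i < k, a + i * d ∈ A

/-- The colouring `χ` is constant on the `k`-AP with first term `a` and difference `d`. -/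
def MonoOn (k : ℕ) (χ : ℕ → ℕ) (a d : ℕ) : Prop :=
  ∀ i < k, ∀ j < k, χ (a + i * d) = χ (a + j * d)

/-- The colouring `χ` is injective (rainbow) on the `k`-AP with first term `a`
and difference `d`. -/
def RainbowOn (k : ℕ) (χ : ℕ → ℕ) (a d : ℕ) : Prop :=
  ∀ i < k, ∀ j < k, i ≠ j → χ (a + i * d) ≠ χ (a + j * d)

/-- `A` has the canonical van der Waerden property for `k`-APs: every colouring of `A`
admits a monochromatic or rainbow `k`-AP contained in `A`. -/
def IsCanVdW (k : ℕ) (A : Finset ℕ) : Prop :=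
  ∀ χ : ℕ → ℕ, ∃ a d : ℕ, APIn k A a d ∧ (MonoOn k χ a d ∨ RainbowOn k χ a d)

open scoped Classical in
/-- The probability that the binomial random subset `[n]_p` of `{1,…,n}` (each element kept
independently with probability `p`) satisfies the predicate `P`. -/
noncomputable def binomProb (n : ℕ) (p : ℝ) (P : Finset ℕ → Prop) : ℝ :=
  ∑ A ∈ (Finset.Icc 1 n).powerset,
    if P A then p ^ A.card * (1 - p) ^ (n - A.card) else 0

/-- The canonical van der Waerden theorem, finite form. -/
theorem exists_canonical_vdw (k : ℕ) :
    ∃ M : ℕ, 1 ≤ M ∧ ∀ χ : ℕ → ℕ, ∃ a d : ℕ, 1 ≤ d ∧ (∀ i < k, a + i * d < M) ∧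
      (MonoOn k χ a d ∨ RainbowOn k χ a d) := by
  classical
  set R := k * k with hR
  obtain ⟨ι, _inst, hι⟩ := Combinatorics.Line.exists_mono_in_high_dimension
    (Fin (R + 1) × Fin (R + 1)) (Fin k → Fin k → Prop)
  refine ⟨Fintype.card ι * R + k * (Fintype.card ι * R + 1) + 1, by omega, fun χ => ?_⟩
  obtain ⟨l, c, hl⟩ := hι fun v => fun i j =>
    χ ((∑ t, (v t).1.val) + i * (1 + ∑ t, (v t).2.val)) =
      χ ((∑ t, (v t).1.val) + j * (1 + ∑ t, (v t).2.val))
  set s : Finset ι := {i | l.idxFun i = none} with hs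
  have hspos : 0 < s.card :=
    Finset.card_pos.mpr ⟨l.proper.choose, by simpa [hs] using l.proper.choose_spec⟩
  have key : ∀ g : Fin (R + 1) × Fin (R + 1) → ℕ, ∃ b : ℕ, ∀ x,
      ∑ t, g (l x t) = s.card * g x + b := by
    intro g
    refine ⟨∑ t ∈ sᶜ, ((l.idxFun t).map g).getD 0, fun x => ?_⟩
    rw [← Finset.sum_add_sum_compl s]
    congr 1
    · rw [← smul_eq_mul, ← Finset.sum_const]
      apply Finset.sum_congr rfl
      intro i hi
      rw [hs, Finset.mem_filter] at hi
      rw [l.apply_none _ _ hi.right]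
    · apply Finset.sum_congr rfl
      intro i hi
      rw [hs, Finset.compl_filter, Finset.mem_filter] at hi
      obtain ⟨y, hy⟩ := Option.ne_none_iff_exists.mp hi.right
      simp [← hy]
  obtain ⟨a₀, ha₀⟩ := key (fun x => x.1.val)
  obtain ⟨d₀, hd₀⟩ := key (fun x => x.2.val)
  have hbd : ∀ g : Fin (R + 1) × Fin (R + 1) → Fin (R + 1), ∀ x,
      ∑ t, (g (l x t)).val ≤ Fintype.card ι * R := by
    intro g x
    calc ∑ t, (g (l x t)).val ≤ ∑ _t : ι, R :=
          Finset.sum_le_sum fun t _ => by have := (g (l x t)).isLt; omega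
      _ = _ := by simp
  have hlt : ∀ x : Fin (R + 1) × Fin (R + 1), ∀ i < k, (s.card * x.1.val + a₀) + i * (1 + (s.card * x.2.val + d₀)) <
      Fintype.card ι * R + k * (Fintype.card ι * R + 1) + 1 := by
    intro x i hi
    have h1 := hbd Prod.fst x
    have h2 := hbd Prod.snd x
    rw [ha₀ x] at h1
    rw [hd₀ x] at h2
    have : i * (1 + (s.card * x.2.val + d₀)) ≤ k * (Fintype.card ι * R + 1) :=
      Nat.mul_le_mul hi.le (by omega)
    omega
  have hpat : ∀ x : Fin (R + 1) × Fin (R + 1), ∀ i j : Fin k,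
      (χ ((s.card * x.1.val + a₀) + i * (1 + (s.card * x.2.val + d₀))) =
        χ ((s.card * x.1.val + a₀) + j * (1 + (s.card * x.2.val + d₀)))) ↔ c i j := by
    intro x i j
    have := congrFun (congrFun (hl x) i) j
    simp only [ha₀ x, hd₀ x] at this
    exact iff_of_eq this
  by_cases hE : ∃ i j : Fin k, i < j ∧ c i j
  · obtain ⟨i, j, hij, hc⟩ := hE
    have hij' : i.val < j.val := hij
    obtain ⟨e, he⟩ := Nat.exists_eq_add_of_lt hij'
    have hk : 1 ≤ k := by have := i.isLt; omega
    have hx : ∀ y < k, i.val * (k - 1 - y) < R + 1 ∧ y < R + 1 := by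
      intro y hy
      constructor
      · have : i.val * (k - 1 - y) ≤ k * k := Nat.mul_le_mul i.isLt.le (by omega)
        omega
      · nlinarith
    have hform : ∀ y < k,
        (s.card * (i.val * (k - 1 - y)) + a₀) + j.val * (1 + (s.card * y + d₀)) =
        (s.card * (i.val * (k - 1)) + a₀ + j.val * (1 + d₀)) + y * ((e + 1) * s.card) := by
      intro y hy
      obtain ⟨z, hz⟩ : ∃ z, k - 1 = y + z := ⟨k - 1 - y, by omega⟩
      rw [hz, Nat.add_sub_cancel_left, he]
      ring
    have hcol : ∀ y < k,
        χ ((s.card * (i.val * (k - 1)) + a₀ + j.val * (1 + d₀)) + y * ((e + 1) * s.card)) =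
        χ (s.card * (i.val * (k - 1)) + a₀ + i.val * (1 + d₀)) := by
      intro y hy
      have h := (hpat (⟨i.val * (k - 1 - y), (hx y hy).1⟩, ⟨y, (hx y hy).2⟩) i j).2 hc
      simp only at h
      rw [hform y hy] at h
      rw [← h]
      congr 1
      obtain ⟨z, hz⟩ : ∃ z, k - 1 = y + z := ⟨k - 1 - y, by omega⟩
      rw [hz, Nat.add_sub_cancel_left]
      ring
    refine ⟨s.card * (i.val * (k - 1)) + a₀ + j.val * (1 + d₀), (e + 1) * s.card,
      Nat.mul_pos (by omega) hspos, fun y hy => ?_, Or.inl fun y hy z hz => ?_⟩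
    · rw [← hform y hy]
      exact hlt (⟨i.val * (k - 1 - y), (hx y hy).1⟩, ⟨y, (hx y hy).2⟩) j j.isLt
    · rw [hcol y hy, hcol z hz]
  · push Not at hE
    refine ⟨s.card * 0 + a₀, 1 + (s.card * 0 + d₀), by omega, fun i hi => ?_, Or.inr ?_⟩
    · simpa using hlt (0, 0) i hi
    · intro i hi j hj hij
      rcases Nat.lt_or_gt_of_ne hij with h | h
      · intro hh
        exact hE ⟨i, hi⟩ ⟨j, hj⟩ h ((hpat (0, 0) ⟨i, hi⟩ ⟨j, hj⟩).1 (by simpa using hh))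
      · intro hh
        exact hE ⟨j, hj⟩ ⟨i, hi⟩ h ((hpat (0, 0) ⟨j, hj⟩ ⟨i, hi⟩).1 (by simpa using hh.symm))

/-- A family of fingerprint/container pairs `(S, C)` with `q`-weight at most `W`, such that every
`I` satisfying `J` has a pair with `S ⊆ I`, `I \ S ⊆ C` and `P C`. -/
def HasContainers {V : Type} [DecidableEq V] (q W : ℝ) (J P : Finset V → Prop) : Prop :=
  ∃ F : Finset (Finset V × Finset V), ∑ x ∈ F, q ^ x.1.card ≤ W ∧
    ∀ I, J I → ∃ x ∈ F, x.1 ⊆ I ∧ I \ x.1 ⊆ x.2 ∧ P x.2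

theorem HasContainers.comp {V α : Type} [DecidableEq V] {q W₁ W₂ : ℝ} (hq : 0 ≤ q)
    (hW₂ : 0 ≤ W₂) {J P : Finset V → Prop} (A : Finset α) (S : α → Finset V)
    (hW : ∑ a ∈ A, q ^ (S a).card ≤ W₁) (J' : α → Finset V → Prop)
    (hc : ∀ a ∈ A, HasContainers q W₂ (J' a) P)
    (hJ : ∀ I, J I → ∃ a ∈ A, S a ⊆ I ∧ J' a (I \ S a)) :
    HasContainers q (W₁ * W₂) J P := by
  classical
  have hc' : ∀ a : α, ∃ F : Finset (Finset V × Finset V), a ∈ A →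
      (∑ x ∈ F, q ^ x.1.card ≤ W₂ ∧
        ∀ I, J' a I → ∃ x ∈ F, x.1 ⊆ I ∧ I \ x.1 ⊆ x.2 ∧ P x.2) := by
    intro a
    by_cases ha : a ∈ A
    · obtain ⟨F, hF⟩ := hc a ha
      exact ⟨F, fun _ => hF⟩
    · exact ⟨∅, fun h => absurd h ha⟩
  choose F hF using hc'
  refine ⟨((A.sigma F).filter fun y => Disjoint (S y.1) y.2.1).image
    fun y => (S y.1 ∪ y.2.1, y.2.2), ?_, ?_⟩
  · refine (Finset.sum_image_le_of_nonneg fun u _ => pow_nonneg hq _).trans ?_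
    calc _ = ∑ y ∈ (A.sigma F).filter (fun y => Disjoint (S y.1) y.2.1),
            q ^ (S y.1).card * q ^ y.2.1.card := by
          refine Finset.sum_congr rfl fun y hy => ?_
          rw [Finset.card_union_of_disjoint (Finset.mem_filter.1 hy).2, pow_add]
      _ ≤ ∑ y ∈ A.sigma F, q ^ (S y.1).card * q ^ y.2.1.card :=
          Finset.sum_le_sum_of_subset_of_nonneg (Finset.filter_subset _ _)
            fun _ _ _ => by positivity
      _ = ∑ a ∈ A, q ^ (S a).card * ∑ x ∈ F a, q ^ x.1.card := by
          rw [Finset.sum_sigma]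
          simp_rw [Finset.mul_sum]
      _ ≤ ∑ a ∈ A, q ^ (S a).card * W₂ :=
          Finset.sum_le_sum fun a ha =>
            mul_le_mul_of_nonneg_left (hF a ha).1 (pow_nonneg hq _)
      _ ≤ W₁ * W₂ := by
          rw [← Finset.sum_mul]
          exact mul_le_mul_of_nonneg_right hW hW₂
  · intro I hI
    obtain ⟨a, ha, hSI, hJa⟩ := hJ I hI
    obtain ⟨x, hx, hxI, hxC, hP⟩ := (hF a ha).2 _ hJa
    have hdis : Disjoint (S a) x.1 :=
      (Finset.disjoint_sdiff).mono_right hxI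
    refine ⟨(S a ∪ x.1, x.2), Finset.mem_image.2 ⟨⟨a, x⟩, ?_, rfl⟩, ?_, ?_, hP⟩
    · simp [ha, hx, hdis]
    · exact Finset.union_subset hSI (hxI.trans Finset.sdiff_subset)
    · exact fun v hv => hxC (by simp at hv ⊢; tauto)

theorem HasContainers.single {V : Type} [DecidableEq V] {q W : ℝ} (hW : 1 ≤ W)
    {J P : Finset V → Prop} (C : Finset V) (hP : P C) (hJ : ∀ I, J I → I ⊆ C) :
    HasContainers q W J P :=
  ⟨{(∅, C)}, by simpa using hW, fun I hI => ⟨(∅, C), by simp, by simp, by simpa using hJ I hI, hP⟩⟩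

/-- The number of edges of `H` containing `T`. -/
def codeg {V : Type} [DecidableEq V] (H : Finset (Finset V)) (T : Finset V) : ℕ :=
  (H.filter (T ⊆ ·)).card

/-- `I` is a subset of `X` containing no edge of `H`. -/
def IsIndepIn {V : Type} [DecidableEq V] (X : Finset V) (H : Finset (Finset V))
    (I : Finset V) : Prop :=
  I ⊆ X ∧ ∀ e ∈ H, ¬ e ⊆ I

/-- Double counting: the edges hit by saturated sets are few. -/
theorem card_filter_exists_saturated_le {V : Type} [DecidableEq V] (X : Finset V) (m : ℕ)
    {K Q : ℝ} (hK : 0 ≤ K) (hQ : 0 ≤ Q) (H G : Finset (Finset V)) (hH : ∀ e ∈ H, e ⊆ X)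
    (hG : ∀ e ∈ G, e ⊆ X ∧ e.card = m)
    (hd : ∀ T : Finset V, T.Nonempty → T.card ≤ m → (codeg H T : ℝ) ≤ K * Q ^ (m + 1 - T.card)) :
    ((H.filter fun e => ∃ T ⊆ e, T.Nonempty ∧ T.card ≤ m ∧
      Q ^ (m - T.card) ≤ (codeg G T : ℝ)).card : ℝ) ≤ K * Q * (2 ^ m * G.card) := by
  classical
  set B := X.powerset.filter fun T => T.Nonempty ∧ T.card ≤ m ∧
      Q ^ (m - T.card) ≤ (codeg G T : ℝ) with hB
  have h1 : (H.filter fun e => ∃ T ⊆ e, T.Nonempty ∧ T.card ≤ m ∧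
      Q ^ (m - T.card) ≤ (codeg G T : ℝ)) ⊆ B.biUnion fun T => H.filter (T ⊆ ·) := by
    intro e he
    obtain ⟨he, T, hT, h⟩ := Finset.mem_filter.1 he
    refine Finset.mem_biUnion.2 ⟨T, ?_, Finset.mem_filter.2 ⟨he, hT⟩⟩
    exact Finset.mem_filter.2 ⟨Finset.mem_powerset.2 (hT.trans (hH e he)), h⟩
  have h2 : ∑ T ∈ X.powerset, codeg G T = G.card * 2 ^ m := by
    have := Finset.sum_card_bipartiteAbove_eq_sum_card_bipartiteBelow
      (fun (T e : Finset V) => T ⊆ e) (s := X.powerset) (t := G)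
    simp only [Finset.bipartiteAbove, Finset.bipartiteBelow] at this
    unfold codeg
    rw [this, ← smul_eq_mul, ← Finset.sum_const]
    refine Finset.sum_congr rfl fun e he => ?_
    have : (X.powerset.filter fun T => T ⊆ e) = e.powerset := by
      ext T
      simp only [Finset.mem_filter, Finset.mem_powerset]
      exact ⟨fun h => h.2, fun h => ⟨h.trans (hG e he).1, h⟩⟩
    rw [this, Finset.card_powerset, (hG e he).2]
  calc _ ≤ ((B.biUnion fun T => H.filter (T ⊆ ·)).card : ℝ) := by
        exact_mod_cast Finset.card_le_card h1
    _ ≤ ∑ T ∈ B, (codeg H T : ℝ) := by exact_mod_cast Finset.card_biUnion_le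
    _ ≤ ∑ T ∈ B, K * Q * (codeg G T : ℝ) := by
        refine Finset.sum_le_sum fun T hT => ?_
        obtain ⟨-, hne, hcard, hsat⟩ := Finset.mem_filter.1 hT
        refine (hd T hne hcard).trans ?_
        rw [Nat.sub_add_comm hcard, pow_succ]
        calc K * (Q ^ (m - T.card) * Q) = K * Q * Q ^ (m - T.card) := by ring
          _ ≤ _ := mul_le_mul_of_nonneg_left hsat (by positivity)
    _ ≤ ∑ T ∈ X.powerset, K * Q * (codeg G T : ℝ) :=
        Finset.sum_le_sum_of_subset_of_nonneg (Finset.filter_subset _ _)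
          fun _ _ _ => by positivity
    _ = K * Q * (2 ^ m * G.card) := by
        rw [← Finset.mul_sum]
        congr 1
        rw [mul_comm]
        exact_mod_cast h2

/-- `S` supports an `m`-uniform hypergraph of bounded codegrees with exactly `t` edges per vertex
of `S`, each of them a link edge in `H` of a vertex of `S`. -/
def IsGoodFingerprint {V : Type} [DecidableEq V] (X : Finset V) (H : Finset (Finset V))
    (m t : ℕ) (K Q : ℝ) (S : Finset V) : Prop :=
  ∃ G : Finset (Finset V), (∀ f ∈ G, f ⊆ X ∧ f.card = m) ∧ (∀ f ∈ G, ∃ v ∈ S, insert v f ∈ H) ∧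
    (∀ T : Finset V, T.Nonempty → (codeg G T : ℝ) ≤ (K + 1) * Q ^ (m - T.card)) ∧
    G.card = S.card * t

/-- The edges of `H` containing no set that is saturated in `G`. -/
noncomputable def unsaturated {V : Type} [DecidableEq V] (H G : Finset (Finset V)) (m : ℕ)
    (Q : ℝ) : Finset (Finset V) := by
  classical
  exact H.filter fun e => ¬ ∃ T ⊆ e, T.Nonempty ∧ T.card ≤ m ∧ Q ^ (m - T.card) ≤ (codeg G T : ℝ)

theorem IsGoodFingerprint.insert {V : Type} [DecidableEq V] {X : Finset V}
    {H G : Finset (Finset V)} {m t : ℕ} {K Q : ℝ} (hm : 1 ≤ m)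
    (hH : ∀ e ∈ H, e ⊆ X ∧ e.card = m + 1)
    (hd : ∀ T : Finset V, T.Nonempty → (codeg H T : ℝ) ≤ K * Q ^ (m + 1 - T.card))
    {S : Finset V} (hG : ∀ f ∈ G, f ⊆ X ∧ f.card = m) (hGS : ∀ f ∈ G, ∃ v ∈ S, insert v f ∈ H)
    (hGd : ∀ T : Finset V, T.Nonempty → (codeg G T : ℝ) ≤ (K + 1) * Q ^ (m - T.card))
    (hGc : G.card = S.card * t) {v : V} (hv : v ∉ S)
    (ht : t ≤ codeg (unsaturated H G m Q) {v}) :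
    IsGoodFingerprint X H m t K Q (insert v S) := by
  classical
  obtain ⟨N, hN, hNt⟩ := Finset.exists_subset_card_eq ht
  have hN1 : ∀ e ∈ N, e ∈ H ∧ v ∈ e ∧
      ∀ T ⊆ e, T.Nonempty → T.card ≤ m → (codeg G T : ℝ) < Q ^ (m - T.card) := by
    intro e he
    have := hN he
    simp only [unsaturated, Finset.mem_filter, Finset.singleton_subset_iff] at this
    refine ⟨this.1.1, this.2, fun T hT hne hc => ?_⟩
    by_contra hcon
    exact this.1.2 ⟨T, hT, hne, hc, not_lt.1 hcon⟩
  have hinj : Set.InjOn (fun e : Finset V => e.erase v) (N : Set (Finset V)) := by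
    intro e he e' he' h
    have h1 := Finset.insert_erase (hN1 e he).2.1
    have h2 := Finset.insert_erase (hN1 e' he').2.1
    simp only at h
    rw [← h1, h, h2]
  have hecard : ∀ e ∈ N, (e.erase v).card = m := by
    intro e he
    rw [Finset.card_erase_of_mem (hN1 e he).2.1, (hH e (hN1 e he).1).2]
    rfl
  set L := N.image fun e => e.erase v with hL
  have hLc : L.card = t := by rw [hL, Finset.card_image_of_injOn hinj, hNt]
  have hdis : Disjoint G L := by
    rw [Finset.disjoint_left]
    intro f hf hfL
    obtain ⟨e, he, rfl⟩ := Finset.mem_image.1 hfL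
    have hc := hecard e he
    have h1 := (hN1 e he).2.2 (e.erase v) (Finset.erase_subset _ _)
      (Finset.card_pos.1 (by omega)) hc.le
    rw [hc, Nat.sub_self, pow_zero] at h1
    have h2 : 0 < codeg G (e.erase v) :=
      Finset.card_pos.2 ⟨_, Finset.mem_filter.2 ⟨hf, subset_rfl⟩⟩
    have h3 : codeg G (e.erase v) < 1 := by exact_mod_cast h1
    omega
  refine ⟨G ∪ L, ?_, ?_, ?_, ?_⟩
  · intro f hf
    rcases Finset.mem_union.1 hf with hf | hf
    · exact hG f hf
    · obtain ⟨e, he, rfl⟩ := Finset.mem_image.1 hf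
      exact ⟨(Finset.erase_subset _ _).trans (hH e (hN1 e he).1).1, hecard e he⟩
  · intro f hf
    rcases Finset.mem_union.1 hf with hf | hf
    · obtain ⟨u, hu, h⟩ := hGS f hf
      exact ⟨u, Finset.mem_insert_of_mem hu, h⟩
    · obtain ⟨e, he, rfl⟩ := Finset.mem_image.1 hf
      exact ⟨v, Finset.mem_insert_self _ _, by
        rw [Finset.insert_erase (hN1 e he).2.1]; exact (hN1 e he).1⟩
  · intro T hT
    have hsum : codeg (G ∪ L) T ≤ codeg G T + codeg L T := by
      unfold codeg
      rw [Finset.filter_union]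
      exact Finset.card_union_le _ _
    have hsum' : (codeg (G ∪ L) T : ℝ) ≤ codeg G T + codeg L T := by exact_mod_cast hsum
    by_cases hz : codeg L T = 0
    · rw [hz] at hsum'
      push_cast at hsum'
      linarith [hGd T hT]
    · obtain ⟨f, hf⟩ := Finset.card_pos.1 (Nat.pos_of_ne_zero hz)
      obtain ⟨hf, hTf⟩ := Finset.mem_filter.1 hf
      obtain ⟨e, he, rfl⟩ := Finset.mem_image.1 hf
      have hTm : T.card ≤ m := (Finset.card_le_card hTf).trans (hecard e he).le
      have hvT : v ∉ T := fun h => Finset.notMem_erase v e (hTf h)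
      have h1 := (hN1 e he).2.2 T (hTf.trans (Finset.erase_subset _ _)) hT hTm
      have h2 : codeg L T ≤ codeg H (Insert.insert v T) := by
        unfold codeg
        refine Finset.card_le_card_of_injOn (fun f => Insert.insert v f) ?_ ?_
        · intro f hf
          obtain ⟨hf, hTf⟩ := Finset.mem_filter.1 hf
          obtain ⟨e, he, rfl⟩ := Finset.mem_image.1 hf
          refine Finset.mem_filter.2 ⟨?_, Finset.insert_subset_insert _ hTf⟩
          change Insert.insert v (e.erase v) ∈ H
          rw [Finset.insert_erase (hN1 e he).2.1]
          exact (hN1 e he).1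
        · intro f hf f' hf' h
          have hvf : ∀ f ∈ (L.filter (T ⊆ ·) : Finset (Finset V)), v ∉ f := by
            intro f hf
            obtain ⟨hf, -⟩ := Finset.mem_filter.1 hf
            obtain ⟨e, he, rfl⟩ := Finset.mem_image.1 hf
            exact Finset.notMem_erase v e
          have := congrArg (fun s => Finset.erase s v) h
          simpa [Finset.erase_insert (hvf f hf), Finset.erase_insert (hvf f' hf')] using this
      have h3 := hd (Insert.insert v T) (Finset.insert_nonempty _ _)
      rw [Finset.card_insert_of_notMem hvT, Nat.add_sub_add_right] at h3
      have h2' : (codeg L T : ℝ) ≤ codeg H (Insert.insert v T) := by exact_mod_cast h2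
      linarith
  · rw [Finset.card_union_of_disjoint hdis, hGc, hLc, Finset.card_insert_of_notMem hv]
    ring

/-- Many vertices extend a small good fingerprint. -/
theorem card_large_unsaturated_degree {V : Type} [DecidableEq V] (X : Finset V) {m t : ℕ}
    {K Q ε c N : ℝ} (hK : 1 ≤ K) (hQ : 0 < Q) (hN : 0 ≤ N) (hXN : (X.card : ℝ) ≤ N)
    {H G : Finset (Finset V)}
    (hH : ∀ e ∈ H, e ⊆ X ∧ e.card = m + 1) (hG : ∀ e ∈ G, e ⊆ X ∧ e.card = m)
    (hd : ∀ T : Finset V, T.Nonempty → (codeg H T : ℝ) ≤ K * Q ^ (m + 1 - T.card))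
    (hc : c * (8 * 2 ^ m * K) ≤ ε)
    (hc0 : 0 ≤ c) (ht : (t : ℝ) ≤ 2 * c * Q ^ m)
    (hHc : ε * N * Q ^ m ≤ (H.card : ℝ)) (hGc : (G.card : ℝ) * Q ≤ 2 * c * N * Q ^ m) :
    ε / (4 * K) * N ≤ ((X.filter fun v => t ≤ codeg (unsaturated H G m Q) {v}).card : ℝ) := by
  classical
  set U := unsaturated H G m Q with hU
  set Z := X.filter fun v => t ≤ codeg U {v} with hZ
  have hUH : U ⊆ H := by rw [hU]; unfold unsaturated; exact Finset.filter_subset _ _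
  have h1 := card_filter_exists_saturated_le X m (by linarith : 0 ≤ K) hQ.le H G
    (fun e he => (hH e he).1) hG (fun T hT _ => hd T hT)
  have h2 : (H.card : ℝ) = ((H.filter fun e => ∃ T ⊆ e, T.Nonempty ∧ T.card ≤ m ∧
      Q ^ (m - T.card) ≤ (codeg G T : ℝ)).card : ℝ) + U.card := by
    rw [hU]; unfold unsaturated
    exact_mod_cast (Finset.card_filter_add_card_filter_not _).symm
  have hQm : 0 < Q ^ m := pow_pos hQ m
  have h3 : ε / 2 * N * Q ^ m ≤ U.card := by
    have : K * Q * (2 ^ m * (G.card : ℝ)) ≤ ε / 2 * N * Q ^ m := by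
      calc K * Q * (2 ^ m * (G.card : ℝ)) = K * 2 ^ m * (G.card * Q) := by ring
        _ ≤ K * 2 ^ m * (2 * c * N * Q ^ m) := by gcongr
        _ = (c * (8 * 2 ^ m * K)) * (N * Q ^ m) / 4 := by ring
        _ ≤ ε * (N * Q ^ m) / 4 := by gcongr
        _ ≤ ε / 2 * N * Q ^ m := by
          have hε : 0 ≤ ε := le_trans (by positivity) hc
          have : 0 ≤ ε * (N * Q ^ m) := by positivity
          linarith
    linarith
  have h4 : U.card ≤ ∑ v ∈ X, codeg U {v} := by
    have := Finset.sum_card_bipartiteAbove_eq_sum_card_bipartiteBelow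
      (fun (v : V) (e : Finset V) => {v} ⊆ e) (s := X) (t := U)
    simp only [Finset.bipartiteAbove, Finset.bipartiteBelow] at this
    unfold codeg
    rw [this, Finset.card_eq_sum_ones]
    refine Finset.sum_le_sum fun e he => Finset.card_pos.2 ?_
    obtain ⟨heX, hec⟩ := hH e (hUH he)
    obtain ⟨v, hv⟩ := Finset.card_pos.1 (by omega : 0 < e.card)
    exact ⟨v, by simp [hv, heX hv]⟩
  have h5 : ∀ v, (codeg U {v} : ℝ) ≤ K * Q ^ m := by
    intro v
    have : codeg U {v} ≤ codeg H {v} :=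
      Finset.card_le_card (Finset.filter_subset_filter _ hUH)
    have h := hd {v} (Finset.singleton_nonempty v)
    simp only [Finset.card_singleton, Nat.add_sub_cancel] at h
    exact le_trans (by exact_mod_cast this) h
  have h6 : (∑ v ∈ X, (codeg U {v} : ℝ)) ≤ Z.card * (K * Q ^ m) + N * (2 * c * Q ^ m) := by
    rw [← Finset.sum_filter_add_sum_filter_not X (fun v => t ≤ codeg U {v})]
    refine add_le_add ?_ ?_
    · rw [← nsmul_eq_mul]
      exact Finset.sum_le_card_nsmul _ _ _ fun v _ => h5 v
    · calc _ ≤ ((X.filter fun v => ¬ t ≤ codeg U {v}).card) • (2 * c * Q ^ m) := by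
            refine Finset.sum_le_card_nsmul _ _ _ fun v hv => ?_
            have : codeg U {v} ≤ t := by have := (Finset.mem_filter.1 hv).2; omega
            exact le_trans (by exact_mod_cast this) ht
        _ ≤ N * (2 * c * Q ^ m) := by
            rw [nsmul_eq_mul]
            have : ((X.filter fun v => ¬ t ≤ codeg U {v}).card : ℝ) ≤ N :=
              le_trans (by exact_mod_cast Finset.card_filter_le _ _) hXN
            gcongr
  have h7 : (U.card : ℝ) ≤ ∑ v ∈ X, (codeg U {v} : ℝ) := by exact_mod_cast h4
  have h8 : 8 * c ≤ ε := by
    have : (1 : ℝ) ≤ 2 ^ m * K := one_le_mul_of_one_le_of_one_le (one_le_pow₀ (by norm_num)) hK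
    nlinarith
  have h9 : ε / 4 * N * Q ^ m ≤ Z.card * K * Q ^ m := by
    have : 8 * c * (N * Q ^ m) ≤ ε * (N * Q ^ m) := by gcongr
    linarith
  have h10 : ε / 4 * N ≤ Z.card * K := le_of_mul_le_mul_right h9 hQm
  rw [div_mul_eq_mul_div, div_le_iff₀ (by positivity)]
  linarith

theorem HasContainers.mono {V : Type} [DecidableEq V] {q W W' : ℝ} {J J' P P' : Finset V → Prop}
    (h : HasContainers q W J P) (hW : W ≤ W') (hJ : ∀ I, J' I → J I) (hP : ∀ C, P C → P' C) :
    HasContainers q W' J' P' := by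
  obtain ⟨F, hF, h⟩ := h
  refine ⟨F, hF.trans hW, fun I hI => ?_⟩
  obtain ⟨x, hx, h1, h2, h3⟩ := h I (hJ I hI)
  exact ⟨x, hx, h1, h2, hP _ h3⟩

/-- One step of the hypergraph container theorem: a hypergraph with balanced codegrees admits
containers missing a positive proportion of the vertices. -/
theorem exists_containers_missing (ℓ : ℕ) : ∀ K ε : ℝ, 1 ≤ K → 0 < ε →
    ∃ δ : ℝ, 0 < δ ∧ ∃ Q₀ : ℝ, 1 ≤ Q₀ ∧
      ∀ (V : Type) [DecidableEq V] (X : Finset V) (N Q q w : ℝ), Q₀ ≤ Q → 0 ≤ N →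
        (X.card : ℝ) ≤ N → 0 ≤ q → 1 ≤ w →
        (∑ S ∈ X.powerset.filter (fun S => S.card ≤ ⌈N / Q⌉₊), q ^ S.card ≤ w) →
        ∀ H : Finset (Finset V), (∀ e ∈ H, e ⊆ X ∧ e.card = ℓ + 1) →
          (∀ T : Finset V, T.Nonempty → (codeg H T : ℝ) ≤ K * Q ^ (ℓ + 1 - T.card)) →
          ε * N * Q ^ ℓ ≤ H.card →
          HasContainers q (w ^ ℓ) (IsIndepIn X H)
            (fun C => C ⊆ X ∧ (C.card : ℝ) + δ * N ≤ X.card) := by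
  classical
  induction ℓ with
  | zero =>
    intro K ε hK hε
    refine ⟨ε, hε, 1, le_rfl, ?_⟩
    intro V _ X N Q q w hQ hN hX hq hw hsum H hH hd hHc
    have hHsub : H ⊆ (X.filter fun v => {v} ∈ H).image fun v => ({v} : Finset V) := by
      intro e he
      obtain ⟨heX, hec⟩ := hH e he
      obtain ⟨v, rfl⟩ := Finset.card_eq_one.1 (by simpa using hec)
      exact Finset.mem_image.2 ⟨v, Finset.mem_filter.2 ⟨heX (by simp), he⟩, rfl⟩
    have h1 : H.card ≤ (X.filter fun v => {v} ∈ H).card :=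
      (Finset.card_le_card hHsub).trans Finset.card_image_le
    have h2 := Finset.card_filter_add_card_filter_not (s := X) (fun v => ({v} : Finset V) ∈ H)
    refine HasContainers.single (by simp) (X.filter fun v => ¬ {v} ∈ H)
      ⟨Finset.filter_subset _ _, ?_⟩ ?_
    · have h3 : (H.card : ℝ) ≤ (X.filter fun v => {v} ∈ H).card := by exact_mod_cast h1
      have h4 : (X.card : ℝ) = (X.filter fun v => {v} ∈ H).card +
        (X.filter fun v => ¬ {v} ∈ H).card := by exact_mod_cast h2.symm
      simp only [pow_zero, mul_one] at hHc
      linarith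
    · intro I hI v hv
      exact Finset.mem_filter.2 ⟨hI.1 hv, fun h => hI.2 _ h (by simpa using hv)⟩
  | succ ℓ ih =>
    intro K ε hK hε
    set m := ℓ + 1 with hm
    set c := ε / (8 * 2 ^ m * K) with hc
    have hc0 : 0 < c := by positivity
    obtain ⟨δ, hδ, Q₀, hQ₀, hih⟩ := ih (K + 1) c (by linarith) hc0
    refine ⟨min δ (ε / (4 * K)), by positivity, max Q₀ (1 / c), le_max_of_le_left hQ₀, ?_⟩
    intro V _ X N Q q w hQ hN hX hq hw hsum H hH hd hHc
    have hQ1 : Q₀ ≤ Q := le_trans (le_max_left _ _) hQ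
    have hQ2 : 1 / c ≤ Q := le_trans (le_max_right _ _) hQ
    have hQ0 : 1 ≤ Q := hQ₀.trans hQ1
    have hQpos : 0 < Q := by linarith
    set t := ⌈c * Q ^ m⌉₊ with ht
    have hQm : Q ≤ Q ^ m := le_self_pow₀ hQ0 (by omega)
    have ht1 : c * Q ^ m ≤ t := Nat.le_ceil _
    have ht2 : (t : ℝ) ≤ 2 * c * Q ^ m := by
      have h1 := Nat.ceil_lt_add_one (by positivity : 0 ≤ c * Q ^ m)
      have h2 : 1 ≤ c * Q := by rwa [div_le_iff₀' hc0] at hQ2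
      have h3 : c * Q ≤ c * Q ^ m := by gcongr
      linarith
    set L := ⌈N / Q⌉₊ with hL
    set good := IsGoodFingerprint X H m t K Q with hgood
    have hP : ∀ (C : Finset V) (η : ℝ), min δ (ε / (4 * K)) ≤ η →
        (C ⊆ X ∧ (C.card : ℝ) + η * N ≤ X.card) →
        (C ⊆ X ∧ (C.card : ℝ) + min δ (ε / (4 * K)) * N ≤ X.card) := by
      intro C η h1 h2
      refine ⟨h2.1, le_trans ?_ h2.2⟩
      gcongr
    have hww : w ^ (ℓ + 1) = w * w ^ ℓ := pow_succ' w ℓ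
    rw [hww]
    refine HasContainers.comp hq (by positivity)
      (X.powerset.filter (fun S => S.card ≤ L)) (fun S => S) hsum
      (fun S I => IsIndepIn X H (S ∪ I) ∧ Disjoint S I ∧ good S ∧
        (S.card = L ∨ ∀ v ∈ I, ¬ good (insert v S))) ?_ ?_
    · intro S hS
      obtain ⟨hSX, hSL⟩ := Finset.mem_filter.1 hS
      by_cases hgS : good S
      swap
      · exact ⟨∅, by simp; positivity, fun I hI => absurd hI.2.2.1 hgS⟩
      obtain ⟨G, hG1, hG2, hG3, hG4⟩ := hgS
      by_cases hSc : S.card = L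
      · refine (hih V X N Q q w hQ1 hN hX hq hw hsum G hG1 hG3 ?_).mono le_rfl ?_
          fun C hC => hP C δ (min_le_left _ _) hC
        · rw [hG4, hSc]
          push_cast
          calc c * N * Q ^ ℓ = N / Q * (c * Q ^ m) := by
                rw [hm, pow_succ]; field_simp
            _ ≤ L * t := by
                gcongr
                exact Nat.le_ceil _
        · rintro I ⟨hI, -, -, -⟩
          refine ⟨Finset.subset_union_right.trans hI.1, fun f hf hfI => ?_⟩
          obtain ⟨v, hv, hvf⟩ := hG2 f hf
          exact hI.2 _ hvf (Finset.insert_subset (Finset.mem_union_left _ hv)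
            (hfI.trans Finset.subset_union_right))
      · have hSlt : S.card < L := lt_of_le_of_ne hSL hSc
        have hSN : (S.card : ℝ) < N / Q := Nat.lt_ceil.1 hSlt
        have hZ := card_large_unsaturated_degree (t := t) (ε := ε) (c := c) X hK hQpos hN hX hH hG1 hd
          (by rw [hc]; field_simp; rfl) hc0.le ht2 hHc (by
            rw [hG4]
            push_cast
            calc (S.card : ℝ) * t * Q ≤ N / Q * (2 * c * Q ^ m) * Q := by gcongr
              _ = 2 * c * N * Q ^ m := by field_simp)
        set Z := X.filter fun v => t ≤ codeg (unsaturated H G m Q) {v} with hZdef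
        set C := X.filter fun v => v ∉ S ∧ ¬ good (insert v S) with hC
        have hdisj : Disjoint C Z := by
          rw [Finset.disjoint_left]
          intro v hvC hvZ
          obtain ⟨-, hvS, hvg⟩ := Finset.mem_filter.1 hvC
          exact hvg (IsGoodFingerprint.insert (by omega) hH hd hG1 hG2 hG3 hG4 hvS
            (Finset.mem_filter.1 hvZ).2)
        have hcard : C.card + Z.card ≤ X.card := by
          rw [← Finset.card_union_of_disjoint hdisj]
          exact Finset.card_le_card
            (Finset.union_subset (Finset.filter_subset _ _) (Finset.filter_subset _ _))
        refine HasContainers.single (one_le_pow₀ hw) C (hP C _ (min_le_right _ _)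
          ⟨Finset.filter_subset _ _, ?_⟩) ?_
        · have : (C.card : ℝ) + Z.card ≤ X.card := by exact_mod_cast hcard
          linarith
        · rintro I ⟨hI, hdis, -, h⟩ v hv
          refine Finset.mem_filter.2 ⟨hI.1 (Finset.mem_union_right _ hv), ?_, ?_⟩
          · exact fun h' => Finset.disjoint_left.1 hdis h' hv
          · exact (h.resolve_left hSc) v hv
    · intro I hI
      obtain ⟨S, hS, hmax⟩ := Finset.exists_max_image
        (I.powerset.filter fun S => S.card ≤ L ∧ good S) Finset.card
        ⟨∅, by
          simp only [Finset.mem_filter, Finset.empty_mem_powerset, Finset.card_empty, Nat.zero_le,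
            true_and]
          exact ⟨∅, by simp, by simp, fun T _ => by simp [codeg]; positivity, by simp⟩⟩
      obtain ⟨hSI, hSL, hSg⟩ := Finset.mem_filter.1 hS
      rw [Finset.mem_powerset] at hSI
      refine ⟨S, Finset.mem_filter.2 ⟨Finset.mem_powerset.2 (hSI.trans hI.1), hSL⟩, hSI, ?_,
        Finset.disjoint_sdiff, hSg, ?_⟩
      · rwa [Finset.union_sdiff_of_subset hSI]
      · by_contra hcon
        push Not at hcon
        obtain ⟨hne, v, hv, hvg⟩ := hcon
        obtain ⟨hvI, hvS⟩ := Finset.mem_sdiff.1 hv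
        have := hmax (insert v S) (Finset.mem_filter.2 ⟨Finset.mem_powerset.2
          (Finset.insert_subset hvI hSI), by
            rw [Finset.card_insert_of_notMem hvS]; omega, hvg⟩)
        rw [Finset.card_insert_of_notMem hvS] at this
        omega

/-- The hypergraph container theorem: containers spanning few edges. -/
theorem exists_containers_few_edges (ℓ : ℕ) (K ε : ℝ) (hK : 1 ≤ K) (hε : 0 < ε) :
    ∃ s : ℕ, 1 ≤ s ∧ ∃ Q₀ : ℝ, 1 ≤ Q₀ ∧
      ∀ (V : Type) [DecidableEq V] (X : Finset V) (N Q q w : ℝ), Q₀ ≤ Q → 0 < N →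
        (X.card : ℝ) ≤ N → 0 ≤ q → 1 ≤ w →
        (∑ S ∈ X.powerset.filter (fun S => S.card ≤ ⌈N / Q⌉₊), q ^ S.card ≤ w) →
        ∀ H : Finset (Finset V), (∀ e ∈ H, e ⊆ X ∧ e.card = ℓ + 1) →
          (∀ T : Finset V, T.Nonempty → (codeg H T : ℝ) ≤ K * Q ^ (ℓ + 1 - T.card)) →
          HasContainers q (w ^ s) (IsIndepIn X H)
            (fun C => C ⊆ X ∧ ((H.filter (· ⊆ C)).card : ℝ) < ε * N * Q ^ ℓ) := by
  classical
  obtain ⟨δ, hδ, Q₀, hQ₀, hstep⟩ := exists_containers_missing ℓ K ε hK hε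
  obtain ⟨s, hs⟩ := exists_nat_gt (1 / δ)
  refine ⟨ℓ * s + 1, by omega, Q₀, hQ₀, ?_⟩
  intro V _ X N Q q w hQ hN hX hq hw hsum H hH hd
  have key : ∀ j : ℕ, HasContainers q (w ^ (ℓ * j)) (IsIndepIn X H)
      (fun C => C ⊆ X ∧ (((H.filter (· ⊆ C)).card : ℝ) < ε * N * Q ^ ℓ ∨
        (C.card : ℝ) + j * (δ * N) ≤ N)) := by
    intro j
    induction j with
    | zero =>
      exact HasContainers.single (by simp) X ⟨subset_rfl, Or.inr (by simpa using hX)⟩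
        fun I hI => hI.1
    | succ j ihj =>
      obtain ⟨F, hF, hF'⟩ := ihj
      have hww : w ^ (ℓ * (j + 1)) = w ^ (ℓ * j) * w ^ ℓ := by rw [mul_add, mul_one, pow_add]
      rw [hww]
      refine HasContainers.comp hq (by positivity) F Prod.fst hF
        (fun x I => IsIndepIn X H I ∧ I ⊆ x.2 ∧ x.2 ⊆ X ∧
          (((H.filter (· ⊆ x.2)).card : ℝ) < ε * N * Q ^ ℓ ∨
            (x.2.card : ℝ) + j * (δ * N) ≤ N)) ?_ ?_
      · rintro ⟨S, C⟩ -
        by_cases hC : C ⊆ X ∧ (((H.filter (· ⊆ C)).card : ℝ) < ε * N * Q ^ ℓ ∨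
            (C.card : ℝ) + j * (δ * N) ≤ N)
        swap
        · exact ⟨∅, by simp; positivity, fun I hI => absurd hI.2.2 hC⟩
        by_cases hfew : ((H.filter (· ⊆ C)).card : ℝ) < ε * N * Q ^ ℓ
        · exact HasContainers.single (one_le_pow₀ hw) C ⟨hC.1, Or.inl hfew⟩ fun I hI => hI.2.1
        · have hCN := hC.2.resolve_left hfew
          have hCX : (C.card : ℝ) ≤ X.card := by exact_mod_cast Finset.card_le_card hC.1
          have hsumC : ∑ S ∈ C.powerset.filter (fun S => S.card ≤ ⌈N / Q⌉₊), q ^ S.card ≤ w :=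
            (Finset.sum_le_sum_of_subset_of_nonneg
              (Finset.filter_subset_filter _ (Finset.powerset_mono.2 hC.1))
              fun _ _ _ => by positivity).trans hsum
          refine (hstep V C N Q q w hQ hN.le (hCX.trans hX) hq hw hsumC (H.filter (· ⊆ C))
            (fun e he => ⟨(Finset.mem_filter.1 he).2, (hH e (Finset.mem_filter.1 he).1).2⟩)
            (fun T hT => le_trans ?_ (hd T hT)) (not_lt.1 hfew)).mono le_rfl ?_ ?_
          · exact_mod_cast Finset.card_le_card
              (Finset.filter_subset_filter _ (Finset.filter_subset _ _))
          · rintro I ⟨hI, hIC, -⟩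
            exact ⟨hIC, fun e he => hI.2 e (Finset.mem_filter.1 he).1⟩
          · rintro C' ⟨h1, h2⟩
            refine ⟨h1.trans hC.1, Or.inr ?_⟩
            push_cast
            linarith
      · intro I hI
        obtain ⟨x, hx, h1, h2, h3⟩ := hF' I hI
        exact ⟨x, hx, h1, ⟨Finset.sdiff_subset.trans hI.1,
          fun e he h => hI.2 e he (h.trans Finset.sdiff_subset)⟩, h2, h3⟩
  refine (key s).mono (pow_le_pow_right₀ hw (by omega)) (fun I h => h) ?_
  rintro C ⟨h1, h2⟩
  refine ⟨h1, h2.resolve_right fun h => ?_⟩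
  rw [div_lt_iff₀ hδ] at hs
  have h3 : N < s * (δ * N) := by nlinarith
  have h4 : (0 : ℝ) ≤ C.card := Nat.cast_nonneg _
  linarith

/-- The graph of the colouring `f` on the `k`-AP with first term `a` and difference `d`. -/
def apGraph {k r : ℕ} (a d : ℕ) (f : Fin k → Fin (2 * r)) : Finset (ℕ × ℕ) :=
  Finset.univ.image fun j => (a + j.val * d, (f j).val)

open scoped Classical in
/-- The hypergraph on `[n] × [2r]` of coloured `k`-APs that are rainbow, or monochromatic
in one of the first `r` colours. -/
noncomputable def canonicalHypergraph (n k r : ℕ) : Finset (Finset (ℕ × ℕ)) :=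
  (((Finset.Icc 1 n ×ˢ Finset.Icc 1 n) ×ˢ (Finset.univ : Finset (Fin k → Fin (2 * r)))).filter
    fun x => apGraph x.1.1 x.1.2 x.2 ⊆ Finset.Icc 1 n ×ˢ Finset.range (2 * r) ∧
      ((∃ c < r, ∀ j, (x.2 j).val = c) ∨ Function.Injective x.2)).image
    fun x => apGraph x.1.1 x.1.2 x.2

theorem card_apGraph {k r a d : ℕ} (hd : 1 ≤ d) (f : Fin k → Fin (2 * r)) :
    (apGraph a d f).card = k := by
  unfold apGraph
  rw [Finset.card_image_of_injective, Finset.card_univ, Fintype.card_fin]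
  intro i j h
  have h1 := (Prod.ext_iff.1 h).1
  simp only [Nat.add_left_cancel_iff] at h1
  exact Fin.ext (Nat.eq_of_mul_eq_mul_right (by omega) h1)

theorem canonicalHypergraph_uniform {n k r : ℕ} : ∀ e ∈ canonicalHypergraph n k r,
    e ⊆ Finset.Icc 1 n ×ˢ Finset.range (2 * r) ∧ e.card = k := by
  intro e he
  obtain ⟨x, hx, rfl⟩ := Finset.mem_image.1 he
  obtain ⟨hx, h1, -⟩ := Finset.mem_filter.1 hx
  simp only [Finset.mem_product, Finset.mem_Icc] at hx
  exact ⟨h1, card_apGraph hx.1.2.1 _⟩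

theorem codeg_canonicalHypergraph_le {n k r : ℕ} (T : Finset (ℕ × ℕ)) (D : Finset (ℕ × ℕ))
    (hD : ∀ a ∈ Finset.Icc 1 n, ∀ d ∈ Finset.Icc 1 n, ∀ f : Fin k → Fin (2 * r),
      T ⊆ apGraph a d f → (a, d) ∈ D) :
    codeg (canonicalHypergraph n k r) T ≤ D.card * (2 * r) ^ k := by
  classical
  have hsub : (canonicalHypergraph n k r).filter (T ⊆ ·) ⊆
      (D ×ˢ (Finset.univ : Finset (Fin k → Fin (2 * r)))).image
        fun x => apGraph x.1.1 x.1.2 x.2 := by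
    intro e he
    obtain ⟨he, hT⟩ := Finset.mem_filter.1 he
    obtain ⟨x, hx, rfl⟩ := Finset.mem_image.1 he
    obtain ⟨hx, -⟩ := Finset.mem_filter.1 hx
    rw [Finset.mem_product, Finset.mem_product] at hx
    exact Finset.mem_image.2 ⟨x, Finset.mem_product.2
      ⟨hD _ hx.1.1 _ hx.1.2 _ hT, Finset.mem_univ _⟩, rfl⟩
  refine (Finset.card_le_card hsub).trans (Finset.card_image_le.trans ?_)
  rw [Finset.card_product, Finset.card_univ]
  simp

theorem codeg_canonicalHypergraph {n k r : ℕ} (hk : 1 ≤ k) {Q : ℝ} (hQ : 1 ≤ Q)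
    (hQn : Q ^ (k - 1) = n) (T : Finset (ℕ × ℕ)) (hT : T.Nonempty) :
    (codeg (canonicalHypergraph n k r) T : ℝ) ≤
      ((k * k * (2 * r) ^ k : ℕ) : ℝ) * Q ^ (k - T.card) := by
  classical
  by_cases hT1 : T.card = 1
  · obtain ⟨v, rfl⟩ := Finset.card_eq_one.1 hT1
    set D := (Finset.range k).biUnion fun j =>
      (Finset.Icc 1 n ×ˢ Finset.Icc 1 n).filter fun x => x.1 + j * x.2 = v.1 with hD
    have hDc : D.card ≤ k * n := by
      calc D.card ≤ ∑ j ∈ Finset.range k, n := by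
            refine Finset.card_biUnion_le.trans (Finset.sum_le_sum fun j _ => ?_)
            calc _ ≤ (Finset.Icc 1 n).card := by
                  refine Finset.card_le_card_of_injOn Prod.snd ?_ ?_
                  · intro x hx
                    simp only [Finset.coe_filter, Finset.mem_product, Set.mem_ofPred_eq] at hx
                    exact hx.1.2
                  · intro x hx y hy h
                    simp only [Finset.coe_filter, Set.mem_ofPred_eq] at hx hy
                    have := hx.2.trans hy.2.symm
                    rw [h] at this
                    exact Prod.ext (by omega) h
              _ = n := by simp
        _ = k * n := by simp
    have h := codeg_canonicalHypergraph_le (k := k) (n := n) (r := r) {v} D (by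
      intro a ha d hd f hf
      rw [Finset.singleton_subset_iff] at hf
      obtain ⟨j, -, rfl⟩ := Finset.mem_image.1 hf
      exact Finset.mem_biUnion.2 ⟨j, Finset.mem_range.2 j.isLt, by simp_all⟩)
    have h2 : codeg (canonicalHypergraph n k r) {v} ≤ k * k * (2 * r) ^ k * n := by
      calc _ ≤ k * n * (2 * r) ^ k := h.trans (Nat.mul_le_mul_right _ hDc)
        _ = 1 * (k * (2 * r) ^ k * n) := by ring
        _ ≤ k * (k * (2 * r) ^ k * n) := Nat.mul_le_mul_right _ hk
        _ = _ := by ring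
    rw [Finset.card_singleton, hQn]
    exact_mod_cast h2
  · have hT2 : 1 < T.card := by have := Finset.card_pos.2 hT; omega
    obtain ⟨v, hv, w, hw, hvw⟩ := Finset.one_lt_card.1 hT2
    set D := ((Finset.range k ×ˢ Finset.range k).filter fun p => p.1 ≠ p.2).biUnion fun p =>
      (Finset.Icc 1 n ×ˢ Finset.Icc 1 n).filter
        fun x => x.1 + p.1 * x.2 = v.1 ∧ x.1 + p.2 * x.2 = w.1 with hD
    have hDc : D.card ≤ k * k := by
      calc D.card ≤ ∑ j ∈ (Finset.range k ×ˢ Finset.range k).filter (fun p => p.1 ≠ p.2), 1 := by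
            refine Finset.card_biUnion_le.trans (Finset.sum_le_sum fun p hp => ?_)
            have hp := (Finset.mem_filter.1 hp).2
            refine Finset.card_le_one.2 fun x hx y hy => ?_
            obtain ⟨-, hx1, hx2⟩ := Finset.mem_filter.1 hx
            obtain ⟨-, hy1, hy2⟩ := Finset.mem_filter.1 hy
            have hp' : ((p.1 : ℤ) - p.2) ≠ 0 := by omega
            have e : ((p.1 : ℤ) - p.2) * x.2 = ((p.1 : ℤ) - p.2) * y.2 := by
              zify at hx1 hx2 hy1 hy2
              linarith
            have e2 : x.2 = y.2 := by exact_mod_cast mul_left_cancel₀ hp' e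
            rw [e2] at hx1
            exact Prod.ext (by omega) e2
        _ ≤ k * k := by
            simp only [Finset.sum_const, smul_eq_mul, mul_one]
            exact (Finset.card_filter_le _ _).trans (by simp)
    have h := codeg_canonicalHypergraph_le (k := k) (n := n) (r := r) T D (by
      intro a ha d hd f hf
      obtain ⟨i, -, hi⟩ := Finset.mem_image.1 (hf hv)
      obtain ⟨j, -, hj⟩ := Finset.mem_image.1 (hf hw)
      have hij : i ≠ j := by
        rintro rfl
        exact hvw (hi.symm.trans hj)
      refine Finset.mem_biUnion.2 ⟨(i, j), ?_, ?_⟩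
      · simpa [Fin.val_inj] using hij
      · simp only [Finset.mem_filter, Finset.mem_product]
        exact ⟨⟨ha, hd⟩, by rw [← hi], by rw [← hj]⟩)
    have h2 : codeg (canonicalHypergraph n k r) T ≤ k * k * (2 * r) ^ k :=
      h.trans (Nat.mul_le_mul_right _ hDc)
    have h3 : (1 : ℝ) ≤ Q ^ (k - T.card) := one_le_pow₀ hQ
    calc (codeg (canonicalHypergraph n k r) T : ℝ) ≤ ((k * k * (2 * r) ^ k : ℕ) : ℝ) * 1 := by
          rw [mul_one]; exact_mod_cast h2
      _ ≤ _ := by gcongr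

theorem mem_canonicalHypergraph {n k r a d : ℕ} (hk : 2 ≤ k) (hd : 1 ≤ d) (c : ℕ → ℕ)
    (hn : ∀ j < k, a + j * d ∈ Finset.Icc 1 n) (hc : ∀ j < k, c (a + j * d) < 2 * r)
    (h : (MonoOn k c a d ∧ c a < r) ∨ RainbowOn k c a d) :
    (Finset.range k).image (fun j => (a + j * d, c (a + j * d))) ∈ canonicalHypergraph n k r := by
  classical
  have h0 := Finset.mem_Icc.1 (hn 0 (by omega))
  have h1 := Finset.mem_Icc.1 (hn 1 (by omega))
  set f : Fin k → Fin (2 * r) := fun j => ⟨c (a + j * d), hc j j.isLt⟩ with hf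
  have himg : apGraph a d f = (Finset.range k).image (fun j => (a + j * d, c (a + j * d))) := by
    ext x
    simp only [apGraph, Finset.mem_image, Finset.mem_univ, true_and, Finset.mem_range]
    exact ⟨fun ⟨j, hj⟩ => ⟨j, j.isLt, hj⟩, fun ⟨j, hj, h⟩ => ⟨⟨j, hj⟩, h⟩⟩
  refine Finset.mem_image.2 ⟨((a, d), f), Finset.mem_filter.2 ⟨?_, ?_, ?_⟩, himg⟩
  · simp only [Finset.mem_product, Finset.mem_Icc, Finset.mem_univ, and_true]
    omega
  · simp only [himg]
    intro x hx
    obtain ⟨j, hj, rfl⟩ := Finset.mem_image.1 hx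
    rw [Finset.mem_range] at hj
    exact Finset.mem_product.2 ⟨hn j hj, Finset.mem_range.2 (hc j hj)⟩
  · rcases h with ⟨hm, hr⟩ | hr
    · refine Or.inl ⟨c a, hr, fun j => ?_⟩
      simpa [hf] using hm j j.isLt 0 (by omega)
    · refine Or.inr fun i j hij => ?_
      by_contra hne
      exact hr i i.isLt j j.isLt (fun h => hne (Fin.ext h)) (by simpa [hf] using hij)

theorem image_ap_injective {k a d a' d' : ℕ} (hk : 2 ≤ k) {c : ℕ → ℕ}
    (h : (Finset.range k).image (fun j => (a + j * d, c (a + j * d))) =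
      (Finset.range k).image (fun j => (a' + j * d', c (a' + j * d')))) :
    a = a' ∧ d = d' := by
  have key : ∀ {a d a' d' : ℕ},
      (Finset.range k).image (fun j => (a + j * d, c (a + j * d))) =
      (Finset.range k).image (fun j => (a' + j * d', c (a' + j * d'))) →
      a' ≤ a ∧ a + (k - 1) * d ≤ a' + (k - 1) * d' := by
    intro a d a' d' h
    have hmem : ∀ j < k, ∃ i < k, a' + i * d' = a + j * d := by
      intro j hj
      have : (a + j * d, c (a + j * d)) ∈
          (Finset.range k).image (fun j => (a' + j * d', c (a' + j * d'))) := by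
        rw [← h]
        exact Finset.mem_image.2 ⟨j, Finset.mem_range.2 hj, rfl⟩
      obtain ⟨i, hi, hi'⟩ := Finset.mem_image.1 this
      exact ⟨i, Finset.mem_range.1 hi, (Prod.ext_iff.1 hi').1⟩
    obtain ⟨i, hi, h1⟩ := hmem 0 (by omega)
    obtain ⟨j, hj, h2⟩ := hmem (k - 1) (by omega)
    have : j * d' ≤ (k - 1) * d' := Nat.mul_le_mul_right _ (by omega)
    omega
  have h1 := key h
  have h2 := key h.symm
  have ha : a = a' := by omega
  refine ⟨ha, ?_⟩
  have : (k - 1) * d = (k - 1) * d' := by omega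
  exact Nat.eq_of_mul_eq_mul_left (by omega) this

theorem exists_bounded_selection (X : Finset ℕ) (L : ℕ → Finset ℕ) (r cap : ℕ)
    (hL : ∀ x ∈ X, L x ⊆ Finset.range (2 * r))
    (h : ∀ U ⊆ Finset.Ico r (2 * r), (X.filter (L · ⊆ U)).card ≤ cap * (U.card + 1)) :
    ∃ c : ℕ → ℕ, (∀ x ∈ X, c x ∈ L x ∨ c x = 2 * r) ∧
      ∀ i, r ≤ i → (X.filter (c · = i)).card ≤ cap := by
  classical
  set Z := X.filter fun x => ∀ i ∈ L x, r ≤ i with hZ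
  set t : Z → Finset (ℕ × ℕ) := fun x => insert (2 * r) (L x) ×ˢ Finset.range cap with ht
  have hall : ∀ s : Finset Z, s.card ≤ (s.biUnion t).card := by
    intro s
    rcases s.eq_empty_or_nonempty with rfl | ⟨x₀, hx₀⟩
    · simp
    set U := s.biUnion fun x => L x with hU
    have hUI : U ⊆ Finset.Ico r (2 * r) := by
      intro i hi
      obtain ⟨x, -, hx⟩ := Finset.mem_biUnion.1 hi
      have hx2 := Finset.mem_filter.1 x.2
      exact Finset.mem_Ico.2 ⟨hx2.2 i hx, Finset.mem_range.1 (hL _ hx2.1 hx)⟩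
    have h1 : s.card ≤ (X.filter (L · ⊆ U)).card := by
      refine Finset.card_le_card_of_injOn Subtype.val ?_ Subtype.val_injective.injOn
      intro x hx
      simp only [Finset.coe_filter, Set.mem_ofPred_eq]
      exact ⟨(Finset.mem_filter.1 x.2).1,
        Finset.subset_biUnion_of_mem (fun x : Z => L x) hx⟩
    have h2 : insert (2 * r) U ×ˢ Finset.range cap ⊆ s.biUnion t := by
      intro y hy
      obtain ⟨hy1, hy2⟩ := Finset.mem_product.1 hy
      rcases Finset.mem_insert.1 hy1 with hy1 | hy1
      · exact Finset.mem_biUnion.2 ⟨x₀, hx₀, Finset.mem_product.2 ⟨by simp [hy1], hy2⟩⟩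
      · obtain ⟨x, hx, hx1⟩ := Finset.mem_biUnion.1 hy1
        exact Finset.mem_biUnion.2
          ⟨x, hx, Finset.mem_product.2 ⟨Finset.mem_insert_of_mem hx1, hy2⟩⟩
    have h3 : (2 * r) ∉ U := fun hh => by
      have := Finset.mem_Ico.1 (hUI hh)
      omega
    calc s.card ≤ cap * (U.card + 1) := h1.trans (h U hUI)
      _ = (insert (2 * r) U ×ˢ Finset.range cap).card := by
          rw [Finset.card_product, Finset.card_insert_of_notMem h3, Finset.card_range, mul_comm]
      _ ≤ _ := Finset.card_le_card h2
  obtain ⟨f, hf, hft⟩ := (Finset.all_card_le_biUnion_card_iff_exists_injective t).1 hall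
  have hlarge : ∀ x : ℕ, ∃ i, x ∈ X → x ∉ Z → i ∈ L x ∧ i < r := by
    intro x
    by_cases hx : x ∈ X ∧ x ∉ Z
    · have := hx.2
      simp only [hZ, Finset.mem_filter, not_and] at this
      have := this hx.1
      push Not at this
      obtain ⟨i, hi⟩ := this
      exact ⟨i, fun _ _ => hi⟩
    · exact ⟨0, fun h1 h2 => absurd ⟨h1, h2⟩ hx⟩
  choose g hg using hlarge
  refine ⟨fun x => if hx : x ∈ Z then (f ⟨x, hx⟩).1 else g x, ?_, ?_⟩
  · intro x hx
    by_cases hxZ : x ∈ Z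
    · have := (Finset.mem_product.1 (hft ⟨x, hxZ⟩)).1
      simp only [hxZ, dif_pos]
      exact (Finset.mem_insert.1 this).symm
    · simp only [hxZ, dif_neg, not_false_iff]
      exact Or.inl (hg x hx hxZ).1
  · intro i hi
    set T := X.filter fun x => (if hx : x ∈ Z then (f ⟨x, hx⟩).1 else g x) = i with hT
    have hTZ : ∀ x ∈ T, ∃ hx : x ∈ Z, (f ⟨x, hx⟩).1 = i := by
      intro x hx
      obtain ⟨hxX, hx⟩ := Finset.mem_filter.1 hx
      by_cases hxZ : x ∈ Z
      · exact ⟨hxZ, by simpa only [hxZ, dif_pos] using hx⟩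
      · simp only [hxZ, dif_neg, not_false_iff] at hx
        have := (hg x hxX hxZ).2
        omega
    have hcard : T.card ≤ (Finset.range cap).card := by
      refine Finset.card_le_card_of_injOn (fun x => if hx : x ∈ Z then (f ⟨x, hx⟩).2 else 0) ?_ ?_
      · intro x hx
        obtain ⟨hxZ, -⟩ := hTZ x hx
        simp only [hxZ, dif_pos]
        exact (Finset.mem_product.1 (hft ⟨x, hxZ⟩)).2
      · intro x hx y hy hxy
        obtain ⟨hxZ, hx1⟩ := hTZ x hx
        obtain ⟨hyZ, hy1⟩ := hTZ y hy
        simp only [hxZ, hyZ, dif_pos] at hxy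
        have := hf (Prod.ext (hx1.trans hy1.symm) hxy)
        exact congrArg Subtype.val this
    simpa using hcard

theorem card_pairs_le_of_canonical {k M n r cap : ℕ} (hk : 2 ≤ k)
    (hM : ∀ χ : ℕ → ℕ, ∃ a d, 1 ≤ d ∧ (∀ i < k, a + i * d < M) ∧
      (MonoOn k χ a d ∨ RainbowOn k χ a d))
    (C : Finset (ℕ × ℕ)) (c : ℕ → ℕ)
    (hc : ∀ x ∈ Finset.Icc 1 n, ((x, c x) ∈ C ∧ c x < 2 * r) ∨ c x = 2 * r)
    (hcap : ∀ i, r ≤ i → ((Finset.Icc 1 n).filter (c · = i)).card ≤ cap) :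
    n / 2 * (n / (2 * M)) ≤ M * (n * cap) + M * M * (n * cap) +
      M * M * ((canonicalHypergraph n k r).filter (· ⊆ C)).card := by
  classical
  set B := Finset.Icc 1 (n / 2) ×ˢ Finset.Icc 1 (n / (2 * M)) with hB
  have hBn : ∀ x ∈ B, ∀ t < M, x.1 + t * x.2 ∈ Finset.Icc 1 n ∧ 1 ≤ x.2 ∧ x.2 ∈ Finset.Icc 1 n := by
    intro x hx t ht
    simp only [hB, Finset.mem_product, Finset.mem_Icc] at hx ⊢
    have h1 : t * x.2 ≤ n / 2 := by
      have : t * x.2 ≤ M * (n / (2 * M)) := Nat.mul_le_mul ht.le hx.2.2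
      have h2 : 2 * M * (n / (2 * M)) ≤ n := Nat.mul_div_le n (2 * M)
      have h3 : 2 * (M * (n / (2 * M))) ≤ n := by rw [← mul_assoc]; exact h2
      omega
    have h4 : n / (2 * M) ≤ n := Nat.div_le_self _ _
    omega
  set B₁ := (Finset.range M).biUnion fun t => B.filter fun x => c (x.1 + t * x.2) = 2 * r
  set B₂ := (Finset.range M ×ˢ Finset.range M).biUnion fun s => B.filter fun x =>
    s.1 < s.2 ∧ c (x.1 + s.1 * x.2) = c (x.1 + s.2 * x.2) ∧ r ≤ c (x.1 + s.1 * x.2)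
  set B₃ := (Finset.range M ×ˢ Finset.range M).biUnion fun s => B.filter fun x =>
    1 ≤ s.2 ∧ (Finset.range k).image (fun j => (x.1 + s.1 * x.2 + j * (s.2 * x.2),
      c (x.1 + s.1 * x.2 + j * (s.2 * x.2)))) ∈ (canonicalHypergraph n k r).filter (· ⊆ C)
  have hsub : B ⊆ B₁ ∪ B₂ ∪ B₃ := by
    intro x hx
    obtain ⟨a, d, hd, hlt, hχ⟩ := hM fun t => c (x.1 + t * x.2)
    have ha : a < M := by simpa using hlt 0 (by omega)
    have had : a + d < M := by simpa using hlt 1 (by omega)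
    have hform : ∀ i, x.1 + (a + i * d) * x.2 = x.1 + a * x.2 + i * (d * x.2) := fun i => by ring
    by_cases h1 : ∃ i < k, c (x.1 + (a + i * d) * x.2) = 2 * r
    · obtain ⟨i, hi, h⟩ := h1
      exact Finset.mem_union_left _ (Finset.mem_union_left _ (Finset.mem_biUnion.2
        ⟨a + i * d, Finset.mem_range.2 (hlt i hi), Finset.mem_filter.2 ⟨hx, h⟩⟩))
    push Not at h1
    by_cases h2 : MonoOn k (fun t => c (x.1 + t * x.2)) a d ∧ r ≤ c (x.1 + a * x.2)
    · refine Finset.mem_union_left _ (Finset.mem_union_right _ (Finset.mem_biUnion.2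
        ⟨(a, a + d), ?_, Finset.mem_filter.2 ⟨hx, by omega, ?_, h2.2⟩⟩))
      · simp [ha, had]
      · simpa using h2.1 0 (by omega) 1 (by omega)
    refine Finset.mem_union_right _ (Finset.mem_biUnion.2
        ⟨(a, d), by simp only [Finset.mem_product, Finset.mem_range]; omega,
          Finset.mem_filter.2 ⟨hx, hd, Finset.mem_filter.2 ⟨?_, ?_⟩⟩⟩)
    · have hin : ∀ j < k, x.1 + a * x.2 + j * (d * x.2) ∈ Finset.Icc 1 n := fun j hj => by
        rw [← hform]
        exact (hBn x hx _ (hlt j hj)).1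
      refine mem_canonicalHypergraph hk (Nat.mul_pos hd (hBn x hx a ha).2.1) c hin ?_ ?_
      · intro j hj
        have h3 := h1 j hj
        rw [hform] at h3
        exact ((hc _ (hin j hj)).resolve_right h3).2
      · rcases hχ with hχ | hχ
        · refine Or.inl ⟨fun i hi j hj => ?_, ?_⟩
          · rw [← hform, ← hform]
            exact hχ i hi j hj
          · exact not_le.1 fun h => h2 ⟨hχ, h⟩
        · refine Or.inr fun i hi j hj hij => ?_
          rw [← hform, ← hform]
          exact hχ i hi j hj hij
    · intro y hy
      obtain ⟨j, hj, rfl⟩ := Finset.mem_image.1 hy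
      rw [Finset.mem_range] at hj
      simp only [← hform]
      exact ((hc _ (hBn x hx _ (hlt j hj)).1).resolve_right (h1 j hj)).1
  have hB₁ : B₁.card ≤ M * (n * cap) := by
    calc B₁.card ≤ ∑ t ∈ Finset.range M, n * cap := by
          refine Finset.card_biUnion_le.trans (Finset.sum_le_sum fun t ht => ?_)
          calc _ ≤ (Finset.Icc 1 n ×ˢ (Finset.Icc 1 n).filter (c · = 2 * r)).card := by
                refine Finset.card_le_card_of_injOn (fun x => (x.2, x.1 + t * x.2)) ?_ ?_
                · intro x hx
                  obtain ⟨hx, hx2⟩ := Finset.mem_filter.1 hx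
                  have := hBn x hx t (Finset.mem_range.1 ht)
                  exact Finset.mem_product.2 ⟨this.2.2, Finset.mem_filter.2 ⟨this.1, hx2⟩⟩
                · intro x _ y _ hxy
                  simp only [Prod.mk.injEq] at hxy
                  obtain ⟨h1, h2⟩ := hxy
                  rw [h1] at h2
                  exact Prod.ext (by omega) h1
            _ ≤ n * cap := by
                rw [Finset.card_product, Nat.card_Icc, Nat.add_sub_cancel]
                exact Nat.mul_le_mul_left _ (hcap _ (by omega))
      _ = _ := by simp
  have hB₂ : B₂.card ≤ M * M * (n * cap) := by
    calc B₂.card ≤ ∑ t ∈ Finset.range M ×ˢ Finset.range M, n * cap := by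
          refine Finset.card_biUnion_le.trans (Finset.sum_le_sum fun s hs => ?_)
          rw [Finset.mem_product, Finset.mem_range, Finset.mem_range] at hs
          by_cases hlt : s.1 < s.2
          swap
          · simp [hlt]
          set R := ((Finset.Icc 1 n).filter (r ≤ c ·)).biUnion fun x =>
            ((Finset.Icc 1 n).filter (c · = c x)).image fun y => (x, y)
          calc _ ≤ R.card := by
                refine Finset.card_le_card_of_injOn
                  (fun x => (x.1 + s.1 * x.2, x.1 + s.2 * x.2)) ?_ ?_
                · intro x hx
                  obtain ⟨hx, -, hx2, hx3⟩ := Finset.mem_filter.1 hx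
                  exact Finset.mem_biUnion.2 ⟨x.1 + s.1 * x.2, Finset.mem_filter.2
                    ⟨(hBn x hx _ hs.1).1, hx3⟩, Finset.mem_image.2 ⟨x.1 + s.2 * x.2,
                    Finset.mem_filter.2 ⟨(hBn x hx _ hs.2).1, hx2.symm⟩, rfl⟩⟩
                · intro x _ y _ hxy
                  simp only [Prod.mk.injEq] at hxy
                  obtain ⟨h1, h2⟩ := hxy
                  obtain ⟨z, hz⟩ : ∃ z, s.2 = s.1 + (z + 1) := ⟨s.2 - s.1 - 1, by omega⟩
                  rw [hz, add_mul, add_mul s.1, ← add_assoc, ← add_assoc, h1] at h2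
                  have h3 : x.2 = y.2 := Nat.eq_of_mul_eq_mul_left (by omega)
                    (Nat.add_left_cancel h2)
                  rw [h3] at h1
                  exact Prod.ext (by omega) h3
            _ ≤ ∑ x ∈ (Finset.Icc 1 n).filter (r ≤ c ·), cap := by
                refine Finset.card_biUnion_le.trans (Finset.sum_le_sum fun x hx => ?_)
                exact Finset.card_image_le.trans (hcap _ (Finset.mem_filter.1 hx).2)
            _ ≤ n * cap := by
                rw [Finset.sum_const, smul_eq_mul]
                exact Nat.mul_le_mul_right _ ((Finset.card_filter_le _ _).trans (by simp))
      _ = _ := by simp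
  have hB₃ : B₃.card ≤ M * M * ((canonicalHypergraph n k r).filter (· ⊆ C)).card := by
    calc B₃.card ≤ ∑ t ∈ Finset.range M ×ˢ Finset.range M,
          ((canonicalHypergraph n k r).filter (· ⊆ C)).card := by
          refine Finset.card_biUnion_le.trans (Finset.sum_le_sum fun s hs => ?_)
          refine Finset.card_le_card_of_injOn (fun x => (Finset.range k).image (fun j =>
            (x.1 + s.1 * x.2 + j * (s.2 * x.2), c (x.1 + s.1 * x.2 + j * (s.2 * x.2))))) ?_ ?_
          · intro x hx
            exact (Finset.mem_filter.1 hx).2.2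
          · intro x hx y hy hxy
            have hs2 := (Finset.mem_filter.1 hx).2.1
            obtain ⟨h1, h2⟩ := image_ap_injective hk hxy
            have h3 : x.2 = y.2 := Nat.eq_of_mul_eq_mul_left (by omega) h2
            rw [h3] at h1
            exact Prod.ext (by omega) h3
      _ = _ := by simp
  have hcard : B.card = n / 2 * (n / (2 * M)) := by simp [hB]
  rw [← hcard]
  refine (Finset.card_le_card hsub).trans ((Finset.card_union_le _ _).trans ?_)
  have := Finset.card_union_le B₁ B₂
  omega

/-- A container with few canonical edges is concentrated: for some set `U` of small colours,
many points have all their available colours in `U`. -/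
theorem exists_concentrated_lists {k M : ℕ} (hk : 2 ≤ k) (hM1 : 1 ≤ M)
    (hM : ∀ χ : ℕ → ℕ, ∃ a d, 1 ≤ d ∧ (∀ i < k, a + i * d < M) ∧
      (MonoOn k χ a d ∨ RainbowOn k χ a d))
    {γ : ℝ} (hγ : γ = 1 / (100 * M ^ 3)) {n r : ℕ} (hn : 100 * M ^ 3 ≤ n)
    (C : Finset (ℕ × ℕ))
    (hC : (((canonicalHypergraph n k r).filter (· ⊆ C)).card : ℝ) < γ * n ^ 2) :
    ∃ U ⊆ Finset.Ico r (2 * r), γ * n * (U.card + 1) <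
      ((Finset.Icc 1 n).filter fun x => ∀ i < 2 * r, (x, i) ∈ C → i ∈ U).card := by
  classical
  by_contra! hcon
  have hM0 : (1 : ℝ) ≤ M := by exact_mod_cast hM1
  have hn' : (100 * M ^ 3 : ℝ) ≤ n := by exact_mod_cast hn
  have hM3 : (0 : ℝ) < 100 * M ^ 3 := by positivity
  have hγn : 1 ≤ γ * n := by
    rw [hγ, one_div_mul_eq_div, one_le_div hM3]
    exact hn'
  set cap := ⌈γ * n⌉₊ with hcap
  have hcap1 : γ * n ≤ cap := Nat.le_ceil _
  have hcap2 : (cap : ℝ) ≤ 2 * (γ * n) := by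
    have := Nat.ceil_lt_add_one (show 0 ≤ γ * n by linarith)
    linarith
  obtain ⟨c, hc1, hc2⟩ := exists_bounded_selection (Finset.Icc 1 n)
    (fun x => (Finset.range (2 * r)).filter fun i => (x, i) ∈ C) r cap
    (fun x _ => Finset.filter_subset _ _) (by
      intro U hU
      have h1 := hcon U hU
      have h2 : ((Finset.Icc 1 n).filter fun x =>
          (Finset.range (2 * r)).filter (fun i => (x, i) ∈ C) ⊆ U) =
          (Finset.Icc 1 n).filter fun x => ∀ i < 2 * r, (x, i) ∈ C → i ∈ U := by
        refine Finset.filter_congr fun x _ => ?_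
        constructor
        · intro h i hi hiC
          exact h (by simp [hi, hiC])
        · intro h i hi
          simp only [Finset.mem_filter, Finset.mem_range] at hi
          exact h i hi.1 hi.2
      rw [h2]
      have h3 : γ * n * (U.card + 1) ≤ cap * (U.card + 1) := by gcongr
      exact_mod_cast h1.trans h3)
  have key := card_pairs_le_of_canonical (k := k) (M := M) (n := n) (r := r) (cap := cap) hk hM C c
    (by
      intro x hx
      refine (hc1 x hx).imp (fun h => ?_) id
      simp only [Finset.mem_filter, Finset.mem_range] at h
      exact ⟨h.2, h.1⟩) hc2
  set h := ((canonicalHypergraph n k r).filter (· ⊆ C)).card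
  have key' : ((n / 2 : ℕ) : ℝ) * ((n / (2 * M) : ℕ) : ℝ) ≤
      M * (n * cap) + M * M * (n * cap) + M * M * h := by exact_mod_cast key
  have hMM : (M : ℝ) ≤ M ^ 3 := le_self_pow₀ hM0 (by norm_num)
  have f1 : (n : ℝ) / 4 ≤ ((n / 2 : ℕ) : ℝ) := by
    have h1 : n < 2 * (n / 2) + 2 := by omega
    have h2 : (n : ℝ) < 2 * ((n / 2 : ℕ) : ℝ) + 2 := by exact_mod_cast h1
    linarith
  have f2 : (n : ℝ) / (4 * M) ≤ ((n / (2 * M) : ℕ) : ℝ) := by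
    have h1 : n < 2 * M * (n / (2 * M) + 1) := Nat.lt_mul_div_succ n (by omega)
    have h2 : (n : ℝ) < 2 * M * (((n / (2 * M) : ℕ) : ℝ) + 1) := by exact_mod_cast h1
    rw [div_le_iff₀ (by positivity)]
    nlinarith
  have f3 : (n : ℝ) / 4 * (n / (4 * M)) ≤ ((n / 2 : ℕ) : ℝ) * ((n / (2 * M) : ℕ) : ℝ) := by
    gcongr
  have hn0 : (0 : ℝ) < n := by linarith
  have hMsq : (M : ℝ) ≤ M * M := by nlinarith
  have g1 : (M * (n * cap) + M * M * (n * cap) + M * M * h : ℝ) ≤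
      5 * (M * M * (γ * n ^ 2)) := by
    have e1 : (n * cap : ℝ) ≤ 2 * (γ * n ^ 2) := by
      calc (n * cap : ℝ) ≤ n * (2 * (γ * n)) := by gcongr
        _ = _ := by ring
    have e0 : (0 : ℝ) ≤ n * cap := by positivity
    have e2 : (M * (n * cap) : ℝ) ≤ M * M * (n * cap) := by gcongr
    have e3 : (M * M * (n * cap) : ℝ) ≤ M * M * (2 * (γ * n ^ 2)) := by gcongr
    have e4 : (M * M * h : ℝ) ≤ M * M * (γ * n ^ 2) := by gcongr
    linarith
  have g2 : 5 * (M * M * (γ * n ^ 2)) = (n : ℝ) ^ 2 / (20 * M) := by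
    rw [hγ]; field_simp; norm_num
  have g3 : (n : ℝ) / 4 * (n / (4 * M)) = (n : ℝ) ^ 2 / (16 * M) := by
    field_simp; norm_num
  have g4 : (n : ℝ) ^ 2 / (20 * M) < (n : ℝ) ^ 2 / (16 * M) := by
    apply div_lt_div_of_pos_left <;> first | positivity | nlinarith
  linarith

theorem exists_balanced_merge (s : Finset ℕ) (w : ℕ → ℝ) {δ : ℝ} {r : ℕ} (hr : 1 ≤ r)
    (hw0 : ∀ i ∈ s, 0 ≤ w i) (hw : ∀ i ∈ s, w i ≤ δ) (hδ : 0 ≤ δ) :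
    ∃ g : ℕ → ℕ, (∀ i, g i < r) ∧
      ∀ j, ∑ i ∈ s.filter (g · = j), w i ≤ (∑ i ∈ s, w i) / r + δ := by
  classical
  induction s using Finset.induction_on with
  | empty => exact ⟨fun _ => 0, fun _ => hr, fun j => by simpa using hδ⟩
  | insert a s ha ih =>
    obtain ⟨g, hg, hgs⟩ := ih (fun i hi => hw0 i (Finset.mem_insert_of_mem hi))
      (fun i hi => hw i (Finset.mem_insert_of_mem hi))
    have hr0 : (0 : ℝ) < r := by exact_mod_cast hr
    obtain ⟨j₀, hj₀, hj₀s⟩ : ∃ j ∈ Finset.range r,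
        ∑ i ∈ s.filter (g · = j), w i ≤ (∑ i ∈ s, w i) / r := by
      refine Finset.exists_le_of_sum_le (by simp; omega) ?_
      rw [Finset.sum_fiberwise_of_maps_to (fun i _ => Finset.mem_range.2 (hg i)),
        Finset.sum_const, Finset.card_range, nsmul_eq_mul, mul_div_cancel₀ _ hr0.ne']
    have hwa := hw0 a (Finset.mem_insert_self _ _)
    have hmono : (∑ i ∈ s, w i) / r ≤ (∑ i ∈ insert a s, w i) / r := by
      rw [Finset.sum_insert ha]
      gcongr
      linarith
    have hsame : ∀ j, s.filter (Function.update g a j₀ · = j) = s.filter (g · = j) := by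
      intro j
      refine Finset.filter_congr fun i hi => ?_
      rw [Function.update_of_ne]
      rintro rfl
      exact ha hi
    refine ⟨Function.update g a j₀, fun i => ?_, fun j => ?_⟩
    · by_cases h : i = a
      · subst h
        simpa using hj₀
      · simpa [h] using hg i
    · rw [Finset.filter_insert, hsame]
      split_ifs with h
      · rw [Function.update_self] at h
        subst h
        rw [Finset.sum_insert (fun hh => ha (Finset.mem_filter.1 hh).1)]
        have := hw a (Finset.mem_insert_self _ _)
        linarith
      · linarith [hgs j]

/-- A colouring of `A` with no monochromatic or rainbow `k`-AP can be recoloured with `2 * r`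
colours, the last `r` of which have small classes, so that its graph is independent. -/
theorem exists_independent_recolouring {n k r : ℕ} (hr : 1 ≤ r) {A : Finset ℕ}
    (hAn : A ⊆ Finset.Icc 1 n) (hA : ¬ IsCanVdW k A) {σ : ℝ} (hσ : 0 < σ)
    (hAσ : (A.card : ℝ) ≤ r * σ) :
    ∃ φ : ℕ → ℕ, (∀ i, r ≤ i → ((A.filter (φ · = i)).card : ℝ) ≤ 2 * σ) ∧
      IsIndepIn (Finset.Icc 1 n ×ˢ Finset.range (2 * r)) (canonicalHypergraph n k r)
        (A.image fun x => (x, φ x)) := by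
  classical
  unfold IsCanVdW at hA
  push Not at hA
  obtain ⟨χ, hχ⟩ := hA
  have hr0 : (0 : ℝ) < r := by exact_mod_cast hr
  set w : ℕ → ℝ := fun c => ((A.filter (χ · = c)).card : ℝ) with hw
  set T := A.image χ with hT
  have hwT : ∑ c ∈ T, w c = A.card := by
    rw [Finset.card_eq_sum_card_image χ A]
    push_cast
    rfl
  set Lg := T.filter fun c => σ < w c with hLg
  have hLr : Lg.card ≤ r := by
    have h1 : (Lg.card : ℝ) * σ ≤ r * σ := by
      calc (Lg.card : ℝ) * σ = ∑ c ∈ Lg, σ := by simp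
        _ ≤ ∑ c ∈ Lg, w c := Finset.sum_le_sum fun c hc => (Finset.mem_filter.1 hc).2.le
        _ ≤ ∑ c ∈ T, w c := Finset.sum_le_sum_of_subset_of_nonneg (Finset.filter_subset _ _)
            fun c _ _ => by positivity
        _ ≤ r * σ := hwT ▸ hAσ
    exact_mod_cast le_of_mul_le_mul_right h1 hσ
  obtain ⟨g, hg, hgs⟩ := exists_balanced_merge (T \ Lg) w (δ := σ) hr
    (fun i _ => by positivity) (fun i hi => by
      simp only [hLg, Finset.mem_sdiff, Finset.mem_filter, not_and, not_lt] at hi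
      exact hi.2 hi.1) hσ.le
  have hgs' : ∀ j, ∑ i ∈ (T \ Lg).filter (g · = j), w i ≤ 2 * σ := by
    intro j
    have h1 : (∑ i ∈ T \ Lg, w i) / r ≤ σ := by
      rw [div_le_iff₀ hr0]
      calc ∑ i ∈ T \ Lg, w i ≤ ∑ i ∈ T, w i :=
            Finset.sum_le_sum_of_subset_of_nonneg Finset.sdiff_subset fun c _ _ => by positivity
        _ ≤ σ * r := by rw [hwT, mul_comm]; exact hAσ
    linarith [hgs j]
  set ψ : ℕ → ℕ := fun c => if hc : c ∈ Lg then (Lg.equivFin ⟨c, hc⟩).val else r + g c with hψ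
  have hψL : ∀ c ∈ Lg, ψ c < r := by
    intro c hc
    simp only [hψ, hc, dif_pos]
    exact (Fin.isLt _).trans_le hLr
  have hψS : ∀ c ∉ Lg, ψ c = r + g c := by
    intro c hc
    simp only [hψ, hc, dif_neg, not_false_iff]
  have hψlt : ∀ c, ψ c < 2 * r := by
    intro c
    by_cases hc : c ∈ Lg
    · have := hψL c hc
      omega
    · have := hψS c hc
      have := hg c
      omega
  have hψinj : ∀ c c', ψ c < r → ψ c = ψ c' → c = c' := by
    intro c c' h1 h2
    have hc : c ∈ Lg := by
      by_contra hc
      have := hψS c hc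
      omega
    have hc' : c' ∈ Lg := by
      by_contra hc
      have := hψS c' hc
      omega
    simp only [hψ, hc, hc', dif_pos] at h2
    have := Lg.equivFin.injective (Fin.ext h2)
    exact congrArg Subtype.val this
  refine ⟨fun x => ψ (χ x), fun i hi => ?_, ?_, ?_⟩
  · have h1 : A.filter (fun x => ψ (χ x) = i) ⊆
        ((T \ Lg).filter (g · = i - r)).biUnion fun c => A.filter (χ · = c) := by
      intro x hx
      obtain ⟨hxA, hx⟩ := Finset.mem_filter.1 hx
      have hxL : χ x ∉ Lg := fun h => by
        have := hψL _ h
        omega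
      have := hψS _ hxL
      exact Finset.mem_biUnion.2 ⟨χ x, Finset.mem_filter.2 ⟨Finset.mem_sdiff.2
        ⟨Finset.mem_image_of_mem _ hxA, hxL⟩, by omega⟩, Finset.mem_filter.2 ⟨hxA, rfl⟩⟩
    have h2 := (Finset.card_le_card h1).trans Finset.card_biUnion_le
    calc ((A.filter fun x => ψ (χ x) = i).card : ℝ) ≤
          ((∑ c ∈ (T \ Lg).filter (g · = i - r), (A.filter (χ · = c)).card : ℕ) : ℝ) := by
            exact_mod_cast h2
      _ = ∑ c ∈ (T \ Lg).filter (g · = i - r), w c := by push_cast; rfl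
      _ ≤ _ := hgs' _
  · intro y hy
    obtain ⟨x, hx, rfl⟩ := Finset.mem_image.1 hy
    exact Finset.mem_product.2 ⟨hAn hx, Finset.mem_range.2 (hψlt _)⟩
  · intro e he hsub
    obtain ⟨⟨⟨a, d⟩, f⟩, hx, rfl⟩ := Finset.mem_image.1 he
    obtain ⟨hx, -, hf⟩ := Finset.mem_filter.1 hx
    simp only [Finset.mem_product, Finset.mem_Icc] at hx hf
    have hmem : ∀ j : Fin k, a + j * d ∈ A ∧ ψ (χ (a + j * d)) = (f j).val := by
      intro j
      obtain ⟨x, hxA, hx⟩ := Finset.mem_image.1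
        (hsub (Finset.mem_image.2 ⟨j, Finset.mem_univ _, rfl⟩))
      simp only [Prod.mk.injEq] at hx
      obtain ⟨rfl, hx⟩ := hx
      exact ⟨hxA, hx⟩
    obtain ⟨h1, h2⟩ := hχ a d ⟨hx.1.2.1, fun i hi => (hmem ⟨i, hi⟩).1⟩
    rcases hf with ⟨c, hc, hfc⟩ | hf
    · refine h1 fun i hi j hj => ?_
      have e1 := (hmem ⟨i, hi⟩).2
      have e2 := (hmem ⟨j, hj⟩).2
      rw [hfc] at e1 e2
      exact hψinj _ _ (by simp only at e1; omega) (e1.trans e2.symm)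
    · refine h2 fun i hi j hj hij h => hij ?_
      have e1 := (hmem ⟨i, hi⟩).2
      have e2 := (hmem ⟨j, hj⟩).2
      simp only at e1 e2
      rw [h, e2] at e1
      have := hf (Fin.ext e1)
      simpa using this.symm

theorem sum_biUnion_le_sum_sum {α β : Type*} [DecidableEq β] (s : Finset α) (t : α → Finset β)
    {f : β → ℝ} (hf : ∀ b, 0 ≤ f b) : ∑ b ∈ s.biUnion t, f b ≤ ∑ a ∈ s, ∑ b ∈ t a, f b := by
  classical
  induction s using Finset.induction_on with
  | empty => simp
  | insert a s ha ih =>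
    rw [Finset.biUnion_insert, Finset.sum_insert ha]
    have h := Finset.sum_union_inter (s₁ := t a) (s₂ := s.biUnion t) (f := f)
    have h0 : 0 ≤ ∑ b ∈ t a ∩ s.biUnion t, f b := Finset.sum_nonneg fun b _ => hf b
    linarith

theorem sum_powerset_weight_eq (X : Finset ℕ) (f g : ℕ → ℝ) :
    ∑ A ∈ X.powerset, (∏ x ∈ A, f x) * ∏ x ∈ X \ A, g x = ∏ x ∈ X, (f x + g x) :=
  (Finset.prod_add f g X).symm

open scoped Classical in
theorem sum_weight_sparse_le (X B Y : Finset ℕ) (hB : B ⊆ X) (hY : Y ⊆ X) {p : ℝ}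
    (hp0 : 0 ≤ p) (hp1 : p ≤ 1) (a : ℝ) :
    ∑ A ∈ X.powerset.filter (fun A => B ⊆ A ∧ (((A ∩ Y) \ B).card : ℝ) ≤ a),
      p ^ A.card * (1 - p) ^ (X.card - A.card) ≤
        (2 * p) ^ B.card * Real.exp (a - p * Y.card / 2) := by
  set f : ℕ → ℝ := fun x => p * if x ∈ Y \ B then 1 / 2 else 1 with hf
  set g : ℕ → ℝ := fun x => if x ∈ B then 0 else 1 - p with hg
  have hf0 : ∀ x, 0 ≤ f x := fun x => by simp only [hf]; positivity
  have hg0 : ∀ x, 0 ≤ g x := fun x => by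
    simp only [hg]
    split_ifs
    · exact le_rfl
    · linarith
  have hterm : ∀ A ∈ X.powerset.filter (fun A => B ⊆ A ∧ (((A ∩ Y) \ B).card : ℝ) ≤ a),
      p ^ A.card * (1 - p) ^ (X.card - A.card) ≤
        Real.exp a * ((∏ x ∈ A, f x) * ∏ x ∈ X \ A, g x) := by
    intro A hA
    obtain ⟨hAX, hBA, hAa⟩ := Finset.mem_filter.1 hA
    rw [Finset.mem_powerset] at hAX
    have h1 : ∏ x ∈ X \ A, g x = (1 - p) ^ (X.card - A.card) := by
      rw [← Finset.card_sdiff_of_subset hAX]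
      refine Finset.prod_eq_pow_card fun x hx => ?_
      have : x ∉ B := fun h => (Finset.mem_sdiff.1 hx).2 (hBA h)
      simp [hg, this]
    have h2 : ∏ x ∈ A, f x = p ^ A.card * (1 / 2) ^ ((A ∩ Y) \ B).card := by
      rw [Finset.prod_mul_distrib, Finset.prod_const, Finset.prod_ite, Finset.prod_const,
        Finset.prod_const, one_pow, mul_one, Finset.filter_mem_eq_inter, Finset.inter_sdiff_assoc]
    have h3 : 1 ≤ Real.exp a * (1 / 2) ^ ((A ∩ Y) \ B).card := by
      have e1 : Real.exp (-1) ≤ 1 / 2 := by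
        rw [Real.exp_neg, ← one_div]
        have := Real.add_one_le_exp (1 : ℝ)
        exact one_div_le_one_div_of_le (by norm_num) (by linarith)
      calc (1 : ℝ) ≤ Real.exp (a + ((A ∩ Y) \ B).card * (-1)) := by
            rw [Real.one_le_exp_iff]; linarith
        _ = Real.exp a * Real.exp (-1) ^ ((A ∩ Y) \ B).card := by
            rw [Real.exp_add, Real.exp_nat_mul]
        _ ≤ _ := by gcongr
    rw [h1, h2]
    have h4 : 0 ≤ p ^ A.card * (1 - p) ^ (X.card - A.card) :=
      mul_nonneg (by positivity) (pow_nonneg (by linarith) _)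
    calc p ^ A.card * (1 - p) ^ (X.card - A.card) ≤
          p ^ A.card * (1 - p) ^ (X.card - A.card) *
            (Real.exp a * (1 / 2) ^ ((A ∩ Y) \ B).card) := le_mul_of_one_le_right h4 h3
      _ = _ := by ring
  have hprod : ∏ x ∈ X, (f x + g x) ≤ (2 * p) ^ B.card * (1 - p / 2) ^ Y.card := by
    calc ∏ x ∈ X, (f x + g x) ≤
          ∏ x ∈ X, ((if x ∈ B then 2 * p else 1) * (if x ∈ Y then 1 - p / 2 else 1)) := by
          refine Finset.prod_le_prod (fun x _ => add_nonneg (hf0 x) (hg0 x)) fun x _ => ?_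
          simp only [hf, hg, Finset.mem_sdiff]
          by_cases h1 : x ∈ B <;> by_cases h2 : x ∈ Y <;> simp [h1, h2] <;> nlinarith
      _ = _ := by
          rw [Finset.prod_mul_distrib, Finset.prod_ite, Finset.prod_ite]
          simp only [Finset.prod_const, one_pow, mul_one, Finset.filter_mem_eq_inter,
            Finset.inter_eq_right.2 hB, Finset.inter_eq_right.2 hY]
  have hexp : (1 - p / 2) ^ Y.card ≤ Real.exp (-(p * Y.card / 2)) := by
    have : 1 - p / 2 ≤ Real.exp (-(p / 2)) := by
      have := Real.add_one_le_exp (-(p / 2))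
      linarith
    calc (1 - p / 2) ^ Y.card ≤ Real.exp (-(p / 2)) ^ Y.card :=
          pow_le_pow_left₀ (by linarith) this _
      _ = _ := by rw [← Real.exp_nat_mul]; ring_nf
  calc _ ≤ ∑ A ∈ X.powerset.filter (fun A => B ⊆ A ∧ (((A ∩ Y) \ B).card : ℝ) ≤ a),
          Real.exp a * ((∏ x ∈ A, f x) * ∏ x ∈ X \ A, g x) := Finset.sum_le_sum hterm
    _ ≤ ∑ A ∈ X.powerset, Real.exp a * ((∏ x ∈ A, f x) * ∏ x ∈ X \ A, g x) :=
        Finset.sum_le_sum_of_subset_of_nonneg (Finset.filter_subset _ _) fun A _ _ =>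
          mul_nonneg (Real.exp_pos _).le (mul_nonneg (Finset.prod_nonneg fun x _ => hf0 x)
            (Finset.prod_nonneg fun x _ => hg0 x))
    _ = Real.exp a * ∏ x ∈ X, (f x + g x) := by
        rw [← Finset.mul_sum, sum_powerset_weight_eq]
    _ ≤ Real.exp a * ((2 * p) ^ B.card * Real.exp (-(p * Y.card / 2))) := by
        gcongr
        exact hprod.trans (mul_le_mul_of_nonneg_left hexp (by positivity))
    _ = _ := by rw [sub_eq_add_neg, Real.exp_add]; ring

open scoped Classical in
theorem sum_weight_large_le (X : Finset ℕ) {p : ℝ} (hp0 : 0 ≤ p) (hp1 : p ≤ 1) :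
    ∑ A ∈ X.powerset.filter (fun A => 2 * (X.card * p) < A.card),
      p ^ A.card * (1 - p) ^ (X.card - A.card) ≤ Real.exp (-(X.card * p / 4)) := by
  set m : ℝ := X.card * p with hm
  have hm0 : 0 ≤ m := by positivity
  have hw0 : ∀ A : Finset ℕ, 0 ≤ p ^ A.card * (1 - p) ^ (X.card - A.card) := fun A =>
    mul_nonneg (by positivity) (pow_nonneg (by linarith) _)
  have hlog := Real.log_two_gt_d9
  have hlog2 := Real.log_two_lt_d9
  calc _ ≤ ∑ A ∈ X.powerset.filter (fun A => 2 * m < A.card),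
          Real.exp (-(2 * m * Real.log 2)) * ((2 * p) ^ A.card * (1 - p) ^ (X.card - A.card)) := by
        refine Finset.sum_le_sum fun A hA => ?_
        have hA := (Finset.mem_filter.1 hA).2
        have h1 : 1 ≤ Real.exp (-(2 * m * Real.log 2)) * 2 ^ A.card := by
          have : (2 : ℝ) ^ A.card = Real.exp (A.card * Real.log 2) := by
            rw [Real.exp_nat_mul, Real.exp_log (by norm_num)]
          rw [this, ← Real.exp_add, Real.one_le_exp_iff]
          nlinarith
        calc _ ≤ p ^ A.card * (1 - p) ^ (X.card - A.card) *
              (Real.exp (-(2 * m * Real.log 2)) * 2 ^ A.card) :=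
              le_mul_of_one_le_right (hw0 A) h1
          _ = _ := by rw [mul_pow]; ring
    _ ≤ ∑ A ∈ X.powerset,
          Real.exp (-(2 * m * Real.log 2)) * ((2 * p) ^ A.card * (1 - p) ^ (X.card - A.card)) := by
        refine Finset.sum_le_sum_of_subset_of_nonneg (Finset.filter_subset _ _) fun A _ _ => ?_
        exact mul_nonneg (Real.exp_pos _).le
          (mul_nonneg (by positivity) (pow_nonneg (by linarith) _))
    _ = Real.exp (-(2 * m * Real.log 2)) * (1 + p) ^ X.card := by
        rw [← Finset.mul_sum, Finset.sum_pow_mul_eq_add_pow]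
        ring
    _ ≤ Real.exp (-(2 * m * Real.log 2)) * Real.exp m := by
        gcongr
        calc (1 + p) ^ X.card ≤ Real.exp p ^ X.card :=
              pow_le_pow_left₀ (by linarith) (by linarith [Real.add_one_le_exp p]) _
          _ = _ := by rw [← Real.exp_nat_mul]
    _ ≤ _ := by
        rw [← Real.exp_add, Real.exp_le_exp]
        nlinarith

/-- The union bound over containers. -/
theorem one_sub_binomProb_le {n k r : ℕ} (hr : 1 ≤ r) {γ p W : ℝ} (hp0 : 0 < p) (hp1 : p ≤ 1)
    (hn : 1 ≤ n) (hγ : 0 < γ) (hrγ : 2 ≤ r * (γ / 4)) {P : Finset (ℕ × ℕ) → Prop}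
    (hF : HasContainers (2 * p) W
      (IsIndepIn (Finset.Icc 1 n ×ˢ Finset.range (2 * r)) (canonicalHypergraph n k r)) P)
    (hP : ∀ C, P C → ∃ U ⊆ Finset.Ico r (2 * r), γ * n * (U.card + 1) <
      ((Finset.Icc 1 n).filter fun x => ∀ i < 2 * r, (x, i) ∈ C → i ∈ U).card) :
    1 - binomProb n p (IsCanVdW k) ≤
      Real.exp (-(n * p / 4)) + W * Real.exp (-(γ / 2 * (n * p))) := by
  classical
  obtain ⟨F, hFW, hF⟩ := hF
  have hn0 : (0 : ℝ) < n := by exact_mod_cast hn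
  choose! U hUsub hU using hP
  set X := Finset.Icc 1 n with hX
  have hXc : X.card = n := by simp [hX]
  set σ : ℝ := γ / 4 * (n * p) with hσ
  have hσ0 : 0 < σ := by positivity
  set Y : Finset (ℕ × ℕ) → Finset ℕ := fun C =>
    X.filter fun x => ∀ i < 2 * r, (x, i) ∈ C → i ∈ U C with hY
  set μ : Finset ℕ → ℝ := fun A => p ^ A.card * (1 - p) ^ (n - A.card) with hμ
  have hμ0 : ∀ A, 0 ≤ μ A := fun A => mul_nonneg (by positivity) (pow_nonneg (by linarith) _)
  set F' := F.filter fun x => P x.2 ∧ (x.1.image Prod.fst) ⊆ X ∧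
    (x.1.image Prod.fst).card = x.1.card
  set E : Finset (ℕ × ℕ) × Finset (ℕ × ℕ) → Finset (Finset ℕ) := fun x =>
    X.powerset.filter fun A => x.1.image Prod.fst ⊆ A ∧
      (((A ∩ Y x.2) \ x.1.image Prod.fst).card : ℝ) ≤ (U x.2).card * (2 * σ) with hE
  set E₀ := X.powerset.filter fun A => 2 * (X.card * p) < A.card with hE₀
  have htotal : ∑ A ∈ X.powerset, μ A = 1 := by
    have := Finset.sum_pow_mul_eq_add_pow p (1 - p) X
    rw [hXc] at this
    simpa [hμ] using this
  have hcompl : 1 - binomProb n p (IsCanVdW k) =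
      ∑ A ∈ X.powerset.filter (fun A => ¬ IsCanVdW k A), μ A := by
    rw [← htotal, ← Finset.sum_filter_add_sum_filter_not X.powerset (IsCanVdW k)]
    unfold binomProb
    rw [Finset.sum_filter (IsCanVdW k)]
    simp [hμ, hX]
  have hcover : X.powerset.filter (fun A => ¬ IsCanVdW k A) ⊆ E₀ ∪ F'.biUnion E := by
    intro A hA
    obtain ⟨hAX, hA⟩ := Finset.mem_filter.1 hA
    by_cases hbig : 2 * (X.card * p) < A.card
    · exact Finset.mem_union_left _ (Finset.mem_filter.2 ⟨hAX, hbig⟩)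
    rw [not_lt, hXc] at hbig
    obtain ⟨φ, hφ, hind⟩ := exists_independent_recolouring hr (Finset.mem_powerset.1 hAX) hA hσ0
      (by
        calc (A.card : ℝ) ≤ 2 * (n * p) := hbig
          _ ≤ r * (γ / 4) * (n * p) := by gcongr
          _ = r * σ := by rw [hσ]; ring)
    obtain ⟨⟨S, C⟩, hx, hSI, hIC, hPC⟩ := hF _ hind
    simp only at hSI hIC hPC
    have hSA : S.image Prod.fst ⊆ A := by
      intro x hx
      obtain ⟨y, hy, rfl⟩ := Finset.mem_image.1 hx
      obtain ⟨z, hz, rfl⟩ := Finset.mem_image.1 (hSI hy)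
      exact hz
    refine Finset.mem_union_right _ (Finset.mem_biUnion.2 ⟨(S, C), Finset.mem_filter.2
      ⟨hx, hPC, hSA.trans (Finset.mem_powerset.1 hAX), ?_⟩,
      Finset.mem_filter.2 ⟨hAX, hSA, ?_⟩⟩)
    · refine Finset.card_image_of_injOn fun y hy z hz hyz => ?_
      obtain ⟨y, _, rfl⟩ := Finset.mem_image.1 (hSI hy)
      obtain ⟨z, _, rfl⟩ := Finset.mem_image.1 (hSI hz)
      simp only at hyz
      rw [hyz]
    · have hsub : (A ∩ Y C) \ S.image Prod.fst ⊆
          (U C).biUnion fun i => A.filter (φ · = i) := by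
        intro x hx
        simp only [Finset.mem_sdiff, Finset.mem_inter] at hx
        obtain ⟨⟨hxA, hxY⟩, hxS⟩ := hx
        have hxI : (x, φ x) ∈ A.image fun x => (x, φ x) := Finset.mem_image_of_mem _ hxA
        have hxC : (x, φ x) ∈ C := hIC (Finset.mem_sdiff.2 ⟨hxI, fun h =>
          hxS (Finset.mem_image.2 ⟨_, h, rfl⟩)⟩)
        have hlt := (Finset.mem_product.1 (hind.1 hxI)).2
        exact Finset.mem_biUnion.2 ⟨φ x, (Finset.mem_filter.1 hxY).2 _
          (Finset.mem_range.1 hlt) hxC, Finset.mem_filter.2 ⟨hxA, rfl⟩⟩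
      have h1 := (Finset.card_le_card hsub).trans Finset.card_biUnion_le
      calc (((A ∩ Y C) \ S.image Prod.fst).card : ℝ) ≤
            ((∑ i ∈ U C, (A.filter (φ · = i)).card : ℕ) : ℝ) := by exact_mod_cast h1
        _ = ∑ i ∈ U C, ((A.filter (φ · = i)).card : ℝ) := by push_cast; rfl
        _ ≤ ∑ i ∈ U C, 2 * σ := Finset.sum_le_sum fun i hi =>
            hφ i (Finset.mem_Ico.1 (hUsub C hPC hi)).1
        _ = _ := by simp
  have hE₀le : ∑ A ∈ E₀, μ A ≤ Real.exp (-(n * p / 4)) := by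
    have := sum_weight_large_le X hp0.le hp1
    rw [hXc] at this
    simpa only [hE₀, hXc] using this
  have hEle : ∀ x ∈ F', ∑ A ∈ E x, μ A ≤
      (2 * p) ^ x.1.card * Real.exp (-(γ / 2 * (n * p))) := by
    intro x hx
    obtain ⟨-, hPx, hBX, hBc⟩ := Finset.mem_filter.1 hx
    have h := sum_weight_sparse_le X (x.1.image Prod.fst) (Y x.2) hBX (Finset.filter_subset _ _)
      hp0.le hp1 ((U x.2).card * (2 * σ))
    rw [hXc, hBc] at h
    refine h.trans ?_
    gcongr
    have hYc : γ * n * ((U x.2).card + 1) < (Y x.2).card := hU _ hPx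
    have : p * (γ * n * ((U x.2).card + 1)) ≤ p * (Y x.2).card := by gcongr
    rw [hσ]
    linarith
  calc 1 - binomProb n p (IsCanVdW k) ≤ ∑ A ∈ E₀ ∪ F'.biUnion E, μ A := by
        rw [hcompl]
        exact Finset.sum_le_sum_of_subset_of_nonneg hcover fun A _ _ => hμ0 A
    _ ≤ ∑ A ∈ E₀, μ A + ∑ A ∈ F'.biUnion E, μ A := by
        rw [← Finset.sum_union_inter]
        exact le_add_of_nonneg_right (Finset.sum_nonneg fun A _ => hμ0 A)
    _ ≤ ∑ A ∈ E₀, μ A + ∑ x ∈ F', ∑ A ∈ E x, μ A := by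
        gcongr
        exact sum_biUnion_le_sum_sum _ _ hμ0
    _ ≤ Real.exp (-(n * p / 4)) +
          ∑ x ∈ F', (2 * p) ^ x.1.card * Real.exp (-(γ / 2 * (n * p))) :=
        add_le_add hE₀le (Finset.sum_le_sum hEle)
    _ ≤ Real.exp (-(n * p / 4)) + W * Real.exp (-(γ / 2 * (n * p))) := by
        rw [← Finset.sum_mul]
        gcongr
        refine le_trans ?_ hFW
        exact Finset.sum_le_sum_of_subset_of_nonneg (Finset.filter_subset _ _)
          fun x _ _ => by positivity

theorem sum_pow_card_le_exp {V : Type} [DecidableEq V] (X : Finset V) (L : ℕ) {q y : ℝ}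
    (hq : 0 ≤ q) (hy : 0 ≤ y) :
    ∑ S ∈ X.powerset.filter (fun S => S.card ≤ L), q ^ S.card ≤
      Real.exp (y * L + X.card * (q * Real.exp (-y))) := by
  calc _ ≤ ∑ S ∈ X.powerset.filter (fun S => S.card ≤ L),
          Real.exp (y * L) * (q * Real.exp (-y)) ^ S.card := by
        refine Finset.sum_le_sum fun S hS => ?_
        have hS : (S.card : ℝ) ≤ L := by exact_mod_cast (Finset.mem_filter.1 hS).2
        have h1 : 1 ≤ Real.exp (y * L) * Real.exp (-y) ^ S.card := by
          rw [← Real.exp_nat_mul, ← Real.exp_add, Real.one_le_exp_iff]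
          nlinarith
        calc q ^ S.card ≤ q ^ S.card * (Real.exp (y * L) * Real.exp (-y) ^ S.card) :=
              le_mul_of_one_le_right (by positivity) h1
          _ = _ := by rw [mul_pow]; ring
    _ ≤ ∑ S ∈ X.powerset, Real.exp (y * L) * (q * Real.exp (-y)) ^ S.card :=
        Finset.sum_le_sum_of_subset_of_nonneg (Finset.filter_subset _ _)
          fun S _ _ => by positivity
    _ = Real.exp (y * L) * (q * Real.exp (-y) + 1) ^ X.card := by
        rw [← Finset.mul_sum, ← Finset.sum_pow_mul_eq_add_pow]
        simp
    _ ≤ Real.exp (y * L) * Real.exp (q * Real.exp (-y)) ^ X.card := by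
        gcongr
        exact Real.add_one_le_exp _
    _ = _ := by rw [← Real.exp_nat_mul, ← Real.exp_add]

set_option maxHeartbeats 400000 in
theorem random_canonical_vdw_quantitative :
    ∀ k : ℕ, 3 ≤ k → ∃ C c : ℝ, 0 < C ∧ 0 < c ∧ ∃ N : ℕ, ∀ n : ℕ, N ≤ n →
      ∀ p : ℝ, 0 ≤ p → p ≤ 1 →
        C * (n : ℝ) ^ (-(1 : ℝ) / ((k : ℝ) - 1)) < p →
        1 - Real.exp (-(c * n * p)) ≤ binomProb n p (IsCanVdW k) := by
  intro k hk
  obtain ⟨M, hM1, hM⟩ := exists_canonical_vdw k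
  have hM0 : (1 : ℝ) ≤ M := by exact_mod_cast hM1
  obtain ⟨γ, hγ⟩ : ∃ γ : ℝ, γ = 1 / (100 * M ^ 3) := ⟨_, rfl⟩
  have hγ0 : 0 < γ := by rw [hγ]; positivity
  have hγ1 : γ ≤ 1 := by
    rw [hγ, div_le_one (by positivity)]
    have : (1 : ℝ) ≤ M ^ 3 := one_le_pow₀ hM0
    linarith
  obtain ⟨r, hr⟩ := exists_nat_ge (8 / γ)
  have hrγ : 2 ≤ r * (γ / 4) := by
    rw [div_le_iff₀ hγ0] at hr
    linarith
  have hr0 : (1 : ℝ) ≤ r := by nlinarith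
  have hr1 : 1 ≤ r := by exact_mod_cast hr0
  obtain ⟨s, hs1, Q₀, hQ₀, hcont⟩ := exists_containers_few_edges (k - 1)
    ((k * k * (2 * r) ^ k : ℕ) : ℝ) (γ / (2 * r))
    (by
      have : 1 ≤ k * k * (2 * r) ^ k := Nat.one_le_iff_ne_zero.2 (by
        have : k ≠ 0 := by omega
        have : r ≠ 0 := by omega
        simp [*])
      exact_mod_cast this) (by positivity)
  have hs0 : (1 : ℝ) ≤ s := by exact_mod_cast hs1
  obtain ⟨y, hy⟩ : ∃ y : ℝ, y = 32 * r * s / γ := ⟨_, rfl⟩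
  have hyγ : y * γ = 32 * r * s := by rw [hy]; field_simp
  have hy32 : 32 ≤ y * γ := by rw [hyγ]; nlinarith
  have hy1 : 1 ≤ y := by nlinarith
  obtain ⟨n₀, hn₀⟩ := exists_nat_ge (Q₀ ^ (k - 1))
  refine ⟨y ^ 2, γ / 8, by positivity, by positivity, max (100 * M ^ 3) n₀, ?_⟩
  intro n hn p _ hp1 hp
  have hnM : 100 * M ^ 3 ≤ n := (le_max_left _ _).trans hn
  have hn0 : 1 ≤ n := le_trans (by have := Nat.one_le_pow 3 M hM1; omega) hnM
  have hnR : (1 : ℝ) ≤ n := by exact_mod_cast hn0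
  have hnQ₀ : Q₀ ^ (k - 1) ≤ n := hn₀.trans (by exact_mod_cast (le_max_right _ _).trans hn)
  obtain ⟨Q, hQ⟩ : ∃ Q : ℝ, Q = (n : ℝ) ^ ((1 : ℝ) / ((k : ℝ) - 1)) := ⟨_, rfl⟩
  have hkR : ((k - 1 : ℕ) : ℝ) = (k : ℝ) - 1 := by
    rw [Nat.cast_sub (by omega), Nat.cast_one]
  have hQpos : 0 < Q := by rw [hQ]; positivity
  have hQn : Q ^ (k - 1) = n := by
    rw [hQ, ← hkR, one_div, Real.rpow_inv_natCast_pow (by positivity) (by omega)]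
  have hQQ₀ : Q₀ ≤ Q := by
    rw [← hQn] at hnQ₀
    exact (pow_le_pow_iff_left₀ (by linarith) hQpos.le (by omega)).1 hnQ₀
  have hQ1 : 1 ≤ Q := hQ₀.trans hQQ₀
  have hQlen : Q ≤ n := by
    rw [← hQn]
    exact le_self_pow₀ hQ1 (by omega)
  have hpQ : y ^ 2 < p * Q := by
    rw [neg_div, Real.rpow_neg (by positivity), ← hQ, ← div_eq_mul_inv, div_lt_iff₀ hQpos] at hp
    exact hp
  have hp0 : 0 < p := by
    by_contra h
    nlinarith
  have hnp : y ^ 2 ≤ n * p := by nlinarith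
  obtain ⟨N, hN⟩ : ∃ N : ℝ, N = 2 * r * n := ⟨_, rfl⟩
  have hN0 : 0 < N := by rw [hN]; positivity
  have hXN : ((Finset.Icc 1 n ×ˢ Finset.range (2 * r)).card : ℝ) = N := by
    rw [hN]; simp; ring
  have hNQ : 1 ≤ N / Q := by
    rw [one_le_div hQpos, hN]
    nlinarith
  have hL : (⌈N / Q⌉₊ : ℝ) ≤ 2 * (N * p) / y ^ 2 := by
    have h1 := Nat.ceil_lt_add_one (show 0 ≤ N / Q by positivity)
    have h2 : N / Q ≤ N * p / y ^ 2 := by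
      rw [div_le_div_iff₀ hQpos (by positivity)]
      nlinarith
    rw [mul_div_assoc]
    linarith
  have hey : Real.exp (-y) ≤ 1 / y := by
    rw [Real.exp_neg, ← one_div]
    exact one_div_le_one_div_of_le (by linarith) (by linarith [Real.add_one_le_exp y])
  set w := Real.exp (N * p * (4 / y)) with hw
  have hweight : ∑ S ∈ (Finset.Icc 1 n ×ˢ Finset.range (2 * r)).powerset.filter
      (fun S => S.card ≤ ⌈N / Q⌉₊), (2 * p) ^ S.card ≤ w := by
    refine (sum_pow_card_le_exp _ _ (by positivity) (show 0 ≤ y by linarith)).trans ?_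
    rw [hw, Real.exp_le_exp, hXN]
    calc y * (⌈N / Q⌉₊ : ℝ) + N * (2 * p * Real.exp (-y)) ≤
          y * (2 * (N * p) / y ^ 2) + N * (2 * p * (1 / y)) := by gcongr
      _ = N * p * (4 / y) := by field_simp; ring
  have hcontainers := hcont (ℕ × ℕ) (Finset.Icc 1 n ×ˢ Finset.range (2 * r)) N Q (2 * p) w hQQ₀ hN0
    hXN.le (by positivity) (by rw [hw, Real.one_le_exp_iff]; positivity) hweight
    (canonicalHypergraph n k r)
    (by
      rw [Nat.sub_add_cancel (by omega)]
      exact canonicalHypergraph_uniform)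
    (by
      rw [Nat.sub_add_cancel (by omega)]
      exact codeg_canonicalHypergraph (by omega) hQ1 hQn)
  have hW : w ^ s = Real.exp (γ / 4 * (n * p)) := by
    rw [hw, ← Real.exp_nat_mul, hN, hy]
    congr 1
    field_simp
    norm_num
  have hfail := one_sub_binomProb_le (k := k) hr1 hp0 hp1 hn0 hγ0 hrγ hcontainers (by
    rintro C ⟨-, hC⟩
    refine exists_concentrated_lists (by omega) hM1 hM hγ hnM C ?_
    have : γ / (2 * r) * N * Q ^ (k - 1) = γ * n ^ 2 := by
      rw [hQn, hN]
      field_simp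
    rwa [this] at hC)
  rw [hW, ← Real.exp_add] at hfail
  have hnp0 : 0 ≤ n * p := by positivity
  have h1 : Real.exp (-(n * p / 4)) ≤ Real.exp (-(γ / 4 * (n * p))) := by
    rw [Real.exp_le_exp]
    have := mul_le_mul_of_nonneg_right hγ1 hnp0
    linarith
  have h2 : γ / 4 * (n * p) + -(γ / 2 * (n * p)) = -(γ / 4 * (n * p)) := by ring
  rw [h2] at hfail
  have h3 : 2 * Real.exp (-(γ / 4 * (n * p))) ≤ Real.exp (-(γ / 8 * n * p)) := by
    have h4 : 1 ≤ γ / 8 * (n * p) := by nlinarith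
    have h5 : 2 ≤ Real.exp (γ / 8 * (n * p)) := by
      linarith [Real.add_one_le_exp (γ / 8 * (n * p))]
    calc 2 * Real.exp (-(γ / 4 * (n * p))) ≤
          Real.exp (γ / 8 * (n * p)) * Real.exp (-(γ / 4 * (n * p))) := by gcongr
      _ = _ := by rw [← Real.exp_add]; ring_nf
  linarith
end

section
/- For all integers k ≥ 3 and g ≥ 2, there exists a finite set A ⊆ ℕ such that A is can-k-vdW and the k-uniform hypergraph H_{k-AP}(A) contains no cycle of length ℓ for any 2 ≤ ℓ < g (i.e., H_{k-AP}(A) has girth at least g). -/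
/-- The cyclic successor of `i : Fin ℓ`. -/
def cycSucc {ℓ : ℕ} (i : Fin ℓ) : Fin ℓ := ⟨(i.val + 1) % ℓ, Nat.mod_lt _ i.pos⟩

/-- `(e, v)` is a cycle of length `ℓ ≥ 2` in the hypergraph whose edges are the sets
satisfying `E`: the edges `e 1, …, e ℓ` are distinct, the linking vertices
`v 1, …, v ℓ` are distinct, and `v i ∈ e i ∩ e (i+1)` cyclically. -/
def IsCycle {V : Type} (E : Finset V → Prop) {ℓ : ℕ}
    (e : Fin ℓ → Finset V) (v : Fin ℓ → V) : Prop :=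
  2 ≤ ℓ ∧ Function.Injective e ∧ Function.Injective v ∧
    ∀ i : Fin ℓ, E (e i) ∧ v i ∈ e i ∧ v i ∈ e (cycSucc i)

/-- A cycle is minimal if no subset of its edges (with some choice of linking vertices)
forms a cycle of smaller length. -/
def IsMinCycle {V : Type} (E : Finset V → Prop) {ℓ : ℕ}
    (e : Fin ℓ → Finset V) (v : Fin ℓ → V) : Prop :=
  IsCycle E e v ∧ ∀ ℓ' : ℕ, ℓ' < ℓ → ∀ (e' : Fin ℓ' → Finset V) (v' : Fin ℓ' → V),
    ¬ (IsCycle E e' v' ∧ ∀ i : Fin ℓ', ∃ j : Fin ℓ, e' i = e j)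

/-- The `k`-AP `{a, a + d, …, a + (k-1)d}` as a finset. -/
def kAPFinset (k a d : ℕ) : Finset ℕ := (Finset.range k).image (fun i => a + i * d)

/-- The edges of the `k`-uniform hypergraph `H_{k-AP}(A)`: the `k`-APs contained in `A`. -/
def kAPEdge (k : ℕ) (A : Finset ℕ) (s : Finset ℕ) : Prop :=
  ∃ a d : ℕ, 1 ≤ d ∧ s = kAPFinset k a d ∧ s ⊆ A

section

open scoped Classical

/-- No nontrivial three-term arithmetic progression lies in `S`. -/
def AP3Free {V : Type} [AddCommGroup V] (S : Set V) : Prop :=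
  ∀ a ∈ S, ∀ b ∈ S, ∀ c ∈ S, a + c = b + b → a = b

/-- The point `p` of the edge `e` lies on another edge of the subsystem `S`. -/
def SharedPoint {V J : Type} (E : J → Set V) (S : Finset J) (e : J) (p : V) : Prop :=
  p ∈ E e ∧ ∃ e' ∈ S, e' ≠ e ∧ p ∈ E e'

/-- Every subsystem with at least two and fewer than `g` edges has a leaf edge
different from any prescribed edge. -/
def SparseSystem {V J : Type} (E : J → Set V) (g : ℕ) : Prop :=
  ∀ S : Finset J, 2 ≤ S.card → S.card < g → ∀ e₀ ∈ S, ∃ e ∈ S, e ≠ e₀ ∧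
    ∀ p q, SharedPoint E S e p → SharedPoint E S e q → p = q

theorem SparseSystem.exists_leaf_off_vertex {V J : Type} {E : J → Set V} {g : ℕ}
    (h : SparseSystem E g) {S : Finset J} (hne : S.Nonempty) (hS : S.card < g) (w : V) :
    ∃ e ∈ S, ∀ p ∈ E e, ∀ q ∈ E e, (p = w ∨ SharedPoint E S e p) →
      (q = w ∨ SharedPoint E S e q) → p = q := by
  by_cases h1 : S.card = 1
  · obtain ⟨e, rfl⟩ := Finset.card_eq_one.1 h1
    refine ⟨e, by simp, fun p _ q _ hp' hq' => ?_⟩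
    have key : ∀ p, (p = w ∨ SharedPoint E {e} e p) → p = w := by
      rintro p (rfl | ⟨_, e', he', hne, _⟩)
      · rfl
      · exact absurd (Finset.mem_singleton.1 he') hne
    rw [key p hp', key q hq']
  · have h2 : 2 ≤ S.card := by have := hne.card_pos; omega
    by_cases hw : ∃ e₀ ∈ S, w ∈ E e₀
    · obtain ⟨e₀, he₀, hwe⟩ := hw
      obtain ⟨e, he, hee, hl⟩ := h S h2 hS e₀ he₀
      have key : ∀ p ∈ E e, (p = w ∨ SharedPoint E S e p) → SharedPoint E S e p := by
        rintro p hp (rfl | h)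
        · exact ⟨hp, e₀, he₀, hee.symm, hwe⟩
        · exact h
      exact ⟨e, he, fun p hp q hq hp' hq' => hl p q (key p hp hp') (key q hq hq')⟩
    · obtain ⟨e₀, he₀⟩ := hne
      obtain ⟨e, he, hee, hl⟩ := h S h2 hS e₀ he₀
      have key : ∀ p ∈ E e, (p = w ∨ SharedPoint E S e p) → SharedPoint E S e p := by
        rintro p hp (rfl | h)
        · exact absurd ⟨e, he, hp⟩ hw
        · exact h
      exact ⟨e, he, fun p hp q hq hp' hq' => hl p q (key p hp hp') (key q hq hq')⟩

/-- A finite indexed family of parametrised lines in a rational vector space. -/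
structure LineFamily where
  V : Type
  [addCommGroup : AddCommGroup V]
  [module : Module ℚ V]
  J : Type
  [fintype : Fintype J]
  base : J → V
  dir : J → V

namespace LineFamily

attribute [instance] LineFamily.addCommGroup LineFamily.module LineFamily.fintype

/-- The point with parameter `q` on the line `j`. -/
def pt (C : LineFamily) (j : C.J) (q : ℚ) : C.V := C.base j + q • C.dir j

/-- The points of the line `j` with parameters in `X`. -/
def edge (C : LineFamily) (X : Finset ℚ) (j : C.J) : Set C.V := {v | ∃ s ∈ X, C.pt j s = v}

/-- All points with parameters in `X`. -/
def pts (C : LineFamily) (X : Finset ℚ) : Set C.V := {v | ∃ j, v ∈ C.edge X j}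

/-- No line degenerates to a point. -/
def Nondegenerate (C : LineFamily) : Prop := ∀ j, C.dir j ≠ 0

/-- Points with parameters in `G` never coincide with points with parameters in `X`. -/
def Ghost (C : LineFamily) (X G : Finset ℚ) : Prop := ∀ j, ∀ q ∈ G, C.pt j q ∉ C.pts X

/-- Every nontrivial three-term progression of points lies on a single edge. -/
def Induced (C : LineFamily) (X : Finset ℚ) : Prop :=
  ∀ p ∈ C.pts X, ∀ q ∈ C.pts X, ∀ r ∈ C.pts X, p + r = q + q → p ≠ q →
    ∃ j, p ∈ C.edge X j ∧ q ∈ C.edge X j ∧ r ∈ C.edge X j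

/-- The edge `j` is monochromatic or rainbow. -/
def Canonical (C : LineFamily) (X : Finset ℚ) {κ : Type} (χ : C.V → κ) (j : C.J) : Prop :=
  (∀ s ∈ X, ∀ t ∈ X, χ (C.pt j s) = χ (C.pt j t)) ∨
    ∀ s ∈ X, ∀ t ∈ X, χ (C.pt j s) = χ (C.pt j t) → s = t

/-- Every colouring has a canonical edge, even if each point forbids up to `K` edges. -/
def Robust (C : LineFamily) (X : Finset ℚ) (K : ℕ) : Prop :=
  ∀ (κ : Type) (χ : C.V → κ) (σ : C.V → Finset C.J), (∀ v, (σ v).card ≤ K) →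
    ∃ j, C.Canonical X χ j ∧ ∀ s ∈ X, j ∉ σ (C.pt j s)

theorem pt_mem_edge (C : LineFamily) {X : Finset ℚ} (j : C.J) {s : ℚ} (hs : s ∈ X) :
    C.pt j s ∈ C.edge X j := ⟨s, hs, rfl⟩

theorem pt_mem_pts (C : LineFamily) {X : Finset ℚ} (j : C.J) {s : ℚ} (hs : s ∈ X) :
    C.pt j s ∈ C.pts X := ⟨j, s, hs, rfl⟩

theorem pts_finite (C : LineFamily) (X : Finset ℚ) : (C.pts X).Finite := by
  have : C.pts X = ⋃ j : C.J, (C.pt j) '' (X : Set ℚ) := by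
    ext v; simp [pts, edge]
  rw [this]
  exact Set.finite_iUnion fun j => X.finite_toSet.image _

theorem pt_injective (C : LineFamily) {j : C.J} (h : C.dir j ≠ 0) :
    Function.Injective (C.pt j) := by
  intro s t hst
  have h' : s • C.dir j = t • C.dir j := add_left_cancel hst
  exact smul_left_injective ℚ h h'

theorem Induced.ap3Free {C : LineFamily} {X : Finset ℚ} (h : C.Induced X)
    (hd : C.Nondegenerate) (hX : AP3Free (X : Set ℚ)) : AP3Free (C.pts X) := by
  intro p hp q hq r hr hpq
  by_contra hne
  obtain ⟨j, ⟨s, hs, rfl⟩, ⟨t, ht, rfl⟩, ⟨u, hu, rfl⟩⟩ := h p hp q hq r hr hpq hne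
  apply hne
  congr 1
  refine hX s hs t ht u hu ?_
  have : (s + u) • C.dir j = (t + t) • C.dir j := by
    simp only [pt] at hpq
    have h2 := congrArg (fun v => v - C.base j - C.base j) hpq
    simp only [add_smul] at *
    convert h2 using 1 <;> abel
  exact smul_left_injective ℚ (hd j) this

end LineFamily

theorem single_support_of_ap {I : Type} [DecidableEq I] {M : Type} [AddCommGroup M] [Module ℚ M]
    {i₁ i₂ i₃ : I} {c₁ c₂ c₃ : M}
    (h : Pi.single i₁ c₁ + Pi.single i₃ c₃ = (Pi.single i₂ c₂ + Pi.single i₂ c₂ : I → M)) :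
    c₁ + c₃ = c₂ + c₂ ∧ ∃ L, (c₁ = 0 ∨ i₁ = L) ∧ (c₂ = 0 ∨ i₂ = L) ∧ (c₃ = 0 ∨ i₃ = L) := by
  have e1 := congrFun h i₁
  have e2 := congrFun h i₂
  have e3 := congrFun h i₃
  simp only [Pi.add_apply, Pi.single_apply] at e1 e2 e3
  have two : c₂ + c₂ = 0 → c₂ = 0 := fun h0 => by
    have : (2 : ℚ) • c₂ = 0 := by rw [two_smul]; exact h0
    simpa using this
  by_cases h12 : i₁ = i₂ <;> by_cases h13 : i₁ = i₃ <;> by_cases h23 : i₂ = i₃ <;>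
    simp_all [eq_comm]
  exact ⟨i₁⟩

end

section

open scoped Classical

/-- The labels of the lines in the one-coordinate gadget. -/
abbrev GadgetLine (X : Finset ℚ) : Type := Option {t : X × X × X // t.1 ≠ t.2.1}

/-- The space in which the one-coordinate gadget lives. -/
abbrev GadgetSpace : Type := ℚ × (ℚ × ℚ → ℚ)

/-- The lines of the gadget: `y ↦ (y, 0)`, and lines joining `(u, 0)` at parameter `x`
to a unit vector indexed by the pair of parameters, at the second one. -/
noncomputable def gadgetBase {X : Finset ℚ} : GadgetLine X → GadgetSpace
  | none => (0, 0)
  | some ⟨(x, x', u), _⟩ =>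
      ((1 + x / ((x' : ℚ) - x)) * u, Pi.single ((x : ℚ), (x' : ℚ)) (-(x / ((x' : ℚ) - x))))

/-- The directions of the gadget lines. -/
noncomputable def gadgetDir {X : Finset ℚ} : GadgetLine X → GadgetSpace
  | none => (1, 0)
  | some ⟨(x, x', u), _⟩ =>
      (-(1 / ((x' : ℚ) - x)) * u, Pi.single ((x : ℚ), (x' : ℚ)) (1 / ((x' : ℚ) - x)))

/-- The point with parameter `y` on a gadget line. -/
noncomputable def gadgetPt {X : Finset ℚ} (l : GadgetLine X) (y : ℚ) : GadgetSpace :=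
  gadgetBase l + y • gadgetDir l

theorem gadgetPt_none {X : Finset ℚ} (y : ℚ) :
    gadgetPt (none : GadgetLine X) y = (y, 0) := by
  simp [gadgetPt, gadgetBase, gadgetDir]

theorem gadgetPt_some {X : Finset ℚ} (t : {t : X × X × X // t.1 ≠ t.2.1}) (y r : ℚ)
    (h : (t.1.1 : ℚ) + r * ((t.1.2.1 : ℚ) - t.1.1) = y) :
    gadgetPt (some t) y =
      ((1 - r) * t.1.2.2, Pi.single ((t.1.1 : ℚ), (t.1.2.1 : ℚ)) r) := by
  obtain ⟨⟨x, x', u⟩, hx⟩ := t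
  have hne : (x' : ℚ) - x ≠ 0 := fun h0 => hx (Subtype.ext (sub_eq_zero.1 h0).symm)
  simp only [gadgetPt, gadgetBase, gadgetDir] at h ⊢
  subst h
  refine Prod.ext ?_ ?_
  · simp only [Prod.smul_mk, Prod.mk_add_mk, smul_eq_mul]
    field_simp
    ring
  · simp only [Prod.smul_mk, Prod.mk_add_mk, ← Pi.single_smul, ← Pi.single_add]
    congr 1
    simp only [smul_eq_mul]
    field_simp
    ring

theorem gadgetDir_ne_zero {X : Finset ℚ} (l : GadgetLine X) : gadgetDir l ≠ 0 := by
  rcases l with _ | ⟨⟨x, x', u⟩, hx⟩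
  · intro h
    simpa [gadgetDir] using congrArg Prod.fst h
  · intro h
    have hne : (x' : ℚ) - x ≠ 0 := fun h0 => hx (Subtype.ext (sub_eq_zero.1 h0).symm)
    have h2 := congrFun (congrArg Prod.snd h) ((x : ℚ), (x' : ℚ))
    simp only [gadgetDir, Pi.single_eq_same] at h2
    exact one_div_ne_zero hne h2

/-- The parameter along a joining gadget line, normalised to be `0` and `1` at its two endpoints. -/
theorem exists_gadget_param {X : Finset ℚ} (t : {t : X × X × X // t.1 ≠ t.2.1}) (y : ℚ) :
    ∃ r : ℚ, (t.1.1 : ℚ) + r * ((t.1.2.1 : ℚ) - t.1.1) = y := by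
  have hne : (t.1.2.1 : ℚ) - t.1.1 ≠ 0 := fun h0 => t.2 (Subtype.ext (sub_eq_zero.1 h0).symm)
  exact ⟨(y - t.1.1) / ((t.1.2.1 : ℚ) - t.1.1), by field_simp; ring⟩

theorem gadgetPt_ghost {X G : Finset ℚ} (h : Disjoint X G) (l m : GadgetLine X) {q s : ℚ}
    (hq : q ∈ G) (hs : s ∈ X) : gadgetPt l q ≠ gadgetPt m s := by
  have hqX : ∀ u : X, q ≠ u := fun u hu =>
    Finset.disjoint_left.1 h u.2 (hu ▸ hq)
  have hqs : q ≠ s := hqX ⟨s, hs⟩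
  intro he
  rcases l with _ | t <;> rcases m with _ | t'
  · simp only [gadgetPt_none, Prod.mk.injEq, and_true] at he
    exact hqs he
  · obtain ⟨r, hr⟩ := exists_gadget_param t' s
    rw [gadgetPt_none, gadgetPt_some t' s r hr, Prod.mk.injEq] at he
    have h0 : r = 0 := by
      have := congrFun he.2 ((t'.1.1 : ℚ), (t'.1.2.1 : ℚ))
      simpa [eq_comm] using this
    exact hqX t'.1.2.2 (by rw [he.1, h0]; ring)
  · obtain ⟨r, hr⟩ := exists_gadget_param t q
    rw [gadgetPt_none, gadgetPt_some t q r hr, Prod.mk.injEq] at he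
    have h0 : r = 0 := by
      have := congrFun he.2 ((t.1.1 : ℚ), (t.1.2.1 : ℚ))
      simpa using this
    exact hqX t.1.1 (by rw [← hr, h0]; ring)
  · obtain ⟨r, hr⟩ := exists_gadget_param t q
    obtain ⟨r', hr'⟩ := exists_gadget_param t' s
    rw [gadgetPt_some t q r hr, gadgetPt_some t' s r' hr', Prod.mk.injEq] at he
    have h0 : r ≠ 0 := fun h0 => hqX t.1.1 (by rw [← hr, h0]; ring)
    have h1 := congrFun he.2 ((t.1.1 : ℚ), (t.1.2.1 : ℚ))
    rw [Pi.single_eq_same, Pi.single_apply] at h1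
    split_ifs at h1 with hk
    · rw [Prod.mk.injEq] at hk
      apply hqs
      rw [← hr, ← hr', hk.1, hk.2, h1]
    · exact h0 h1

theorem exists_gadgetPt_eq {X : Finset ℚ} (l : GadgetLine X) {s : ℚ} (hs : s ∈ X) :
    ∃ u ∈ X, ∃ (κ : ℚ × ℚ) (r : ℚ), gadgetPt l s = ((1 - r) * u, Pi.single κ r) ∧
      (r = 0 ∨ κ.1 ≠ κ.2 ∧ κ.1 ∈ X ∧ κ.1 + r * (κ.2 - κ.1) ∈ X) := by
  rcases l with _ | t
  · exact ⟨s, hs, (0, 0), 0, by simp [gadgetPt_none], Or.inl rfl⟩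
  · obtain ⟨r, hr⟩ := exists_gadget_param t s
    exact ⟨t.1.2.2, t.1.2.2.2, _, r, gadgetPt_some t s r hr,
      Or.inr ⟨fun h => t.2 (Subtype.ext h), t.1.1.2, by simpa only [hr] using hs⟩⟩

theorem gadgetPt_ap3Free {X : Finset ℚ} (hX : AP3Free (X : Set ℚ)) :
    AP3Free {z | ∃ l : GadgetLine X, ∃ s ∈ X, gadgetPt l s = z} := by
  rintro _ ⟨l₁, s₁, hs₁, rfl⟩ _ ⟨l₂, s₂, hs₂, rfl⟩ _ ⟨l₃, s₃, hs₃, rfl⟩ h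
  obtain ⟨u₁, hu₁, κ₁, r₁, e₁, c₁⟩ := exists_gadgetPt_eq l₁ hs₁
  obtain ⟨u₂, hu₂, κ₂, r₂, e₂, c₂⟩ := exists_gadgetPt_eq l₂ hs₂
  obtain ⟨u₃, hu₃, κ₃, r₃, e₃, c₃⟩ := exists_gadgetPt_eq l₃ hs₃
  rw [e₁, e₂, e₃] at h
  rw [e₁, e₂]
  simp only [Prod.mk_add_mk, Prod.mk.injEq] at h
  obtain ⟨hr, κ, k₁, k₂, k₃⟩ := single_support_of_ap h.2
  have fst : (1 - r₁) * u₁ + (1 - r₃) * u₃ = (1 - r₂) * u₂ + (1 - r₂) * u₂ := h.1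
  have hreq : r₁ = r₂ ∧ (r₁ = 0 ∨ κ₁ = κ₂) := by
    by_cases hz : r₁ = 0 ∧ r₂ = 0 ∧ r₃ = 0
    · exact ⟨hz.1.trans hz.2.1.symm, Or.inl hz.1⟩
    · have hκ : κ.1 ≠ κ.2 ∧ κ.1 ∈ X := by
        by_contra hcon
        apply hz
        refine ⟨?_, ?_, ?_⟩
        · rcases c₁ with c | c
          · exact c
          · rcases k₁ with k | k
            · exact k
            · exact absurd ⟨k ▸ c.1, k ▸ c.2.1⟩ hcon
        · rcases c₂ with c | c
          · exact c
          · rcases k₂ with k | k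
            · exact k
            · exact absurd ⟨k ▸ c.1, k ▸ c.2.1⟩ hcon
        · rcases c₃ with c | c
          · exact c
          · rcases k₃ with k | k
            · exact k
            · exact absurd ⟨k ▸ c.1, k ▸ c.2.1⟩ hcon
      have mem : ∀ (κ' : ℚ × ℚ) (r : ℚ),
          (r = 0 ∨ κ'.1 ≠ κ'.2 ∧ κ'.1 ∈ X ∧ κ'.1 + r * (κ'.2 - κ'.1) ∈ X) →
          (r = 0 ∨ κ' = κ) → κ.1 + r * (κ.2 - κ.1) ∈ X := by
        rintro κ' r (rfl | c) (h | rfl)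
        · simpa using hκ.2
        · simpa using hκ.2
        · subst h; simpa using hκ.2
        · exact c.2.2
      have := hX _ (mem κ₁ r₁ c₁ k₁) _ (mem κ₂ r₂ c₂ k₂) _ (mem κ₃ r₃ c₃ k₃)
        (by linear_combination (κ.2 - κ.1) * hr)
      have h12 : r₁ = r₂ := mul_right_cancel₀ (sub_ne_zero.2 hκ.1.symm) (add_left_cancel this)
      refine ⟨h12, ?_⟩
      rcases k₁ with k | rfl
      · exact Or.inl k
      · rcases k₂ with k | rfl
        · exact Or.inl (h12.trans k)
        · exact Or.inr rfl
  obtain ⟨rfl, hκ⟩ := hreq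
  have h31 : r₃ = r₁ := by linarith
  subst h31
  have hsingle : (Pi.single κ₁ r₃ : ℚ × ℚ → ℚ) = Pi.single κ₂ r₃ := by
    rcases hκ with h0 | h0
    · simp [h0]
    · rw [h0]
  rw [hsingle]
  by_cases h1 : 1 - r₃ = 0
  · rw [h1, zero_mul, zero_mul]
  · have : u₁ = u₂ := hX u₁ hu₁ u₂ hu₂ u₃ hu₃
      (mul_left_cancel₀ h1 (by linear_combination fst))
    rw [this]

end

section

open scoped Classical

/-- Coordinate rules for lines in a power of the gadget: each coordinate either moves along
a gadget line or is fixed at a gadget point. -/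
abbrev ProductRule (X : Finset ℚ) (ι : Type) : Type :=
  {τ : ι → GadgetLine X ⊕ (GadgetLine X × X) // ∃ i l, τ i = Sum.inl l}

/-- The family of lines in a power of the gadget space. -/
noncomputable def productFamily (X : Finset ℚ) (ι : Type) [Fintype ι] : LineFamily where
  V := ι → GadgetSpace
  J := ProductRule X ι
  base τ i := Sum.elim gadgetBase (fun p => gadgetPt p.1 p.2) (τ.1 i)
  dir τ i := Sum.elim gadgetDir (fun _ => 0) (τ.1 i)

theorem productFamily_pt {X : Finset ℚ} {ι : Type} [Fintype ι] (τ : ProductRule X ι) (q : ℚ)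
    (i : ι) : (productFamily X ι).pt τ q i =
      Sum.elim (fun l => gadgetPt l q) (fun p => gadgetPt p.1 p.2) (τ.1 i) := by
  change Sum.elim gadgetBase (fun p => gadgetPt p.1 p.2) (τ.1 i) +
    q • Sum.elim gadgetDir (fun _ => 0) (τ.1 i) = _
  rcases τ.1 i with l | p
  · rfl
  · simp

theorem productFamily_nondegenerate (X : Finset ℚ) (ι : Type) [Fintype ι] :
    (productFamily X ι).Nondegenerate := by
  rintro ⟨τ, i, l, hl⟩ h
  have := congrFun h i
  simp only [productFamily, hl, Sum.elim_inl] at this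
  exact gadgetDir_ne_zero l this

theorem productFamily_ghost {X G : Finset ℚ} (h : Disjoint X G) (ι : Type) [Fintype ι] :
    (productFamily X ι).Ghost X G := by
  rintro ⟨τ, i, l, hl⟩ q hq ⟨⟨τ', hτ'⟩, s, hs, he⟩
  have := (productFamily_pt ⟨τ', hτ'⟩ s i).symm.trans
    ((congrFun he i).trans (productFamily_pt ⟨τ, i, l, hl⟩ q i))
  simp only [hl, Sum.elim_inl] at this
  rcases hm : τ' i with m | p <;> rw [hm] at this
  · exact gadgetPt_ghost h l m hq hs this.symm
  · exact gadgetPt_ghost h l p.1 hq p.2.2 this.symm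

theorem productFamily_ap3Free {X : Finset ℚ} (hX : AP3Free (X : Set ℚ)) (ι : Type)
    [Fintype ι] : AP3Free ((productFamily X ι).pts X) := by
  have mem : ∀ v ∈ (productFamily X ι).pts X, ∀ i,
      v i ∈ {z | ∃ l : GadgetLine X, ∃ s ∈ X, gadgetPt l s = z} := by
    rintro _ ⟨⟨τ, hτ⟩, s, hs, rfl⟩ i
    have h := (productFamily_pt ⟨τ, hτ⟩ s i).symm
    dsimp only at h
    rcases hm : τ i with m | p <;> rw [hm] at h
    · exact ⟨m, s, hs, h⟩
    · exact ⟨p.1, p.2, p.2.2, h⟩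
  intro a ha b hb c hc h
  funext i
  exact gadgetPt_ap3Free hX _ (mem a ha i) _ (mem b hb i) _ (mem c hc i) (congrFun h i)

/-- The canonical van der Waerden theorem along lines of a suitable product family. -/
theorem exists_productFamily_canonical (X : Finset ℚ) : ∃ (ι : Type) (_ : Fintype ι),
    ∀ (κ : Type) (χ : (productFamily X ι).V → κ), ∃ j, (productFamily X ι).Canonical X χ j := by
  obtain ⟨ι, hι, hHJ⟩ := Combinatorics.Line.exists_mono_in_high_dimension (GadgetLine X)
    (Set (X × X))
  refine ⟨ι, hι, fun κ χ => ?_⟩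
  let word : (ι → GadgetLine X) → ℚ → ι → GadgetSpace := fun Φ q i => gadgetPt (Φ i) q
  obtain ⟨l, T, hT⟩ := hHJ fun Φ => {p : X × X | χ (word Φ p.1) = χ (word Φ p.2)}
  have hT' : ∀ a (x x' : X), χ (word (l a) x) = χ (word (l a) x') ↔ (x, x') ∈ T := by
    intro a x x'
    rw [← hT a]; rfl
  obtain ⟨i₀, hi₀⟩ := l.proper
  by_cases hr : ∃ x x' : X, x ≠ x' ∧ (x, x') ∈ T
  · obtain ⟨x, x', hne, hxT⟩ := hr
    let τ : ProductRule X ι := ⟨fun i => match l.idxFun i with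
      | none => Sum.inl none
      | some m => Sum.inr (m, x), i₀, none, by simp [hi₀]⟩
    refine ⟨τ, Or.inl ?_⟩
    have key : ∀ u : X, χ ((productFamily X ι).pt τ u) =
        χ (fun i => match l.idxFun i with
          | none => ((0, Pi.single ((x : ℚ), (x' : ℚ)) 1) : GadgetSpace)
          | some m => gadgetPt m x') := by
      intro u
      let t : {t : X × X × X // t.1 ≠ t.2.1} := ⟨(x, x', u), hne⟩
      have e1 : (productFamily X ι).pt τ u = word (l (some t)) x := by
        funext i
        rw [productFamily_pt]
        simp only [τ, word, Combinatorics.Line.apply_def]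
        rcases l.idxFun i with _ | m
        · simp only [Sum.elim_inl, Option.getD_none]
          rw [gadgetPt_some t x 0 (by simp [t]), gadgetPt_none]
          simp [t]
        · simp
      have e2 : word (l (some t)) x' = fun i => match l.idxFun i with
          | none => ((0, Pi.single ((x : ℚ), (x' : ℚ)) 1) : GadgetSpace)
          | some m => gadgetPt m x' := by
        funext i
        simp only [word, Combinatorics.Line.apply_def]
        rcases l.idxFun i with _ | m
        · simp only [Option.getD_none]
          rw [gadgetPt_some t x' 1 (by simp [t])]
          simp [t]
        · simp
      rw [← e2, e1]
      exact (hT' _ x x').2 hxT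
    intro s hs t ht
    rw [key ⟨s, hs⟩, key ⟨t, ht⟩]
  · let τ : ProductRule X ι := ⟨fun i => Sum.inl (l none i), i₀, _, rfl⟩
    have e : ∀ q, (productFamily X ι).pt τ q = word (l none) q := by
      intro q
      funext i
      rw [productFamily_pt]
      rfl
    refine ⟨τ, Or.inr fun s hs t ht hst => ?_⟩
    rw [e, e] at hst
    by_contra hne
    exact hr ⟨⟨s, hs⟩, ⟨t, ht⟩, fun h => hne (congrArg Subtype.val h),
      (hT' none ⟨s, hs⟩ ⟨t, ht⟩).1 hst⟩

/-- Robust sparse families exist over progression-free parameter sets. -/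
def RobustSparse (g : ℕ) : Prop :=
  ∀ (X G : Finset ℚ) (K : ℕ), Disjoint X G → AP3Free (X : Set ℚ) → ∃ C : LineFamily,
    C.Nondegenerate ∧ C.Ghost X G ∧ AP3Free (C.pts X) ∧ C.Robust X K ∧
      SparseSystem (C.edge X) g

/-- Robust sparse induced families exist over arbitrary parameter sets. -/
def RobustSparseInduced (g : ℕ) : Prop :=
  ∀ (X G : Finset ℚ) (K : ℕ), Disjoint X G → ∃ C : LineFamily,
    C.Nondegenerate ∧ C.Ghost X G ∧ C.Induced X ∧ C.Robust X K ∧ SparseSystem (C.edge X) g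

theorem RobustSparseInduced.robustSparse {g : ℕ} (h : RobustSparseInduced g) :
    RobustSparse g := by
  intro X G K hXG hX
  obtain ⟨C, hd, hG, hI, hR, hS⟩ := h X G K hXG
  exact ⟨C, hd, hG, hI.ap3Free hd hX, hR, hS⟩

theorem robustSparse_two : RobustSparse 2 := by
  intro X G K hXG hX
  obtain ⟨ι, hι, hcan⟩ := exists_productFamily_canonical X
  let P := productFamily X ι
  let C : LineFamily :=
    { V := P.V
      J := P.J × Fin (K * X.card + 1)
      base := fun j => P.base j.1
      dir := fun j => P.dir j.1 }
  have hpts : C.pts X ⊆ P.pts X := by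
    rintro _ ⟨j, s, hs, rfl⟩
    exact ⟨j.1, s, hs, rfl⟩
  refine ⟨C, fun j => productFamily_nondegenerate X ι j.1, ?_, ?_, ?_, ?_⟩
  · exact fun j q hq h => productFamily_ghost hXG ι j.1 q hq (hpts h)
  · intro a ha b hb c hc h
    exact productFamily_ap3Free hX ι a (hpts ha) b (hpts hb) c (hpts hc) h
  · intro κ χ σ hσ
    obtain ⟨j, hj⟩ := hcan κ χ
    by_contra! hcon
    have h1 : ∀ m : Fin (K * X.card + 1), ∃ s ∈ X, (j, m) ∈ σ (P.pt j s) :=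
      fun m => hcon (j, m) hj
    have h2 : (Finset.univ : Finset (Fin (K * X.card + 1))).card ≤
        (X.biUnion fun s => (σ (P.pt j s)).image Prod.snd).card := by
      apply Finset.card_le_card
      intro m _
      obtain ⟨s, hs, hm⟩ := h1 m
      exact Finset.mem_biUnion.2 ⟨s, hs, Finset.mem_image.2 ⟨_, hm, rfl⟩⟩
    have h3 : (X.biUnion fun s => (σ (P.pt j s)).image Prod.snd).card ≤ X.card * K :=
      Finset.card_biUnion_le_card_mul _ _ _ fun s _ => Finset.card_image_le.trans (hσ _)
    rw [Finset.card_univ, Fintype.card_fin] at h2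
    have := h2.trans h3
    rw [mul_comm] at this
    omega
  · intro S h2 h3
    omega

end

section

open scoped Classical

theorem exists_linear_injOn {V : Type} [AddCommGroup V] [Module ℚ V] {F : Set V}
    (hF : F.Finite) : ∃ f : V →ₗ[ℚ] ℚ, Set.InjOn f F := by
  have := hF.to_subtype
  obtain ⟨f, hf⟩ := Module.exists_dual_forall_apply_ne_zero (K := ℚ)
    (fun p : {p : F × F // p.1 ≠ p.2} => (p.1.1 : V) - p.1.2)
    (fun p h => p.2 (Subtype.ext (sub_eq_zero.1 h)))
  refine ⟨f, fun u hu v hv huv => ?_⟩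
  by_contra hne
  refine hf ⟨(⟨u, hu⟩, ⟨v, hv⟩), fun h => hne (congrArg Subtype.val h)⟩ ?_
  change f (u - v) = 0
  rw [map_sub, huv, sub_self]

/-- The canonical van der Waerden theorem along finitely many affine maps of `ℚ`. -/
theorem exists_rational_canonical (X : Finset ℚ) : ∃ (J : Type) (_ : Fintype J) (b d : J → ℚ),
    (∀ j, d j ≠ 0) ∧ ∀ (κ : Type) (χ : ℚ → κ), ∃ j,
      (∀ s ∈ X, ∀ t ∈ X, χ (b j + s * d j) = χ (b j + t * d j)) ∨
      ∀ s ∈ X, ∀ t ∈ X, χ (b j + s * d j) = χ (b j + t * d j) → s = t := by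
  obtain ⟨ι, hι, hcan⟩ := exists_productFamily_canonical X
  let P := productFamily X ι
  obtain ⟨f, hf⟩ := Module.exists_dual_forall_apply_ne_zero (K := ℚ) P.dir
    (productFamily_nondegenerate X ι)
  refine ⟨P.J, P.fintype, fun j => f (P.base j), fun j => f (P.dir j), hf, fun κ χ => ?_⟩
  obtain ⟨j, hj⟩ := hcan κ (fun v => χ (f v))
  refine ⟨j, ?_⟩
  have e : ∀ s, f (P.pt j s) = f (P.base j) + s * f (P.dir j) := fun s => by
    rw [LineFamily.pt, map_add, map_smul, smul_eq_mul]
  simpa only [LineFamily.Canonical, ← e] using hj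

namespace LineFamily

/-- The copy of `v` along the line `l` of `W`, where `f` gives the parameter and the fibre of
`π` over `x` is not separated. -/
noncomputable def lift (P : LineFamily) (π f : P.V →ₗ[ℚ] ℚ) (x : ℚ) (W : LineFamily) (l : W.J)
    (v : P.V) : W.V × (W.J → ℚ) × ℚ :=
  (W.pt l (f v), Pi.single l (π v - x), π v)

/-- One copy of `P` for each line of `W`, glued along `W` over the fibre of `π` over `x`. -/
noncomputable def amalgam (P : LineFamily) (π f : P.V →ₗ[ℚ] ℚ) (x : ℚ) (W : LineFamily) :
    LineFamily where
  V := W.V × (W.J → ℚ) × ℚ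
  J := W.J × P.J
  base j := lift P π f x W j.1 (P.base j.2)
  dir j := (f (P.dir j.2) • W.dir j.1, Pi.single j.1 (π (P.dir j.2)), π (P.dir j.2))

theorem amalgam_pt {P : LineFamily} {π f : P.V →ₗ[ℚ] ℚ} {x : ℚ} {W : LineFamily} (l : W.J)
    (j : P.J) (q : ℚ) :
    (amalgam P π f x W).pt (l, j) q = lift P π f x W l (P.pt j q) := by
  change lift P π f x W l (P.base j) +
    q • (f (P.dir j) • W.dir l, (Pi.single l (π (P.dir j)) : W.J → ℚ), π (P.dir j)) = _
  simp only [lift, pt, map_add, map_smul, Prod.smul_mk, Prod.mk_add_mk, smul_eq_mul, add_smul,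
    mul_smul, ← Pi.single_smul, ← Pi.single_add, add_assoc]
  congr 3
  ring

theorem lift_ap {P : LineFamily} {π f : P.V →ₗ[ℚ] ℚ} {x : ℚ} {W : LineFamily} (l : W.J)
    {u v w : P.V} (h : u + w = v + v) :
    lift P π f x W l u + lift P π f x W l w = lift P π f x W l v + lift P π f x W l v := by
  have hf : f u + f w = f v + f v := by rw [← map_add, h, map_add]
  have hπ : π u + π w = π v + π v := by rw [← map_add, h, map_add]
  simp only [lift, pt, Prod.mk_add_mk, ← Pi.single_add]
  refine Prod.ext ?_ (Prod.ext ?_ hπ)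
  · have : (f u + f w) • W.dir l = (f v + f v) • W.dir l := by rw [hf]
    simp only [add_smul] at this
    rw [add_add_add_comm, this, add_add_add_comm]
  · simp only
    congr 1
    linear_combination hπ

/-- The data needed to glue copies of `P` along `W` without creating unwanted coincidences. -/
structure Amalgamable (P : LineFamily) (X : Finset ℚ) (π f : P.V →ₗ[ℚ] ℚ) (x : ℚ)
    (W : LineFamily) (X' G' : Finset ℚ) (Q : Set P.V) : Prop where
  dir_ne : ∀ j, π (P.dir j) ≠ 0
  pts_subset : P.pts X ⊆ Q
  reflect_mem : ∀ p ∈ P.pts X, ∀ q ∈ P.pts X, q + q - p ∈ Q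
  midpoint_mem : ∀ p ∈ P.pts X, ∀ q ∈ P.pts X, (1 / 2 : ℚ) • (p + q) ∈ Q
  injOn : Set.InjOn f Q
  mem_fibre : ∀ v ∈ P.pts X, π v = x → f v ∈ X'
  mem_ghost : ∀ v ∈ Q, v ∉ P.pts X → π v = x → f v ∈ G'
  nondegenerate : W.Nondegenerate
  ghost : W.Ghost X' G'
  ap3Free : AP3Free (W.pts X')

namespace Amalgamable

variable {P : LineFamily} {X : Finset ℚ} {π f : P.V →ₗ[ℚ] ℚ} {x : ℚ} {W : LineFamily}
  {X' G' : Finset ℚ} {Q : Set P.V}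

theorem mem_edge_iff {l : W.J} {j : P.J} {z : W.V × (W.J → ℚ) × ℚ} :
    z ∈ (amalgam P π f x W).edge X (l, j) ↔ ∃ u ∈ P.edge X j, lift P π f x W l u = z := by
  constructor
  · rintro ⟨s, hs, rfl⟩
    exact ⟨P.pt j s, P.pt_mem_edge j hs, (amalgam_pt l j s).symm⟩
  · rintro ⟨_, ⟨s, hs, rfl⟩, rfl⟩
    exact ⟨s, hs, amalgam_pt l j s⟩

theorem mem_pts_iff {z : W.V × (W.J → ℚ) × ℚ} :
    z ∈ (amalgam P π f x W).pts X ↔ ∃ l, ∃ u ∈ P.pts X, lift P π f x W l u = z := by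
  constructor
  · rintro ⟨⟨l, j⟩, h⟩
    obtain ⟨u, hu, rfl⟩ := mem_edge_iff.1 h
    exact ⟨l, u, ⟨j, hu⟩, rfl⟩
  · rintro ⟨l, u, ⟨j, hu⟩, rfl⟩
    exact ⟨(l, j), mem_edge_iff.2 ⟨u, hu, rfl⟩⟩

theorem lift_proj {l l' : W.J} {u v : P.V} (h : lift P π f x W l u = lift P π f x W l' v) :
    π u = π v := congrArg (fun z => z.2.2) h

theorem lift_index {l l' : W.J} {u v : P.V} (h : lift P π f x W l u = lift P π f x W l' v)
    (hu : π u ≠ x) : l = l' := by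
  have h1 := congrFun (congrArg (fun z => z.2.1) h) l
  simp only [lift, Pi.single_eq_same, Pi.single_apply] at h1
  by_contra hne
  rw [if_neg hne] at h1
  exact hu (sub_eq_zero.1 h1)

theorem lift_injOn (H : Amalgamable P X π f x W X' G' Q) {l : W.J} {u v : P.V} (hu : u ∈ Q)
    (hv : v ∈ Q) (h : lift P π f x W l u = lift P π f x W l v) : u = v :=
  H.injOn hu hv (W.pt_injective (H.nondegenerate l) (congrArg Prod.fst h))

theorem mem_of_lift_mem (H : Amalgamable P X π f x W X' G' Q) {l : W.J} {v : P.V} (hv : v ∈ Q)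
    (h : lift P π f x W l v ∈ (amalgam P π f x W).pts X) : v ∈ P.pts X := by
  obtain ⟨l', u, hu, he⟩ := mem_pts_iff.1 h
  by_cases hx : π v = x
  · by_contra hcon
    refine H.ghost l (f v) (H.mem_ghost v hv hcon hx) ?_
    have : W.pt l' (f u) = W.pt l (f v) := congrArg Prod.fst he
    rw [← this]
    exact W.pt_mem_pts l' (H.mem_fibre u hu ((lift_proj he).trans hx))
  · obtain rfl := lift_index he.symm hx
    rw [← H.lift_injOn (H.pts_subset hu) hv he]
    exact hu

theorem exists_edge_of_ap (hI : P.Induced X) (l : W.J) {u v w : P.V} (hu : u ∈ P.pts X)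
    (hv : v ∈ P.pts X) (hw : w ∈ P.pts X) (h : u + w = v + v) (hne : u ≠ v) :
    ∃ j, lift P π f x W l u ∈ (amalgam P π f x W).edge X j ∧
      lift P π f x W l v ∈ (amalgam P π f x W).edge X j ∧
      lift P π f x W l w ∈ (amalgam P π f x W).edge X j := by
  obtain ⟨j, h1, h2, h3⟩ := hI u hu v hv w hw h hne
  exact ⟨(l, j), mem_edge_iff.2 ⟨u, h1, rfl⟩, mem_edge_iff.2 ⟨v, h2, rfl⟩,
    mem_edge_iff.2 ⟨w, h3, rfl⟩⟩

theorem induced (H : Amalgamable P X π f x W X' G' Q) (hI : P.Induced X) :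
    (amalgam P π f x W).Induced X := by
  intro p hp q hq r hr hpr hne
  have hp0 := hp
  have hq0 := hq
  have hr0 := hr
  obtain ⟨l₁, u₁, hu₁, rfl⟩ := mem_pts_iff.1 hp
  obtain ⟨l₂, u₂, hu₂, rfl⟩ := mem_pts_iff.1 hq
  obtain ⟨l₃, u₃, hu₃, rfl⟩ := mem_pts_iff.1 hr
  replace hpr : lift P π f x W l₁ u₁ + lift P π f x W l₃ u₃ =
    lift P π f x W l₂ u₂ + lift P π f x W l₂ u₂ := hpr
  have h1 : W.pt l₁ (f u₁) + W.pt l₃ (f u₃) = W.pt l₂ (f u₂) + W.pt l₂ (f u₂) :=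
    congrArg Prod.fst hpr
  have h2 : (Pi.single l₁ (π u₁ - x) + Pi.single l₃ (π u₃ - x) : W.J → ℚ) =
    Pi.single l₂ (π u₂ - x) + Pi.single l₂ (π u₂ - x) := congrArg (fun z => z.2.1) hpr
  obtain ⟨hc, L, k₁, k₂, k₃⟩ := single_support_of_ap h2
  have two_equal : l₁ = l₂ ∨ l₃ = l₂ ∨ l₁ = l₃ := by
    by_contra! hcon
    have hall : π u₁ = x ∧ π u₂ = x ∧ π u₃ = x := by
      rcases k₁ with k₁ | rfl <;> rcases k₂ with k₂ | rfl <;> rcases k₃ with k₃ | rfl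
      · exact ⟨by linarith, by linarith, by linarith⟩
      · exact ⟨by linarith, by linarith, by linarith⟩
      · exact ⟨by linarith, by linarith, by linarith⟩
      · exact absurd rfl hcon.2.1
      · exact ⟨by linarith, by linarith, by linarith⟩
      · exact absurd rfl hcon.2.2
      · exact absurd rfl hcon.1
      · exact absurd rfl hcon.1
    have := H.ap3Free _ (W.pt_mem_pts l₁ (H.mem_fibre u₁ hu₁ hall.1)) _
      (W.pt_mem_pts l₂ (H.mem_fibre u₂ hu₂ hall.2.1)) _
      (W.pt_mem_pts l₃ (H.mem_fibre u₃ hu₃ hall.2.2)) h1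
    apply hne
    simp only [lift, this, hall.1, hall.2.1, sub_self, Pi.single_zero]
    rfl
  rcases two_equal with rfl | rfl | rfl
  · have hap : u₁ + (u₂ + u₂ - u₁) = u₂ + u₂ := by abel
    have hr' : lift P π f x W l₃ u₃ = lift P π f x W l₁ (u₂ + u₂ - u₁) :=
      add_left_cancel (hpr.trans (lift_ap l₁ hap).symm)
    rw [hr'] at hr0 ⊢
    exact exists_edge_of_ap hI l₁ hu₁ hu₂
      (H.mem_of_lift_mem (H.reflect_mem u₁ hu₁ u₂ hu₂) hr0) hap (fun h => hne (by rw [h]))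
  · have hap : (u₂ + u₂ - u₃) + u₃ = u₂ + u₂ := by abel
    have hr' : lift P π f x W l₁ u₁ = lift P π f x W l₃ (u₂ + u₂ - u₃) :=
      add_right_cancel (hpr.trans (lift_ap l₃ hap).symm)
    rw [hr'] at hp0 hne ⊢
    exact exists_edge_of_ap hI l₃ (H.mem_of_lift_mem (H.reflect_mem u₃ hu₃ u₂ hu₂) hp0) hu₂
      hu₃ hap (fun h => hne (by rw [h]))
  · have hap : u₁ + u₃ = (1 / 2 : ℚ) • (u₁ + u₃) + (1 / 2 : ℚ) • (u₁ + u₃) := by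
      rw [← add_smul]; norm_num
    have hr' : lift P π f x W l₂ u₂ = lift P π f x W l₁ ((1 / 2 : ℚ) • (u₁ + u₃)) := by
      have h3 := hpr.symm.trans (lift_ap l₁ hap)
      rw [← two_smul ℚ, ← two_smul ℚ] at h3
      exact smul_right_injective _ (two_ne_zero (α := ℚ)) h3
    rw [hr'] at hq0 hne ⊢
    exact exists_edge_of_ap hI l₁ hu₁ (H.mem_of_lift_mem (H.midpoint_mem u₁ hu₁ u₃ hu₃) hq0)
      hu₃ hap (fun h => hne (by rw [← h]))

end Amalgamable

end LineFamily

end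

section

open scoped Classical

namespace LineFamily.Amalgamable

variable {P : LineFamily} {X : Finset ℚ} {π f : P.V →ₗ[ℚ] ℚ} {x : ℚ} {W : LineFamily}
  {X' G' : Finset ℚ} {Q : Set P.V}

theorem edge_fibre_subsingleton (H : Amalgamable P X π f x W X' G' Q) {j : P.J} {u v : P.V}
    (hu : u ∈ P.edge X j) (hv : v ∈ P.edge X j) (hux : π u = x) (hvx : π v = x) : u = v := by
  obtain ⟨s, _, rfl⟩ := hu
  obtain ⟨t, _, rfl⟩ := hv
  have h := hux.trans hvx.symm
  simp only [pt, map_add, map_smul, smul_eq_mul] at h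
  rw [mul_right_cancel₀ (H.dir_ne j) (add_left_cancel h)]

/-- A shared point of the amalgam is shared inside one copy of `P`, or lies over `x` and is
shared in `W`. -/
theorem sharedPoint_cases (H : Amalgamable P X π f x W X' G' Q) {S : Finset (W.J × P.J)}
    {l : W.J} {j : P.J} {z : W.V × (W.J → ℚ) × ℚ}
    (hz : SharedPoint ((amalgam P π f x W).edge X) S (l, j) z) :
    ∃ u ∈ P.edge X j, lift P π f x W l u = z ∧
      (SharedPoint (P.edge X) ((S.filter fun e => e.1 = l).image Prod.snd) j u ∨
        π u = x ∧ SharedPoint (W.edge X') (S.image Prod.fst) l (W.pt l (f u))) := by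
  obtain ⟨h1, ⟨l', j'⟩, he', hne, h2⟩ := hz
  obtain ⟨u, hu, rfl⟩ := mem_edge_iff.1 h1
  obtain ⟨u', hu', h⟩ := mem_edge_iff.1 h2
  refine ⟨u, hu, rfl, ?_⟩
  by_cases hl : l' = l
  · subst hl
    obtain rfl := H.lift_injOn (H.pts_subset ⟨j', hu'⟩) (H.pts_subset ⟨j, hu⟩) h
    exact Or.inl ⟨hu, j', Finset.mem_image.2 ⟨(l', j'), Finset.mem_filter.2 ⟨he', rfl⟩, rfl⟩,
      fun hj => hne (by rw [hj]), hu'⟩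
  · have hx : π u' = x := by
      by_contra hx
      exact hl (lift_index h hx)
    have hux : π u = x := (lift_proj h).symm.trans hx
    refine Or.inr ⟨hux, W.pt_mem_edge l (H.mem_fibre u ⟨j, hu⟩ hux), l',
      Finset.mem_image.2 ⟨(l', j'), he', rfl⟩, hl, ?_⟩
    have hp : W.pt l' (f u') = W.pt l (f u) := congrArg Prod.fst h
    rw [← hp]
    exact W.pt_mem_edge l' (H.mem_fibre u' ⟨j', hu'⟩ hx)

theorem sparse (H : Amalgamable P X π f x W X' G' Q) {g : ℕ}
    (hP : SparseSystem (P.edge X) (g + 1)) (hW : SparseSystem (W.edge X') g) :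
    SparseSystem ((amalgam P π f x W).edge X) (g + 1) := by
  intro S h2 hg e₀ he₀
  change Finset (W.J × P.J) at S
  change W.J × P.J at e₀
  obtain ⟨l₀, j₀⟩ := e₀
  by_cases hM : ∀ e ∈ S, e.1 = l₀
  · have hfilter : S.filter (fun e => e.1 = l₀) = S := Finset.filter_true_of_mem hM
    have hcard : (S.image Prod.snd).card = S.card := by
      refine Finset.card_image_of_injOn fun a ha b hb hab => ?_
      exact Prod.ext ((hM a ha).trans (hM b hb).symm) hab
    obtain ⟨j, hj, hjne, hleaf⟩ := hP (S.image Prod.snd) (by rw [hcard]; exact h2)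
      (by rw [hcard]; exact hg) j₀ (Finset.mem_image.2 ⟨_, he₀, rfl⟩)
    obtain ⟨⟨l, j'⟩, he, rfl⟩ := Finset.mem_image.1 hj
    obtain rfl : l = l₀ := hM _ he
    refine ⟨(l, j'), he, fun h => hjne (congrArg Prod.snd h), fun z z' hz hz' => ?_⟩
    have key : ∀ z, SharedPoint ((amalgam P π f x W).edge X) S (l, j') z →
        ∃ u, lift P π f x W l u = z ∧ SharedPoint (P.edge X) (S.image Prod.snd) j' u := by
      intro z hz
      obtain ⟨u, _, hu, h | ⟨_, _, l', hl', hne, _⟩⟩ := H.sharedPoint_cases hz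
      · exact ⟨u, hu, by rwa [hfilter] at h⟩
      · obtain ⟨e, he, rfl⟩ := Finset.mem_image.1 hl'
        exact absurd (hM e he) hne
    obtain ⟨u, rfl, hu⟩ := key z hz
    obtain ⟨u', rfl, hu'⟩ := key z' hz'
    rw [hleaf u u' hu hu']
  · push Not at hM
    by_cases hsingle : ∃ e ∈ S, e.1 ≠ l₀ ∧ ∀ e' ∈ S, e'.1 = e.1 → e' = e
    · obtain ⟨⟨l, j⟩, he, hl, huniq⟩ := hsingle
      refine ⟨(l, j), he, fun h => hl (congrArg Prod.fst h), fun z z' hz hz' => ?_⟩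
      have key : ∀ z, SharedPoint ((amalgam P π f x W).edge X) S (l, j) z →
          ∃ u ∈ P.edge X j, lift P π f x W l u = z ∧ π u = x := by
        intro z hz
        obtain ⟨u, hu, hz, ⟨_, j', hj', hne, _⟩ | h⟩ := H.sharedPoint_cases hz
        · obtain ⟨e', he', rfl⟩ := Finset.mem_image.1 hj'
          rw [Finset.mem_filter] at he'
          exact absurd (congrArg Prod.snd (huniq e' he'.1 he'.2)) hne
        · exact ⟨u, hu, hz, h.1⟩
      obtain ⟨u, hu, rfl, hux⟩ := key z hz
      obtain ⟨u', hu', rfl, hux'⟩ := key z' hz'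
      rw [H.edge_fibre_subsingleton hu hu' hux hux']
    · push Not at hsingle
      set M := S.image Prod.fst with hMdef
      have hl₀ : l₀ ∈ M := Finset.mem_image.2 ⟨_, he₀, rfl⟩
      obtain ⟨e₁, he₁, hne₁⟩ := hM
      have hM2 : 2 ≤ M.card :=
        Finset.one_lt_card.2 ⟨l₀, hl₀, e₁.1, Finset.mem_image.2 ⟨_, he₁, rfl⟩, hne₁.symm⟩
      have hcount : 2 * M.card ≤ S.card + 1 := by
        have h1 := Finset.card_eq_sum_card_image Prod.fst S
        rw [← hMdef, ← Finset.add_sum_erase _ _ hl₀] at h1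
        have h3 : 1 ≤ (S.filter fun e => e.1 = l₀).card :=
          Finset.card_pos.2 ⟨_, Finset.mem_filter.2 ⟨he₀, rfl⟩⟩
        have h4 : (M.erase l₀).card * 2 ≤
            ∑ l ∈ M.erase l₀, (S.filter fun e => e.1 = l).card := by
          rw [← smul_eq_mul]
          refine Finset.card_nsmul_le_sum _ _ _ fun l hl => ?_
          obtain ⟨hl1, hl2⟩ := Finset.mem_erase.1 hl
          obtain ⟨e, he, rfl⟩ := Finset.mem_image.1 hl2
          obtain ⟨e', he', h5, h6⟩ := hsingle e he hl1
          exact Finset.one_lt_card.2 ⟨e, Finset.mem_filter.2 ⟨he, rfl⟩, e',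
            Finset.mem_filter.2 ⟨he', h5⟩, h6.symm⟩
        rw [Finset.card_erase_of_mem hl₀] at h4
        omega
      obtain ⟨l, hl, hlne, hleaf⟩ := hW M hM2 (by have hg' : S.card < g + 1 := hg; omega) l₀ hl₀
      set T := (S.filter fun e => e.1 = l).image Prod.snd with hT
      have hTne : T.Nonempty := by
        obtain ⟨e, he, rfl⟩ := Finset.mem_image.1 hl
        exact ⟨e.2, Finset.mem_image.2 ⟨e, Finset.mem_filter.2 ⟨he, rfl⟩, rfl⟩⟩
      have hTcard : T.card < g + 1 :=
        lt_of_le_of_lt (Finset.card_image_le.trans (Finset.card_filter_le _ _)) hg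
      obtain ⟨w, hw⟩ : ∃ w, ∀ u ∈ P.pts X, π u = x →
          SharedPoint (W.edge X') M l (W.pt l (f u)) → u = w := by
        by_cases hex : ∃ w ∈ P.pts X, π w = x ∧ SharedPoint (W.edge X') M l (W.pt l (f w))
        · obtain ⟨w, hw, _, hws⟩ := hex
          exact ⟨w, fun u hu _ hus => H.injOn (H.pts_subset hu) (H.pts_subset hw)
            (W.pt_injective (H.nondegenerate l) (hleaf _ _ hus hws))⟩
        · exact ⟨0, fun u hu hux hus => absurd ⟨u, hu, hux, hus⟩ hex⟩
      obtain ⟨j, hj, hjleaf⟩ := hP.exists_leaf_off_vertex hTne hTcard w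
      obtain ⟨⟨l', j'⟩, he, rfl⟩ := Finset.mem_image.1 hj
      obtain ⟨heS, rfl⟩ := Finset.mem_filter.1 he
      refine ⟨_, heS, fun h => hlne (congrArg Prod.fst h), fun z z' hz hz' => ?_⟩
      have key : ∀ z, SharedPoint ((amalgam P π f x W).edge X) S (l', j') z →
          ∃ u ∈ P.edge X j', lift P π f x W l' u = z ∧
            (u = w ∨ SharedPoint (P.edge X) T j' u) := by
        intro z hz
        obtain ⟨u, hu, hz, h | h⟩ := H.sharedPoint_cases hz
        · exact ⟨u, hu, hz, Or.inr h⟩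
        · exact ⟨u, hu, hz, Or.inl (hw u ⟨j', hu⟩ h.1 h.2)⟩
      obtain ⟨u, hu, rfl, h⟩ := key z hz
      obtain ⟨u', hu', rfl, h'⟩ := key z' hz'
      rw [hjleaf u hu u' hu' h h']

end LineFamily.Amalgamable

end

section

open scoped Classical

namespace LineFamily

/-- A choice `θ` of one line of `C` over each base line whose points over `D` are fibrewise
monochromatic (with colour prescribed by `col`) or fibrewise rainbow, where rainbow fibres do not
interact along a line and no point forbids the line it lies on. -/
def IsUniformSection (C : LineFamily) (X : Finset ℚ) {J₀ : Type} (b d : J₀ → ℚ)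
    (lab : C.J → J₀) (D : Finset ℚ) {κ : Type} (χ : C.V → κ) (σ : C.V → Finset C.J)
    (θ : J₀ → C.J) (col : ℚ → Option κ) : Prop :=
  (∀ a, lab (θ a) = a) ∧ ∀ x ∈ D,
    (∀ c, col x = some c → ∀ a, ∀ s ∈ X, b a + s * d a = x → χ (C.pt (θ a) s) = c) ∧
    (col x = none → ∀ a, ∀ s ∈ X, b a + s * d a = x → ∀ a', ∀ s' ∈ X, b a' + s' * d a' = x →
      χ (C.pt (θ a) s) = χ (C.pt (θ a') s') → a = a') ∧
    (∀ a, ∀ s ∈ X, b a + s * d a = x → θ a ∉ σ (C.pt (θ a) s)) ∧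
    ∀ y ∈ D, x ≠ y → col x = none → col y = none → ∀ a, ∀ s ∈ X, b a + s * d a = x →
      ∀ t ∈ X, b a + t * d a = y → χ (C.pt (θ a) s) ≠ χ (C.pt (θ a) t)

/-- A sparse induced family over the base lines `q ↦ b a + q * d a`, separated outside the
fibres over `D`, in which every colouring admits a uniform section over `D`. -/
structure IsPartite (C : LineFamily) (X G : Finset ℚ) {J₀ : Type} (b d : J₀ → ℚ) (g : ℕ)
    (D : Finset ℚ) (K : ℕ) (π : C.V →ₗ[ℚ] ℚ) (lab : C.J → J₀) : Prop where
  base_eq : ∀ j, π (C.base j) = b (lab j)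
  dir_eq : ∀ j, π (C.dir j) = d (lab j)
  ghost : C.Ghost X G
  induced : C.Induced X
  sparse : SparseSystem (C.edge X) (g + 1)
  separated : ∀ j j', ∀ s ∈ X, ∀ s' ∈ X, C.pt j s = C.pt j' s' → π (C.pt j s) ∉ D → j = j'
  ramsey : ∀ (κ : Type) (χ : C.V → κ) (σ : C.V → Finset C.J), (∀ v, (σ v).card ≤ K) →
    ∃ θ col, C.IsUniformSection X b d lab D χ σ θ col

theorem IsPartite.proj_pt {C : LineFamily} {X G : Finset ℚ} {J₀ : Type} {b d : J₀ → ℚ} {g : ℕ}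
    {D : Finset ℚ} {K : ℕ} {π : C.V →ₗ[ℚ] ℚ} {lab : C.J → J₀}
    (h : C.IsPartite X G b d g D K π lab) (j : C.J) (q : ℚ) :
    π (C.pt j q) = b (lab j) + q * d (lab j) := by
  rw [pt, map_add, map_smul, h.base_eq, h.dir_eq, smul_eq_mul]

theorem exists_isPartite_empty {X G : Finset ℚ} (hXG : Disjoint X G) {J₀ : Type} [Fintype J₀]
    (b d : J₀ → ℚ) (g K : ℕ) :
    ∃ (C : LineFamily) (π : C.V →ₗ[ℚ] ℚ) (lab : C.J → J₀), C.IsPartite X G b d g ∅ K π lab := by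
  let C : LineFamily :=
    { V := (J₀ → ℚ) × ℚ × ℚ
      J := J₀
      base := fun a => (Pi.single a 1, 0, b a)
      dir := fun a => (0, 1, d a) }
  have hpt : ∀ (a : J₀) (q : ℚ), C.pt a q = (Pi.single a 1, q, b a + q * d a) := by
    intro a q
    change ((Pi.single a 1 : J₀ → ℚ), (0 : ℚ), b a) + q • ((0 : J₀ → ℚ), (1 : ℚ), d a) = _
    simp
  have hindex : ∀ a a' : J₀, (Pi.single a 1 : J₀ → ℚ) = Pi.single a' 1 → a = a' := by
    intro a a' h
    have := congrFun h a
    rw [Pi.single_eq_same, Pi.single_apply] at this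
    by_contra hne
    rw [if_neg hne] at this
    exact one_ne_zero this
  have hinj : ∀ (a a' : J₀) (q q' : ℚ), C.pt a q = C.pt a' q' → a = a' ∧ q = q' := by
    intro a a' q q' h
    rw [hpt, hpt] at h
    exact ⟨hindex a a' (congrArg Prod.fst h), congrArg (fun z => z.2.1) h⟩
  refine ⟨C, (LinearMap.snd ℚ ℚ ℚ).comp (LinearMap.snd ℚ (J₀ → ℚ) (ℚ × ℚ)), id,
    fun _ => rfl, fun _ => rfl, ?_, ?_, ?_, ?_, ?_⟩
  · rintro a q hq ⟨a', s, hs, h⟩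
    obtain ⟨-, rfl⟩ := hinj _ _ _ _ h
    exact Finset.disjoint_left.1 hXG hs hq
  · rintro _ ⟨a₁, s₁, hs₁, rfl⟩ _ ⟨a₂, s₂, hs₂, rfl⟩ _ ⟨a₃, s₃, hs₃, rfl⟩ h _
    have h0 : C.pt a₁ s₁ + C.pt a₃ s₃ = C.pt a₂ s₂ + C.pt a₂ s₂ := h
    rw [hpt, hpt, hpt] at h
    have h1 : (Pi.single a₁ 1 + Pi.single a₃ 1 : J₀ → ℚ) = Pi.single a₂ 1 + Pi.single a₂ 1 :=
      congrArg Prod.fst h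
    obtain ⟨-, L, k₁, k₂, k₃⟩ := single_support_of_ap h1
    obtain rfl := k₁.resolve_left one_ne_zero
    obtain rfl := k₂.resolve_left one_ne_zero
    obtain rfl := k₃.resolve_left one_ne_zero
    exact ⟨_, C.pt_mem_edge _ hs₁, C.pt_mem_edge _ hs₂, C.pt_mem_edge _ hs₃⟩
  · intro S h2 _ e₀ he₀
    obtain ⟨e, he, hne⟩ := Finset.exists_mem_ne h2 e₀
    refine ⟨e, he, hne, ?_⟩
    rintro _ _ ⟨⟨s, hs, rfl⟩, e', _, hne', ⟨s', hs', h⟩⟩ _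
    exact absurd (hinj _ _ _ _ h).1 hne'
  · intro j j' s _ s' _ h _
    exact (hinj _ _ _ _ h).1
  · intro κ χ σ _
    exact ⟨id, fun _ => none, fun _ => rfl, by simp⟩

/-- The finite set of points on which the auxiliary functional has to be injective. -/
def controlSet (P : LineFamily) (X G : Finset ℚ) : Set P.V :=
  P.pts X ∪ P.pts G ∪ (fun z : P.V × P.V => z.2 + z.2 - z.1) '' (P.pts X ×ˢ P.pts X) ∪
    (fun z : P.V × P.V => (1 / 2 : ℚ) • (z.1 + z.2)) '' (P.pts X ×ˢ P.pts X)

theorem controlSet_finite (P : LineFamily) (X G : Finset ℚ) : (P.controlSet X G).Finite := by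
  have h := (P.pts_finite X).prod (P.pts_finite X)
  exact (((P.pts_finite X).union (P.pts_finite G)).union (h.image _)).union (h.image _)

theorem IsPartite.exists_amalgamable {g : ℕ} (hg : RobustSparse g) {P : LineFamily}
    {X G : Finset ℚ} {J₀ : Type} {b d : J₀ → ℚ} (hd : ∀ a, d a ≠ 0) {D : Finset ℚ}
    {K : ℕ} {π : P.V →ₗ[ℚ] ℚ} {lab : P.J → J₀} (hP : P.IsPartite X G b d g D K π lab)
    (x : ℚ) (K' : ℕ) : ∃ (f : P.V →ₗ[ℚ] ℚ) (W : LineFamily) (X' G' : Finset ℚ),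
      Amalgamable P X π f x W X' G' (P.controlSet X G) ∧ W.Robust X' K' ∧
      SparseSystem (W.edge X') g ∧ ∀ t ∈ X', ∃ v ∈ P.pts X, π v = x ∧ f v = t := by
  obtain ⟨f, hf⟩ := exists_linear_injOn (P.controlSet_finite X G)
  have hsub : P.pts X ⊆ P.controlSet X G := fun v hv => Or.inl (Or.inl (Or.inl hv))
  have hrefl : ∀ p ∈ P.pts X, ∀ q ∈ P.pts X, q + q - p ∈ P.controlSet X G :=
    fun p hp q hq => Or.inl (Or.inr ⟨(p, q), ⟨hp, hq⟩, rfl⟩)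
  have hmid : ∀ p ∈ P.pts X, ∀ q ∈ P.pts X, (1 / 2 : ℚ) • (p + q) ∈ P.controlSet X G :=
    fun p hp q hq => Or.inr ⟨(p, q), ⟨hp, hq⟩, rfl⟩
  have hfin1 : {v ∈ P.pts X | π v = x}.Finite := (P.pts_finite X).subset fun v hv => hv.1
  have hfin2 : {v ∈ P.controlSet X G | v ∉ P.pts X ∧ π v = x}.Finite :=
    (P.controlSet_finite X G).subset fun v hv => hv.1
  have hX' : ∀ t, t ∈ (hfin1.image f).toFinset ↔ ∃ v ∈ P.pts X, π v = x ∧ f v = t := by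
    intro t
    simp only [Set.Finite.mem_toFinset, Set.mem_image, Set.mem_ofPred_eq, and_assoc]
  have hG' : ∀ t, t ∈ (hfin2.image f).toFinset ↔
      ∃ v ∈ P.controlSet X G, v ∉ P.pts X ∧ π v = x ∧ f v = t := by
    intro t
    simp only [Set.Finite.mem_toFinset, Set.mem_image, Set.mem_ofPred_eq, and_assoc]
  have hdisj : Disjoint (hfin1.image f).toFinset (hfin2.image f).toFinset := by
    rw [Finset.disjoint_left]
    intro t h1 h2
    obtain ⟨v, hv, -, rfl⟩ := (hX' t).1 h1
    obtain ⟨w, hw, hwn, -, hwv⟩ := (hG' _).1 h2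
    exact hwn (hf hw (hsub hv) hwv ▸ hv)
  have hap : AP3Free ((hfin1.image f).toFinset : Set ℚ) := by
    intro t₁ h₁ t₂ h₂ t₃ h₃ h
    obtain ⟨v₁, hv₁, hx₁, rfl⟩ := (hX' t₁).1 h₁
    obtain ⟨v₂, hv₂, hx₂, rfl⟩ := (hX' t₂).1 h₂
    obtain ⟨v₃, hv₃, -, rfl⟩ := (hX' t₃).1 h₃
    by_contra hne
    have h3 : v₂ + v₂ - v₁ = v₃ := by
      refine hf (hrefl v₁ hv₁ v₂ hv₂) (hsub hv₃) ?_
      rw [map_sub, map_add]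
      linear_combination -h
    obtain ⟨j, ⟨s, hs, rfl⟩, ⟨t, ht, rfl⟩, -⟩ := hP.induced v₁ hv₁ v₂ hv₂ v₃ hv₃
      (by rw [← h3]; abel) (fun h => hne (by rw [h]))
    rw [hP.proj_pt] at hx₁ hx₂
    have h4 := add_left_cancel (hx₁.trans hx₂.symm)
    exact hne (by rw [mul_right_cancel₀ (hd _) h4])
  obtain ⟨W, hWd, hWG, hWA, hWR, hWS⟩ := hg _ _ K' hdisj hap
  exact ⟨f, W, _, _,
    { dir_ne := fun j => by rw [hP.dir_eq]; exact hd _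
      pts_subset := hsub
      reflect_mem := hrefl
      midpoint_mem := hmid
      injOn := hf
      mem_fibre := fun v hv hx => (hX' _).2 ⟨v, hv, hx, rfl⟩
      mem_ghost := fun v hv hvn hx => (hG' _).2 ⟨v, hv, hvn, hx, rfl⟩
      nondegenerate := hWd
      ghost := hWG
      ap3Free := hWA }, hWR, hWS, fun t ht => (hX' t).1 ht⟩

theorem IsPartite.amalgam_ramsey {g : ℕ} {P : LineFamily} {X G X' G' : Finset ℚ} {J₀ : Type}
    {b d : J₀ → ℚ} {D : Finset ℚ} {K : ℕ} {π f : P.V →ₗ[ℚ] ℚ} {lab : P.J → J₀}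
    (hP : P.IsPartite X G b d g D (K + 1) π lab) {x : ℚ} (hx : x ∉ D) {W : LineFamily}
    {Q : Set P.V} (H : Amalgamable P X π f x W X' G' Q) (hW : W.Robust X' K)
    (hX' : ∀ t ∈ X', ∃ v ∈ P.pts X, π v = x ∧ f v = t) (κ : Type)
    (χ : (amalgam P π f x W).V → κ)
    (σ : (amalgam P π f x W).V → Finset (amalgam P π f x W).J) (hσ : ∀ v, (σ v).card ≤ K) :
    ∃ θ col, (amalgam P π f x W).IsUniformSection X b d (fun j => lab j.2) (insert x D)
      χ σ θ col := by
  obtain ⟨l, hl, hlσ⟩ := hW κ (fun w => χ (w, 0, x)) (fun w => (σ (w, 0, x)).image Prod.fst)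
    (fun w => Finset.card_image_le.trans (hσ _))
  let T : P.V → (amalgam P π f x W).V := lift P π f x W l
  have hT : ∀ v, π v = x → T v = (W.pt l (f v), 0, x) := by
    intro v hv
    simp only [T, lift, hv, sub_self, Pi.single_zero]
    rfl
  have hunspoiled : ∀ v ∈ P.pts X, π v = x → ∀ j, (l, j) ∉ σ (T v) := by
    intro v hv hvx j hj
    rw [hT v hvx] at hj
    exact hlσ _ (H.mem_fibre v hv hvx) (Finset.mem_image.2 ⟨_, hj, rfl⟩)
  obtain ⟨o, hsome, hnone⟩ : ∃ o : Option κ,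
      (∀ c, o = some c → ∀ v ∈ P.pts X, π v = x → χ (T v) = c) ∧
      (o = none → ∀ v ∈ P.pts X, π v = x → ∀ v' ∈ P.pts X, π v' = x →
        χ (T v) = χ (T v') → v = v') := by
    rcases hl with hmono | hrainbow
    · by_cases hne : ∃ v₀ ∈ P.pts X, π v₀ = x
      · obtain ⟨v₀, hv₀, hx₀⟩ := hne
        refine ⟨some (χ (T v₀)), ?_, by simp⟩
        rintro c ⟨rfl⟩ v hv hvx
        rw [hT v hvx, hT v₀ hx₀]
        exact hmono _ (H.mem_fibre v hv hvx) _ (H.mem_fibre v₀ hv₀ hx₀)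
      · exact ⟨none, by simp, fun _ v hv hvx => absurd ⟨v, hv, hvx⟩ hne⟩
    · refine ⟨none, by simp, fun _ v hv hvx v' hv' hvx' h => ?_⟩
      rw [hT v hvx, hT v' hvx'] at h
      exact H.injOn (H.pts_subset hv) (H.pts_subset hv')
        (hrainbow _ (H.mem_fibre v hv hvx) _ (H.mem_fibre v' hv' hvx') h)
  let σ₁ : P.V → Finset P.J := fun v => Finset.univ.filter fun j =>
    o = none ∧ ∃ s ∈ X, π (P.pt j s) = x ∧ χ (T (P.pt j s)) = χ (T v)
  let σ' : P.V → Finset P.J := fun v => (σ (T v)).image Prod.snd ∪ σ₁ v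
  have hσ₁ : ∀ v, (σ₁ v).card ≤ 1 := by
    intro v
    rw [Finset.card_le_one]
    intro j hj j' hj'
    obtain ⟨-, ho, s, hs, hsx, hsc⟩ := Finset.mem_filter.1 hj
    obtain ⟨-, -, s', hs', hsx', hsc'⟩ := Finset.mem_filter.1 hj'
    refine hP.separated j j' s hs s' hs' ?_ (by rw [hsx]; exact hx)
    exact hnone ho _ (P.pt_mem_pts j hs) hsx _ (P.pt_mem_pts j' hs') hsx' (hsc.trans hsc'.symm)
  have hσ' : ∀ v, (σ' v).card ≤ K + 1 := fun v =>
    (Finset.card_union_le _ _).trans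
      (add_le_add (Finset.card_image_le.trans (hσ _)) (hσ₁ v))
  obtain ⟨θ, col, hlab, hU⟩ := hP.ramsey κ (fun v => χ (T v)) σ' hσ'
  have hproj : ∀ a s y, b a + s * d a = y → π (P.pt (θ a) s) = y := by
    intro a s y h
    rw [hP.proj_pt, hlab, h]
  have hcross : o = none → ∀ y ∈ D, ∀ a, ∀ s ∈ X, b a + s * d a = x → ∀ t ∈ X,
      b a + t * d a = y → χ (T (P.pt (θ a) s)) ≠ χ (T (P.pt (θ a) t)) := by
    intro ho y hy a s hs hsx t ht hty he
    refine (hU y hy).2.2.1 a t ht hty (Finset.mem_union_right _ ?_)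
    exact Finset.mem_filter.2 ⟨Finset.mem_univ _, ho, s, hs, hproj a s x hsx, he⟩
  have hpt : ∀ a s, (amalgam P π f x W).pt (l, θ a) s = T (P.pt (θ a) s) :=
    fun a s => amalgam_pt l (θ a) s
  have hcolx : Function.update col x o x = o := Function.update_self x o col
  have hcol : ∀ y ∈ D, Function.update col x o y = col y := fun y hy =>
    Function.update_of_ne (fun h : y = x => hx (by rwa [h] at hy)) o col
  refine ⟨fun a => (l, θ a), Function.update col x o, hlab, fun y hy => ?_⟩
  simp only [hpt]
  rcases Finset.mem_insert.1 hy with rfl | hyD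
  · rw [hcolx]
    refine ⟨?_, ?_, ?_, ?_⟩
    · intro c hc a s hs hsx
      exact hsome c hc _ (P.pt_mem_pts _ hs) (hproj a s _ hsx)
    · intro ho a s hs hsx a' s' hs' hsx' h
      have h1 := hnone ho _ (P.pt_mem_pts _ hs) (hproj a s _ hsx) _ (P.pt_mem_pts _ hs')
        (hproj a' s' _ hsx') h
      have h2 := hP.separated _ _ s hs s' hs' h1 (by rw [hproj a s _ hsx]; exact hx)
      rw [← hlab a, ← hlab a', h2]
    · intro a s hs hsx
      exact hunspoiled _ (P.pt_mem_pts _ hs) (hproj a s _ hsx) _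
    · intro z hz hne ho _
      rcases Finset.mem_insert.1 hz with rfl | hzD
      · exact absurd rfl hne
      · exact hcross ho z hzD
  · rw [hcol y hyD]
    obtain ⟨h1, h2, h3, h4⟩ := hU y hyD
    refine ⟨h1, h2, ?_, ?_⟩
    · intro a s hs hsy hmem
      exact h3 a s hs hsy (Finset.mem_union_left _ (Finset.mem_image.2 ⟨_, hmem, rfl⟩))
    · intro z hz hne hy0 hz0 a s hs hsy t ht htz
      rcases Finset.mem_insert.1 hz with rfl | hzD
      · rw [hcolx] at hz0
        exact (hcross hz0 y hyD a t ht htz s hs hsy).symm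
      · rw [hcol z hzD] at hz0
        exact h4 z hzD hne hy0 hz0 a s hs hsy t ht htz

theorem IsPartite.exists_insert {g : ℕ} (hg : RobustSparse g) {P : LineFamily}
    {X G : Finset ℚ} {J₀ : Type} {b d : J₀ → ℚ} (hd : ∀ a, d a ≠ 0) {D : Finset ℚ} {K : ℕ}
    {π : P.V →ₗ[ℚ] ℚ} {lab : P.J → J₀} (hP : P.IsPartite X G b d g D (K + 1) π lab) {x : ℚ}
    (hx : x ∉ D) :
    ∃ (C : LineFamily) (π : C.V →ₗ[ℚ] ℚ) (lab : C.J → J₀),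
      C.IsPartite X G b d g (insert x D) K π lab := by
  obtain ⟨f, W, X', G', H, hWR, hWS, hX'⟩ := hP.exists_amalgamable hg hd x K
  refine ⟨amalgam P π f x W,
    (LinearMap.snd ℚ (W.J → ℚ) ℚ).comp (LinearMap.snd ℚ W.V ((W.J → ℚ) × ℚ)),
    fun j => lab j.2, fun j => hP.base_eq j.2, fun j => hP.dir_eq j.2, ?_,
    H.induced hP.induced, H.sparse hP.sparse hWS, ?_, hP.amalgam_ramsey hx H hWR hX'⟩
  · rintro ⟨l, j⟩ q hq h
    rw [amalgam_pt] at h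
    exact hP.ghost j q hq
      (H.mem_of_lift_mem (Or.inl (Or.inl (Or.inr (P.pt_mem_pts j hq)))) h)
  · rintro ⟨l, j⟩ ⟨l', j'⟩ s hs s' hs' h hD
    rw [amalgam_pt] at hD
    rw [amalgam_pt, amalgam_pt] at h
    have hD' : π (P.pt j s) ∉ insert x D := hD
    rw [Finset.mem_insert, not_or] at hD'
    obtain rfl := Amalgamable.lift_index h hD'.1
    have h1 := H.lift_injOn (H.pts_subset (P.pt_mem_pts j hs))
      (H.pts_subset (P.pt_mem_pts j' hs')) h
    rw [hP.separated j j' s hs s' hs' h1 hD'.2]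

theorem exists_isPartite {g : ℕ} (hg : RobustSparse g) {X G : Finset ℚ} (hXG : Disjoint X G)
    {J₀ : Type} [Fintype J₀] {b d : J₀ → ℚ} (hd : ∀ a, d a ≠ 0) (D : Finset ℚ) :
    ∀ K, ∃ (C : LineFamily) (π : C.V →ₗ[ℚ] ℚ) (lab : C.J → J₀),
      C.IsPartite X G b d g D K π lab := by
  induction D using Finset.induction_on with
  | empty => exact exists_isPartite_empty hXG b d g
  | insert x D hx ih =>
    intro K
    obtain ⟨P, π, lab, hP⟩ := ih (K + 1)
    exact hP.exists_insert hg hd hx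

end LineFamily

end

section

open scoped Classical

open LineFamily in
theorem RobustSparse.induced_succ {g : ℕ} (hg : RobustSparse g) :
    RobustSparseInduced (g + 1) := by
  intro X G K hXG
  obtain ⟨J, hJ, b, d, hd, hcan⟩ := exists_rational_canonical X
  let n := (X ×ˢ X).card + 1
  let D : Finset ℚ := (Finset.univ ×ˢ X).image fun p : J × ℚ => b p.1 + p.2 * d p.1
  have hD : ∀ j, ∀ s ∈ X, b j + s * d j ∈ D := fun j s hs =>
    Finset.mem_image.2 ⟨(j, s), Finset.mem_product.2 ⟨Finset.mem_univ _, hs⟩, rfl⟩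
  have hinj : ∀ j s t, b j + s * d j = b j + t * d j → s = t := fun j s t h =>
    mul_right_cancel₀ (hd j) (add_left_cancel h)
  obtain ⟨C, π, lab, hC⟩ := exists_isPartite hg hXG (J₀ := J × Fin n)
    (b := fun a => b a.1) (d := fun a => d a.1) (fun a => hd a.1) D K
  refine ⟨C, fun j h => ?_, hC.ghost, hC.induced, ?_, hC.sparse⟩
  · refine hd (lab j).1 ?_
    rw [← hC.dir_eq j, h, map_zero]
  intro κ χ σ hσ
  obtain ⟨θ, col, hlab, hU⟩ := hC.ramsey κ χ σ hσ
  let χ' : ℚ → κ ⊕ ℚ := fun y => (col y).elim (Sum.inr y) Sum.inl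
  have hsome : ∀ y c, col y = some c → χ' y = Sum.inl c := fun y c h => by simp [χ', h]
  have hnone : ∀ y, col y = none → χ' y = Sum.inr y := fun y h => by simp [χ', h]
  have hunspoiled : ∀ a, ∀ s ∈ X, θ a ∉ σ (C.pt (θ a) s) := fun a s hs =>
    (hU _ (hD a.1 s hs)).2.2.1 a s hs rfl
  have hfibre : ∀ a, ∀ s ∈ X, ∀ c, col (b a.1 + s * d a.1) = some c →
      χ (C.pt (θ a) s) = c := fun a s hs c hc => (hU _ (hD a.1 s hs)).1 c hc a s hs rfl
  obtain ⟨j, hmono | hrainbow⟩ := hcan _ χ'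
  · refine ⟨θ (j, 0), Or.inl fun s hs t ht => ?_, hunspoiled _⟩
    have h := hmono s hs t ht
    rcases hcs : col (b j + s * d j) with _ | c <;> rcases hct : col (b j + t * d j) with _ | c'
    · rw [hnone _ hcs, hnone _ hct] at h
      rw [hinj j s t (Sum.inr_injective h)]
    · rw [hnone _ hcs, hsome _ _ hct] at h
      cases h
    · rw [hsome _ _ hcs, hnone _ hct] at h
      cases h
    · rw [hsome _ _ hcs, hsome _ _ hct] at h
      rw [hfibre (j, 0) s hs c hcs, hfibre (j, 0) t ht c' hct, Sum.inl_injective h]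
  · by_contra hcon
    have hbad : ∀ m : Fin n, ∃ p : ℚ × ℚ, p ∈ X ×ˢ X ∧ ∃ c, col (b j + p.1 * d j) = some c ∧
        col (b j + p.2 * d j) = none ∧ χ (C.pt (θ (j, m)) p.2) = c := by
      intro m
      have h1 : ¬ ∀ s ∈ X, ∀ t ∈ X, χ (C.pt (θ (j, m)) s) = χ (C.pt (θ (j, m)) t) → s = t :=
        fun h => hcon ⟨θ (j, m), Or.inr h, hunspoiled _⟩
      push Not at h1
      obtain ⟨s, hs, t, ht, hst, hne⟩ := h1
      rcases hcs : col (b j + s * d j) with _ | c <;>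
        rcases hct : col (b j + t * d j) with _ | c'
      · exact absurd hst ((hU _ (hD j s hs)).2.2.2 _ (hD j t ht)
          (fun h => hne (hinj j s t h)) hcs hct (j, m) s hs rfl t ht rfl)
      · exact ⟨(t, s), Finset.mem_product.2 ⟨ht, hs⟩, c', hct, hcs,
          hst.trans (hfibre (j, m) t ht c' hct)⟩
      · exact ⟨(s, t), Finset.mem_product.2 ⟨hs, ht⟩, c, hcs, hct,
          hst.symm.trans (hfibre (j, m) s hs c hcs)⟩
      · rw [hfibre (j, m) s hs c hcs, hfibre (j, m) t ht c' hct] at hst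
        exact absurd (hrainbow s hs t ht (by rw [hsome _ _ hcs, hsome _ _ hct, hst])) hne
    choose p hp c hc hcn hχ using hbad
    obtain ⟨m, -, m', -, hmm, hpm⟩ := Finset.exists_ne_map_eq_of_card_lt_of_maps_to
      (s := (Finset.univ : Finset (Fin n))) (t := X ×ˢ X) (f := p)
      (by rw [Finset.card_univ, Fintype.card_fin]; exact Nat.lt_succ_self _)
      (fun m _ => hp m)
    have hcc : c m = c m' := by
      have h1 := hc m
      rw [hpm, hc m'] at h1
      exact (Option.some_injective _ h1).symm
    have ht := (Finset.mem_product.1 (hp m)).2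
    have h2 := (hU _ (hD j _ ht)).2.1 (hcn m) (j, m) _ ht rfl (j, m') _ ht rfl
      (by rw [hχ m, hcc, ← hχ m', hpm])
    exact hmm (congrArg Prod.snd h2)

theorem robustSparseInduced_of_three_le {g : ℕ} (hg : 3 ≤ g) : RobustSparseInduced g := by
  induction g, hg using Nat.le_induction with
  | base => exact robustSparse_two.induced_succ
  | succ g _ ih => exact ih.robustSparse.induced_succ

end

section

open scoped Classical

/-- Finitely many rationals become natural numbers after an affine change of variable. -/
theorem exists_affine_to_nat (F : Finset ℚ) :
    ∃ N c : ℚ, N ≠ 0 ∧ ∀ q ∈ F, ∃ n : ℕ, N * q + c = n := by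
  have hz : ∀ q ∈ F, ∃ z : ℤ, ((∏ r ∈ F, r.den : ℕ) : ℚ) * q = z := by
    intro q hq
    obtain ⟨m, hm⟩ := Finset.dvd_prod_of_mem Rat.den hq
    refine ⟨m * q.num, ?_⟩
    rw [hm]
    push_cast
    calc (q.den : ℚ) * m * q = m * (q * q.den) := by ring
      _ = m * q.num := by rw [Rat.mul_den_eq_num]
  choose! z hz using hz
  refine ⟨((∏ r ∈ F, r.den : ℕ) : ℚ), ((∑ r ∈ F, (z r).natAbs : ℕ) : ℚ), ?_, fun q hq => ?_⟩
  · exact Nat.cast_ne_zero.2 (Finset.prod_ne_zero_iff.2 fun r _ => r.den_nz)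
  · have h1 : (z q).natAbs ≤ ∑ r ∈ F, (z r).natAbs :=
      Finset.single_le_sum (f := fun r => (z r).natAbs) (fun _ _ => Nat.zero_le _) hq
    refine ⟨(z q + (∑ r ∈ F, (z r).natAbs : ℕ)).toNat, ?_⟩
    have h2 : 0 ≤ z q + (∑ r ∈ F, (z r).natAbs : ℕ) := by omega
    have h3 := congrArg (fun t : ℤ => (t : ℚ)) (Int.toNat_of_nonneg h2)
    simp only [Int.cast_natCast, Int.cast_add] at h3
    rw [h3, hz q hq]

/-- An injection of finitely many points of a rational vector space into `ℕ` that is the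
restriction of an affine map and reflects three-term progressions. -/
theorem LineFamily.exists_nat_embedding (C : LineFamily) (X : Finset ℚ) :
    ∃ (φ : C.V → ℕ), Set.InjOn φ (C.pts X) ∧
      (∀ u ∈ C.pts X, ∀ v ∈ C.pts X, ∀ w ∈ C.pts X, φ u + φ w = φ v + φ v → u + w = v + v) ∧
      ∀ j, ∃ α δ : ℚ, ∀ s ∈ X, (φ (C.pt j s) : ℚ) = α + s * δ := by
  obtain ⟨f, hf⟩ := exists_linear_injOn (C.controlSet_finite X ∅)
  have hsub : C.pts X ⊆ C.controlSet X ∅ := fun v hv => Or.inl (Or.inl (Or.inl hv))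
  obtain ⟨N, c, hN, hn⟩ := exists_affine_to_nat ((C.pts_finite X).image f).toFinset
  have hn' : ∀ v ∈ C.pts X, ∃ n : ℕ, N * f v + c = n := fun v hv =>
    hn _ ((Set.Finite.mem_toFinset _).2 ⟨v, hv, rfl⟩)
  choose! φ hφ using hn'
  refine ⟨φ, fun u hu v hv h => ?_, fun u hu v hv w hw h => ?_, fun j => ?_⟩
  · refine hf (hsub hu) (hsub hv) (mul_left_cancel₀ hN ?_)
    have h1 := hφ u hu
    rw [h, ← hφ v hv] at h1
    exact add_right_cancel h1
  · have h1 : (φ u : ℚ) + φ w = φ v + φ v := by exact_mod_cast h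
    rw [← hφ u hu, ← hφ v hv, ← hφ w hw] at h1
    have h2 : v + v - u = w := by
      refine hf (Or.inl (Or.inr ⟨(u, v), ⟨hu, hv⟩, rfl⟩)) (hsub hw) (mul_left_cancel₀ hN ?_)
      rw [map_sub, map_add]
      linear_combination -h1
    rw [← h2]
    abel
  · refine ⟨N * f (C.base j) + c, N * f (C.dir j), fun s hs => ?_⟩
    rw [← hφ _ (C.pt_mem_pts j hs), pt, map_add, map_smul, smul_eq_mul]
    ring

/-- A nonconstant arithmetic progression of naturals, read in increasing order. -/
theorem exists_increasing_reindex {k : ℕ} (hk : 2 ≤ k) {x : ℕ → ℕ} {α δ : ℚ}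
    (hx : ∀ i < k, (x i : ℚ) = α + i * δ) (hδ : x 0 ≠ x 1) :
    ∃ a d : ℕ, 1 ≤ d ∧ ∃ ρ : ℕ → ℕ, (∀ i < k, ρ i < k ∧ a + i * d = x (ρ i)) ∧
      ∀ i < k, ∀ j < k, ρ i = ρ j → i = j := by
  have h0 := hx 0 (by omega)
  have h1 := hx 1 (by omega)
  push_cast at h0 h1
  rcases lt_or_gt_of_ne hδ with hlt | hlt
  · refine ⟨x 0, x 1 - x 0, by omega, id, fun i hi => ⟨hi, ?_⟩, fun i _ j _ h => h⟩
    rw [← Nat.cast_inj (R := ℚ)]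
    push_cast [hlt.le]
    rw [id, hx i hi, h0, h1]
    ring
  · refine ⟨x (k - 1), x 0 - x 1, by omega, fun i => k - 1 - i,
      fun i hi => ⟨by dsimp only; omega, ?_⟩, fun i hi j hj h => by dsimp only at h; omega⟩
    have h2 : ((k - 1 - i : ℕ) : ℚ) = ((k - 1 : ℕ) : ℚ) - i := Nat.cast_sub (by omega)
    rw [← Nat.cast_inj (R := ℚ)]
    push_cast [hlt.le]
    rw [hx (k - 1) (by omega), hx (k - 1 - i) (by omega), h0, h1, h2]
    ring

theorem SparseSystem.edge_unique {V J : Type} {E : J → Set V} {g : ℕ} (h : SparseSystem E g)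
    (hg : 3 ≤ g) {i j : J} {p q : V} (hpq : p ≠ q) (hpi : p ∈ E i) (hqi : q ∈ E i)
    (hpj : p ∈ E j) (hqj : q ∈ E j) : i = j := by
  by_contra hij
  have hc : ({i, j} : Finset J).card = 2 := Finset.card_pair hij
  obtain ⟨e, he, hei, hl⟩ := h {i, j} hc.ge (by omega) i (by simp)
  obtain rfl : e = j := by simpa [hei] using he
  exact hpq (hl p q ⟨hpj, i, by simp, hij, hpi⟩ ⟨hqj, i, by simp, hij, hqi⟩)

/-- The parameters of the points of a `k`-term progression. -/
def rangeParams (k : ℕ) : Finset ℚ := (Finset.range k).image fun i : ℕ => (i : ℚ)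

theorem natCast_mem_rangeParams {k i : ℕ} (hi : i < k) : (i : ℚ) ∈ rangeParams k :=
  Finset.mem_image.2 ⟨i, Finset.mem_range.2 hi, rfl⟩

theorem LineFamily.isCanVdW_image {k : ℕ} (hk : 2 ≤ k) {C : LineFamily}
    (hd : C.Nondegenerate) (hR : C.Robust (rangeParams k) 0) {φ : C.V → ℕ}
    (hφ : Set.InjOn φ (C.pts (rangeParams k)))
    (hlin : ∀ j, ∃ α δ : ℚ, ∀ s ∈ rangeParams k, (φ (C.pt j s) : ℚ) = α + s * δ) :
    IsCanVdW k ((C.pts_finite (rangeParams k)).toFinset.image φ) := by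
  intro χ
  obtain ⟨j, hj, -⟩ := hR ℕ (fun v => χ (φ v)) (fun _ => ∅) (fun _ => by simp)
  obtain ⟨α, δ, hαδ⟩ := hlin j
  have hmem : ∀ i < k, (i : ℚ) ∈ rangeParams k := fun i hi => natCast_mem_rangeParams hi
  have h01 : φ (C.pt j (0 : ℕ)) ≠ φ (C.pt j (1 : ℕ)) := by
    intro h
    have h2 := C.pt_injective (hd j) (hφ (C.pt_mem_pts j (hmem 0 (by omega)))
      (C.pt_mem_pts j (hmem 1 (by omega))) h)
    norm_num at h2
  obtain ⟨a, d, hd1, ρ, hρ, hρinj⟩ := exists_increasing_reindex hk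
    (x := fun i => φ (C.pt j i)) (fun i hi => hαδ i (hmem i hi)) h01
  refine ⟨a, d, ⟨hd1, fun i hi => ?_⟩, ?_⟩
  · rw [(hρ i hi).2]
    exact Finset.mem_image_of_mem _ ((Set.Finite.mem_toFinset _).2
      (C.pt_mem_pts j (hmem _ (hρ i hi).1)))
  · rcases hj with hmono | hrainbow
    · refine Or.inl fun i hi i' hi' => ?_
      rw [(hρ i hi).2, (hρ i' hi').2]
      exact hmono _ (hmem _ (hρ i hi).1) _ (hmem _ (hρ i' hi').1)
    · refine Or.inr fun i hi i' hi' hne h => ?_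
      rw [(hρ i hi).2, (hρ i' hi').2] at h
      have h2 := hrainbow _ (hmem _ (hρ i hi).1) _ (hmem _ (hρ i' hi').1) h
      exact hne (hρinj i hi i' hi' (by exact_mod_cast h2))

theorem LineFamily.exists_edge_eq_of_kAPEdge {k g : ℕ} (hk : 3 ≤ k) (hg : 3 ≤ g)
    {C : LineFamily} (hI : C.Induced (rangeParams k))
    (hS : SparseSystem (C.edge (rangeParams k)) g) {φ : C.V → ℕ}
    (hrefl : ∀ u ∈ C.pts (rangeParams k), ∀ v ∈ C.pts (rangeParams k),
      ∀ w ∈ C.pts (rangeParams k), φ u + φ w = φ v + φ v → u + w = v + v) {s : Finset ℕ}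
    (hs : kAPEdge k ((C.pts_finite (rangeParams k)).toFinset.image φ) s) :
    ∃ j, s = (rangeParams k).image fun q => φ (C.pt j q) := by
  obtain ⟨a, d, hd, rfl, hsub⟩ := hs
  have hv : ∀ i, i < k → ∃ v ∈ C.pts (rangeParams k), φ v = a + i * d := by
    intro i hi
    obtain ⟨v, hv, h⟩ := Finset.mem_image.1
      (hsub (Finset.mem_image.2 ⟨i, Finset.mem_range.2 hi, rfl⟩))
    exact ⟨v, (Set.Finite.mem_toFinset _).1 hv, h⟩
  choose! v hv hφv using hv
  have hne : ∀ i, i + 1 < k → v i ≠ v (i + 1) := by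
    intro i hi h
    have h1 := hφv i (by omega)
    rw [h, hφv (i + 1) hi, add_mul] at h1
    omega
  have htriple : ∀ i, i + 2 < k → ∃ j, v i ∈ C.edge (rangeParams k) j ∧
      v (i + 1) ∈ C.edge (rangeParams k) j ∧ v (i + 2) ∈ C.edge (rangeParams k) j := by
    intro i hi
    refine hI _ (hv i (by omega)) _ (hv (i + 1) (by omega)) _ (hv (i + 2) hi) ?_
      (hne i (by omega))
    refine hrefl _ (hv i (by omega)) _ (hv (i + 1) (by omega)) _ (hv (i + 2) hi) ?_
    rw [hφv i (by omega), hφv (i + 1) (by omega), hφv (i + 2) hi]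
    ring
  obtain ⟨j, hj⟩ := htriple 0 (by omega)
  have hall : ∀ i, i + 2 < k → v i ∈ C.edge (rangeParams k) j ∧
      v (i + 1) ∈ C.edge (rangeParams k) j ∧ v (i + 2) ∈ C.edge (rangeParams k) j := by
    intro i
    induction i with
    | zero => exact fun _ => hj
    | succ i ih =>
      intro hi
      obtain ⟨-, h1, h2⟩ := ih (by omega)
      obtain ⟨j', h3, h4, h5⟩ := htriple (i + 1) hi
      obtain rfl := hS.edge_unique hg (hne (i + 1) (by omega)) h1 h2 h3 h4
      exact ⟨h3, h4, h5⟩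
  have hedge : ∀ i < k, v i ∈ C.edge (rangeParams k) j := by
    intro i hi
    by_cases h : i + 2 < k
    · exact (hall i h).1
    · obtain ⟨_, h1, h2⟩ := hall (k - 3) (by omega)
      by_cases h3 : i + 1 < k
      · rwa [show k - 3 + 1 = i by omega] at h1
      · rwa [show k - 3 + 2 = i by omega] at h2
  refine ⟨j, Finset.eq_of_subset_of_card_le ?_ ?_⟩
  · intro n hn
    obtain ⟨i, hi, rfl⟩ := Finset.mem_image.1 hn
    obtain ⟨q, hq, hqv⟩ := hedge i (Finset.mem_range.1 hi)
    refine Finset.mem_image.2 ⟨q, hq, ?_⟩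
    rw [hqv, hφv i (Finset.mem_range.1 hi)]
  · have h1 : (kAPFinset k a d).card = k := by
      rw [kAPFinset, Finset.card_image_of_injective, Finset.card_range]
      intro i i' h
      exact Nat.eq_of_mul_eq_mul_right hd (add_left_cancel h)
    rw [h1]
    exact Finset.card_image_le.trans (Finset.card_image_le.trans (Finset.card_range k).le)

theorem exists_cycSucc_eq {ℓ : ℕ} (i : Fin ℓ) : ∃ i', cycSucc i' = i := by
  have hi := i.2
  refine ⟨⟨(i.1 + (ℓ - 1)) % ℓ, Nat.mod_lt _ i.pos⟩, Fin.ext ?_⟩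
  change ((i.1 + (ℓ - 1)) % ℓ + 1) % ℓ = i.1
  rw [Nat.mod_add_mod, show i.1 + (ℓ - 1) + 1 = i.1 + ℓ by omega, Nat.add_mod_right,
    Nat.mod_eq_of_lt hi]

theorem cycSucc_ne {ℓ : ℕ} (hℓ : 2 ≤ ℓ) (i : Fin ℓ) : cycSucc i ≠ i := by
  intro h
  have h1 : (i.1 + 1) % ℓ = i.1 := congrArg Fin.val h
  have hi := i.2
  by_cases h2 : i.1 + 1 < ℓ
  · rw [Nat.mod_eq_of_lt h2] at h1
    omega
  · rw [show i.1 + 1 = ℓ by omega, Nat.mod_self] at h1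
    omega

/-- A cycle in the image of a sparse system is at least as long as the sparsity parameter. -/
theorem SparseSystem.not_isCycle {V J : Type} {E : J → Set V} {g : ℕ} (h : SparseSystem E g)
    {φ : V → ℕ} (hφ : Set.InjOn φ (⋃ j, E j)) {P : Finset ℕ → Prop}
    (hP : ∀ s, P s → ∃ j, (s : Set ℕ) = φ '' E j) {ℓ : ℕ} (hℓ : 2 ≤ ℓ) (hg : ℓ < g)
    (e : Fin ℓ → Finset ℕ) (v : Fin ℓ → ℕ) : ¬ IsCycle P e v := by
  rintro ⟨-, he, hv, hcyc⟩
  choose j hj using fun i => hP (e i) (hcyc i).1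
  have hjinj : Function.Injective j := by
    intro i i' hii
    apply he
    rw [← Finset.coe_inj, hj i, hj i', hii]
  have hcard : (Finset.univ.image j).card = ℓ := by
    rw [Finset.card_image_of_injective _ hjinj, Finset.card_univ, Fintype.card_fin]
  obtain ⟨_, hmem, -, hleaf⟩ := h (Finset.univ.image j) (by omega) (by omega)
    (j ⟨0, by omega⟩) (Finset.mem_image_of_mem _ (Finset.mem_univ _))
  obtain ⟨i, -, rfl⟩ := Finset.mem_image.1 hmem
  obtain ⟨i', rfl⟩ := exists_cycSucc_eq i
  have hpoint : ∀ i, ∃ p, φ p = v i ∧ p ∈ E (j i) ∧ p ∈ E (j (cycSucc i)) := by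
    intro i
    have h1 : v i ∈ (e i : Set ℕ) := (hcyc i).2.1
    have h2 : v i ∈ (e (cycSucc i) : Set ℕ) := (hcyc i).2.2
    rw [hj] at h1 h2
    obtain ⟨p, hp, hpv⟩ := h1
    obtain ⟨q, hq, hqv⟩ := h2
    obtain rfl := hφ (Set.mem_iUnion.2 ⟨_, hp⟩) (Set.mem_iUnion.2 ⟨_, hq⟩) (hpv.trans hqv.symm)
    exact ⟨p, hpv, hp, hq⟩
  obtain ⟨p, hpv, hp1, hp2⟩ := hpoint i'
  obtain ⟨q, hqv, hq1, hq2⟩ := hpoint (cycSucc i')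
  have hpq := hleaf p q
    ⟨hp2, _, Finset.mem_image_of_mem _ (Finset.mem_univ i'),
      fun hh => cycSucc_ne hℓ i' (hjinj hh).symm, hp1⟩
    ⟨hq1, _, Finset.mem_image_of_mem _ (Finset.mem_univ (cycSucc (cycSucc i'))),
      fun hh => cycSucc_ne hℓ _ (hjinj hh), hq2⟩
  rw [hpq, hqv] at hpv
  exact cycSucc_ne hℓ i' (hv hpv)

end

theorem sparse_canonical_vdw_high_girth :
    ∀ k g : ℕ, 3 ≤ k → 2 ≤ g → ∃ A : Finset ℕ, IsCanVdW k A ∧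
      ∀ ℓ : ℕ, 2 ≤ ℓ → ℓ < g →
        ∀ (e : Fin ℓ → Finset ℕ) (v : Fin ℓ → ℕ), ¬ IsCycle (kAPEdge k A) e v := by
  classical
  intro k g hk _
  obtain ⟨C, hd, -, hI, hR, hS⟩ := robustSparseInduced_of_three_le (le_max_right g 3)
    (rangeParams k) ∅ 0 (Finset.disjoint_empty_right _)
  obtain ⟨φ, hφ, hrefl, hlin⟩ := C.exists_nat_embedding (rangeParams k)
  refine ⟨_, LineFamily.isCanVdW_image (by omega) hd hR hφ hlin,
    fun ℓ hℓ hg e v => hS.not_isCycle (φ := φ) ?_ ?_ hℓ (lt_max_of_lt_left hg) e v⟩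
  · refine hφ.mono fun p hp => ?_
    obtain ⟨j, hj⟩ := Set.mem_iUnion.1 hp
    exact ⟨j, hj⟩
  · intro s hs
    obtain ⟨j, rfl⟩ := LineFamily.exists_edge_eq_of_kAPEdge hk (le_max_right g 3) hI hS hrefl hs
    refine ⟨j, ?_⟩
    ext n
    simp [LineFamily.edge]
end
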